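/- (Stong) Let M_m = (1/m!) · Σ_{σ ∈ Sym([m])} ord(σ) be the average order of a uniform random permutation of [m]. Then log M_m = β_0 · √(m/log m) + O(√m · log log m / log m) as m → ∞, where β_0 = √(8I) and I = ∫_0^∞ log log(e/(1−e^{−t})) dt. -/

import Mathlib

open scoped Classical
open Function

namespace IterMap

noncomputable section

/-- A vertex `v` is cyclic for `f` if some positive iterate of `f` fixes `v`. -/
def IsCyclic {n : ℕ} (f : Fin n → Fin n) (v : Fin n) : Prop :=
  ∃ t, 0 < t ∧ f^[t] v = v

theorem isCyclic_apply {n : ℕ} {f : Fin n → Fin n} {v : Fin n} (h : IsCyclic f v) :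
    IsCyclic f (f v) := by
  obtain ⟨t, ht, hv⟩ := h
  refine ⟨t, ht, ?_⟩
  calc f^[t] (f v) = f^[t + 1] v := (Function.iterate_succ_apply f t v).symm
    _ = f (f^[t] v) := Function.iterate_succ_apply' f t v
    _ = f v := by rw [hv]

/-- The permutation induced by `f` on its cyclic vertices. -/
def cyclicPerm {n : ℕ} (f : Fin n → Fin n) :
    Equiv.Perm {v : Fin n // IsCyclic f v} :=
  Equiv.ofBijective (fun v => ⟨f v.1, isCyclic_apply v.2⟩) (by
    rw [← Finite.injective_iff_bijective]
    intro u v huv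
    have h1 : f u.1 = f v.1 := congrArg Subtype.val huv
    obtain ⟨s, hs, hsu⟩ := u.2
    obtain ⟨t, ht, htv⟩ := v.2
    have hu : f^[s * t] u.1 = u.1 := by
      rw [Function.iterate_mul]
      exact Function.iterate_fixed hsu t
    have hv : f^[s * t] v.1 = v.1 := by
      rw [mul_comm, Function.iterate_mul]
      exact Function.iterate_fixed htv s
    have hst : 0 < s * t := Nat.mul_pos hs ht
    obtain ⟨k, hk⟩ : ∃ k, s * t = k + 1 := ⟨s * t - 1, by omega⟩
    apply Subtype.ext
    calc u.1 = f^[s * t] u.1 := hu.symm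
      _ = f^[k] (f u.1) := by rw [hk, Function.iterate_succ_apply]
      _ = f^[k] (f v.1) := by rw [h1]
      _ = f^[s * t] v.1 := by rw [hk, Function.iterate_succ_apply]
      _ = v.1 := hv)

/-- `T f`: the (eventual) period of the sequence of iterates of `f`. -/
def T {n : ℕ} (f : Fin n → Fin n) : ℕ :=
  sInf {T : ℕ | 0 < T ∧ ∀ m, n ≤ m → f^[m + T] = f^[m]}

/-- `B f`: the product of the lengths of the cycles of `f`. -/
def B {n : ℕ} (f : Fin n → Fin n) : ℕ :=
  (cyclicPerm f).cycleType.prod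

/-- `Z f`: the number of cyclic vertices of `f`. -/
def Z {n : ℕ} (f : Fin n → Fin n) : ℕ :=
  Nat.card {v : Fin n // IsCyclic f v}

/-- `O f`: the number of distinct positive iterates of `f`. -/
def O {n : ℕ} (f : Fin n → Fin n) : ℕ :=
  Nat.card {g : Fin n → Fin n // ∃ t, 0 < t ∧ g = f^[t]}

/-- `f` is connected if its functional graph has one weak component. -/
def Connected {n : ℕ} (f : Fin n → Fin n) : Prop :=
  ∀ u v : Fin n, ∃ s t : ℕ, f^[s] u = f^[t] v

/-- The set of connected mappings on `[n]`. -/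
def Un (n : ℕ) : Finset (Fin n → Fin n) :=
  Finset.univ.filter fun f => Connected f

/-- `kappa n`: the average cycle length of a uniform random connected mapping. -/
def kappa (n : ℕ) : ℝ :=
  (∑ f ∈ Un n, (Z f : ℝ)) / (Un n).card

def c (d : ℕ) : ℝ :=
  ((kappa d - 1) / d) * Real.exp (-(d : ℝ)) *
    ∑ k ∈ Finset.range d, (d : ℝ) ^ k / (k.factorial : ℝ)

def F (z : ℝ) : ℝ := (1 / (1 - z)) * Real.exp (∑' d : ℕ, c d * z ^ d)

def mu (m : ℕ) : ℝ := iteratedDeriv m F 0 / (m.factorial : ℝ)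

def g (s : ℝ) : ℝ := ∑' d : ℕ, c d * Real.exp (-(d : ℝ) * s)

/-- `M m`: the average order of a uniform random permutation of `[m]`. -/
def M (m : ℕ) : ℝ :=
  (∑ σ : Equiv.Perm (Fin m), (orderOf σ : ℝ)) / (m.factorial : ℝ)

def I : ℝ :=
  ∫ t in Set.Ioi (0 : ℝ), Real.log (Real.log (Real.exp 1 / (1 - Real.exp (-t))))

def beta0 : ℝ := Real.sqrt (8 * I)

def k0 : ℝ := (3 / 2) * (3 * I) ^ ((2 : ℝ) / 3)

end

end IterMap

namespace SAux
open Complex Filter Topology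

noncomputable def eT (n : ℕ) (s : ℂ) : ℂ :=
  (s - 1) * (n : ℂ) ^ (-s) + ((n + 1 : ℕ) : ℂ) ^ (1 - s) - (n : ℂ) ^ (1 - s)

lemma cpow_diff_bound {n : ℕ} (hn : 0 < n) {s : ℂ} (hs : 0 < s.re) {u : ℝ}
    (hu : u ∈ Set.Icc (n : ℝ) (n + 1)) :
    ‖((u : ℝ) : ℂ) ^ (-s) - ((n : ℝ) : ℂ) ^ (-s)‖ ≤ ‖s‖ * (n : ℝ) ^ (-s.re - 1) := by
  have hn' : (0 : ℝ) < n := by exact_mod_cast hn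
  have hs0 : s ≠ 0 := by rintro rfl; simp at hs
  have key := Convex.norm_image_sub_le_of_norm_hasDerivWithin_le (𝕜 := ℝ)
    (f := fun y : ℝ => (y : ℂ) ^ (-s)) (f' := fun y : ℝ => (-s) * (y : ℂ) ^ (-s - 1))
    (s := Set.Icc (n : ℝ) (n + 1)) (x := n) (y := u) (C := ‖s‖ * (n : ℝ) ^ (-s.re - 1))
    (fun x hx => (hasDerivAt_ofReal_cpow_const (by linarith [hx.1]) (neg_ne_zero.mpr hs0)).hasDerivWithinAt)
    (fun x hx => by
      rw [norm_mul, norm_neg, Complex.norm_cpow_eq_rpow_re_of_pos (by linarith [hx.1])]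
      gcongr
      simp only [sub_re, neg_re, one_re]
      exact Real.rpow_le_rpow_of_nonpos hn' hx.1 (by linarith))
    (convex_Icc _ _) (by simp) hu
  refine key.trans ?_
  have : ‖u - (n : ℝ)‖ ≤ 1 := by
    rw [Real.norm_eq_abs, abs_le]; constructor <;> linarith [hu.1, hu.2]
  calc _ ≤ ‖s‖ * (n : ℝ) ^ (-s.re - 1) * 1 := by gcongr
    _ = _ := mul_one _

lemma eT_bound {n : ℕ} (hn : 0 < n) {s : ℂ} (hs : 0 < s.re) :
    ‖eT n s‖ ≤ ‖s - 1‖ * ‖s‖ * (n : ℝ) ^ (-s.re - 1) := by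
  have hn' : (0 : ℝ) < n := by exact_mod_cast hn
  by_cases h1 : s = 1
  · subst h1; simp [eT]
  have key := Convex.norm_image_sub_le_of_norm_hasDerivWithin_le (𝕜 := ℝ)
    (f := fun y : ℝ => (s - 1) * ((n : ℝ) : ℂ) ^ (-s) * y + (y : ℂ) ^ (1 - s))
    (f' := fun y : ℝ => (s - 1) * ((n : ℝ) : ℂ) ^ (-s) * 1 + (1 - s) * (y : ℂ) ^ (1 - s - 1))
    (s := Set.Icc (n : ℝ) (n + 1)) (x := n) (y := n + 1)
    (C := ‖s - 1‖ * (‖s‖ * (n : ℝ) ^ (-s.re - 1)))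
    (fun x hx => by
      apply HasDerivAt.hasDerivWithinAt
      exact ((HasDerivAt.ofReal_comp (hasDerivAt_id x)).const_mul _).add
        (hasDerivAt_ofReal_cpow_const (by linarith [hx.1]) (sub_ne_zero.mpr (Ne.symm h1))))
    (fun x hx => by
      have : (s - 1) * ((n : ℝ) : ℂ) ^ (-s) * 1 + (1 - s) * (x : ℂ) ^ (1 - s - 1)
        = - ((s - 1) * ((x : ℂ) ^ (-s) - ((n : ℝ) : ℂ) ^ (-s))) := by
        rw [show (1 - s - 1 : ℂ) = -s by ring]; ring
      rw [this, norm_neg, norm_mul]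
      gcongr
      exact cpow_diff_bound hn hs hx)
    (convex_Icc _ _) (by simp) (by simp)
  have e : ‖(n : ℝ) + 1 - n‖ = 1 := by simp
  rw [e, mul_one] at key
  rw [mul_assoc]
  refine le_of_eq_of_le ?_ key
  congr 1
  simp only [eT]
  push_cast
  ring

lemma eT_differentiable {n : ℕ} (hn : 0 < n) : Differentiable ℂ (eT n) := by
  have hn' : (n : ℂ) ≠ 0 := by exact_mod_cast hn.ne'
  have hn1 : ((n + 1 : ℕ) : ℂ) ≠ 0 := by exact_mod_cast (Nat.succ_ne_zero n)
  intro s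
  unfold eT
  refine DifferentiableAt.sub (DifferentiableAt.add (DifferentiableAt.mul (by fun_prop) ?_) ?_) ?_
  · exact DifferentiableAt.const_cpow (by fun_prop) (Or.inl hn')
  · exact DifferentiableAt.const_cpow (by fun_prop) (Or.inl hn1)
  · exact DifferentiableAt.const_cpow (by fun_prop) (Or.inl hn')

lemma summable_shift {a : ℝ} (ha : a < -1) : Summable fun n : ℕ => ((n + 1 : ℕ) : ℝ) ^ a :=
  (summable_nat_add_iff 1).mpr (Real.summable_nat_rpow.mpr ha)

lemma eT_summable {s : ℂ} (hs : 0 < s.re) : Summable fun n : ℕ => eT (n + 1) s := by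
  refine Summable.of_norm_bounded (g := fun n : ℕ => ‖s - 1‖ * ‖s‖ * ((n + 1 : ℕ) : ℝ) ^ (-s.re - 1))
    ((summable_shift (by linarith)).mul_left _) fun n => eT_bound n.succ_pos hs

lemma eT_partial (N : ℕ) (s : ℂ) : ∑ n ∈ Finset.range N, eT (n + 1) s =
    (s - 1) * ∑ n ∈ Finset.range N, ((n + 1 : ℕ) : ℂ) ^ (-s) + ((N + 1 : ℕ) : ℂ) ^ (1 - s) - 1 := by
  induction N with
  | zero => simp
  | succ N ih =>
    rw [Finset.sum_range_succ, ih, Finset.sum_range_succ]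
    simp only [eT]; push_cast; ring

lemma zeta1_of_one_lt {s : ℂ} (hs : 1 < s.re) :
    riemannZeta₁ s = 1 + ∑' n : ℕ, eT (n + 1) s := by
  have hs1 : s ≠ 1 := by rintro rfl; simp at hs
  have h1 := (eT_summable (s := s) (by linarith)).hasSum.tendsto_sum_nat
  have h2 : Tendsto (fun N : ℕ => ∑ n ∈ Finset.range N, ((n + 1 : ℕ) : ℂ) ^ (-s)) atTop
      (𝓝 (riemannZeta s)) := by
    have hsum : Summable fun n : ℕ => ((n + 1 : ℕ) : ℂ) ^ (-s) := by
      refine Summable.of_norm_bounded (summable_shift (a := -s.re) (by linarith)) fun n => ?_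
      rw [Complex.norm_natCast_cpow_of_pos n.succ_pos]; simp
    have := hsum.hasSum.tendsto_sum_nat
    rw [zeta_eq_tsum_one_div_nat_add_one_cpow hs]
    convert this using 4 with n
    rw [Complex.cpow_neg]; push_cast; simp
  have h3 : Tendsto (fun N : ℕ => ((N + 1 : ℕ) : ℂ) ^ (1 - s)) atTop (𝓝 0) := by
    rw [tendsto_zero_iff_norm_tendsto_zero]
    have : Tendsto (fun N : ℕ => ((N + 1 : ℕ) : ℝ) ^ (-(s.re - 1))) atTop (𝓝 0) :=
      ((tendsto_rpow_neg_atTop (by linarith)).comp tendsto_natCast_atTop_atTop).comp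
        (tendsto_add_atTop_nat 1)
    refine this.congr fun N => ?_
    rw [Complex.norm_natCast_cpow_of_pos N.succ_pos]; simp
  have h4 := ((h2.const_mul (s - 1)).add h3).sub_const 1
  have h5 := tendsto_nhds_unique (h1.congr fun N => eT_partial N s) h4
  rw [h5, riemannZeta₁, riemannZeta₀, if_neg hs1]
  have : s - 1 ≠ 0 := sub_ne_zero.mpr hs1
  field_simp
  ring

lemma zeta1_eq {s : ℂ} (hs : 0 < s.re) :
    riemannZeta₁ s = 1 + ∑' n : ℕ, eT (n + 1) s := by
  set δ := s.re / 2 with hδ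
  have hδ0 : 0 < δ := by positivity
  set R := ‖s‖ + 3 with hR
  let U : Set ℂ := {z | δ < z.re} ∩ Metric.ball 0 R
  have hUo : IsOpen U := (isOpen_lt continuous_const continuous_re).inter Metric.isOpen_ball
  have hUc : Convex ℝ U := (convex_halfSpace_re_gt δ).inter (convex_ball 0 R)
  have hd : DifferentiableOn ℂ (fun z => 1 + ∑' n : ℕ, eT (n + 1) z) U := by
    refine (differentiableOn_const 1).add ?_
    refine Complex.differentiableOn_tsum_of_summable_norm
      (u := fun n : ℕ => (R + 1) * R * ((n + 1 : ℕ) : ℝ) ^ (-δ - 1))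
      ((summable_shift (by linarith)).mul_left _)
      (fun n => (eT_differentiable n.succ_pos).differentiableOn) hUo ?_
    intro n z hz
    have hz1 : δ < z.re := hz.1
    have hz2 : ‖z‖ < R := by simpa using hz.2
    refine (eT_bound n.succ_pos (hδ0.trans hz1)).trans ?_
    gcongr
    · exact (norm_sub_le _ _).trans (by simp; exact hz2.le)
    · exact_mod_cast Nat.succ_le_succ (Nat.zero_le n)
  have ha := (hd.analyticOnNhd hUo)
  have hb : AnalyticOnNhd ℂ riemannZeta₁ U := fun z _ => differentiable_riemannZeta₁.analyticAt z
  have hz0 : ((2 + s.re : ℝ) : ℂ) ∈ U := by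
    refine ⟨?_, ?_⟩
    · show δ < ((2 + s.re : ℝ) : ℂ).re
      rw [ofReal_re]; linarith
    · rw [mem_ball_zero_iff, norm_real, Real.norm_eq_abs, abs_of_pos (by linarith)]
      have := Complex.abs_re_le_norm s
      have := le_abs_self s.re
      linarith
  refine hb.eqOn_of_preconnected_of_eventuallyEq ha hUc.isPreconnected hz0 ?_ ?_
  · have : {z : ℂ | 1 < z.re} ∈ 𝓝 ((2 + s.re : ℝ) : ℂ) := by
      refine (isOpen_lt continuous_const continuous_re).mem_nhds ?_
      show 1 < ((2 + s.re : ℝ) : ℂ).re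
      rw [ofReal_re]; linarith
    filter_upwards [this] with z hz using zeta1_of_one_lt hz
  · refine ⟨?_, ?_⟩
    · show δ < s.re
      linarith
    · rw [mem_ball_zero_iff]; linarith

lemma zeta1_eq_N {s : ℂ} (hs : 0 < s.re) (N : ℕ) :
    riemannZeta₁ s = (s - 1) * ∑ n ∈ Finset.range N, ((n + 1 : ℕ) : ℂ) ^ (-s)
      + ((N + 1 : ℕ) : ℂ) ^ (1 - s) + ∑' n : ℕ, eT (n + N + 1) s := by
  have h := (eT_summable hs).sum_add_tsum_nat_add N
  rw [zeta1_eq hs, ← h, eT_partial]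
  ring

/-- Growth of zeta slightly to the left of the 1-line. -/
lemma zeta_growth : ∃ C : ℝ, 0 < C ∧ ∀ s : ℂ, 39 / 40 ≤ s.re → s.re ≤ 3 → 1 / 2 ≤ |s.im| →
    ‖riemannZeta s‖ ≤ C * (1 + |s.im|) ^ (1 / 20 : ℝ) := by
  set K : ℝ := ∑' n : ℕ, ((n + 1 : ℕ) : ℝ) ^ (-41 / 40 : ℝ) with hK
  have hKs : Summable fun n : ℕ => ((n + 1 : ℕ) : ℝ) ^ (-41 / 40 : ℝ) :=
    summable_shift (by norm_num)
  have hK0 : 0 ≤ K := tsum_nonneg fun n => by positivity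
  refine ⟨4 * K + 4 + 4 * K, by positivity, fun s h1 h3 ht => ?_⟩
  set τ : ℝ := 1 + |s.im| with hτ
  have hτ1 : 1 ≤ τ := by linarith [abs_nonneg s.im]
  set N : ℕ := ⌊τ⌋₊ with hN
  have hN1 : (N : ℝ) ≤ τ := Nat.floor_le (by linarith)
  have hN2 : τ < N + 1 := Nat.lt_floor_add_one τ
  have hre : 0 < s.re := by linarith
  have him : 1 / 2 ≤ ‖s - 1‖ := by
    have := Complex.abs_im_le_norm (s - 1)
    simp at this; linarith
  have hs1 : s ≠ 1 := by rintro rfl; norm_num at him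
  have hs1' : s - 1 ≠ 0 := sub_ne_zero.mpr hs1
  have hnorm : ‖s‖ ≤ 4 * τ := by
    have := Complex.norm_le_abs_re_add_abs_im s
    rw [abs_of_pos hre] at this
    linarith
  have e1 : riemannZeta s = ∑ n ∈ Finset.range N, ((n + 1 : ℕ) : ℂ) ^ (-s)
      + (((N + 1 : ℕ) : ℂ) ^ (1 - s) + ∑' n : ℕ, eT (n + N + 1) s) / (s - 1) := by
    have := zeta1_eq_N hre N
    rw [riemannZeta₁, riemannZeta₀, if_neg hs1] at this
    field_simp
    field_simp at this
    linear_combination this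
  have hτp : τ ^ (1 / 20 : ℝ) ≥ 1 := Real.one_le_rpow hτ1 (by norm_num)
  have b1 : ‖∑ n ∈ Finset.range N, ((n + 1 : ℕ) : ℂ) ^ (-s)‖ ≤ K * τ ^ (1 / 20 : ℝ) := by
    refine (norm_sum_le _ _).trans ?_
    have : ∀ n ∈ Finset.range N, ‖((n + 1 : ℕ) : ℂ) ^ (-s)‖ ≤
        ((n + 1 : ℕ) : ℝ) ^ (-41 / 40 : ℝ) * τ ^ (1 / 20 : ℝ) := by
      intro n hn
      rw [Complex.norm_natCast_cpow_of_pos n.succ_pos]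
      have hn1 : (1 : ℝ) ≤ ((n + 1 : ℕ) : ℝ) := by exact_mod_cast Nat.succ_le_succ (Nat.zero_le n)
      have hnN : ((n + 1 : ℕ) : ℝ) ≤ τ := by
        refine le_trans ?_ hN1
        exact_mod_cast Finset.mem_range.mp hn
      calc ((n + 1 : ℕ) : ℝ) ^ (-s).re ≤ ((n + 1 : ℕ) : ℝ) ^ (-41 / 40 + 1 / 20 : ℝ) := by
            apply Real.rpow_le_rpow_of_exponent_le hn1
            rw [neg_re]; linarith
        _ = ((n + 1 : ℕ) : ℝ) ^ (-41 / 40 : ℝ) * ((n + 1 : ℕ) : ℝ) ^ (1 / 20 : ℝ) :=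
            Real.rpow_add (by linarith) _ _
        _ ≤ _ := by gcongr
    refine (Finset.sum_le_sum this).trans ?_
    rw [← Finset.sum_mul]
    gcongr
    exact hKs.sum_le_tsum _ fun n _ => by positivity
  have b2 : ‖((N + 1 : ℕ) : ℂ) ^ (1 - s)‖ ≤ 2 * τ ^ (1 / 20 : ℝ) := by
    rw [Complex.norm_natCast_cpow_of_pos N.succ_pos]
    have hn1 : (1 : ℝ) ≤ ((N + 1 : ℕ) : ℝ) := by exact_mod_cast Nat.succ_le_succ (Nat.zero_le N)
    calc ((N + 1 : ℕ) : ℝ) ^ (1 - s).re ≤ ((N + 1 : ℕ) : ℝ) ^ (1 / 20 : ℝ) := by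
          apply Real.rpow_le_rpow_of_exponent_le hn1
          rw [sub_re, one_re]; linarith
      _ ≤ (2 * τ) ^ (1 / 20 : ℝ) := by
          gcongr
          push_cast; linarith
      _ = 2 ^ (1 / 20 : ℝ) * τ ^ (1 / 20 : ℝ) := Real.mul_rpow (by norm_num) (by linarith)
      _ ≤ _ := by
          gcongr
          calc (2 : ℝ) ^ (1 / 20 : ℝ) ≤ 2 ^ (1 : ℝ) :=
                Real.rpow_le_rpow_of_exponent_le (by norm_num) (by norm_num)
            _ = 2 := by norm_num
  have b3 : ‖∑' n : ℕ, eT (n + N + 1) s‖ ≤ ‖s - 1‖ * (4 * K * τ ^ (1 / 20 : ℝ)) := by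
    have hsum2 : Summable fun n : ℕ => ((n + 1 : ℕ) : ℝ) ^ (-41 / 40 : ℝ) *
        (‖s - 1‖ * (4 * τ ^ (1 / 20 : ℝ))) := hKs.mul_right _
    have hb := tsum_of_norm_bounded (f := fun n : ℕ => eT (n + N + 1) s) hsum2.hasSum ?_
    · refine hb.trans (le_of_eq ?_)
      rw [tsum_mul_right]; ring
    · intro n
      refine (eT_bound (Nat.succ_pos _) hre).trans ?_
      have hτN : τ ≤ ((n + N + 1 : ℕ) : ℝ) := by
        push_cast
        have : (0 : ℝ) ≤ n := Nat.cast_nonneg n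
        linarith
      have hbase : ((n + N + 1 : ℕ) : ℝ) ^ (-s.re - 1) ≤
          ((n + 1 : ℕ) : ℝ) ^ (-41 / 40 : ℝ) * τ ^ (-19 / 20 : ℝ) := by
        calc ((n + N + 1 : ℕ) : ℝ) ^ (-s.re - 1) ≤ ((n + N + 1 : ℕ) : ℝ) ^ (-41 / 40 + -19 / 20 : ℝ) := by
              apply Real.rpow_le_rpow_of_exponent_le (by linarith)
              linarith
          _ = ((n + N + 1 : ℕ) : ℝ) ^ (-41 / 40 : ℝ) * ((n + N + 1 : ℕ) : ℝ) ^ (-19 / 20 : ℝ) :=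
              Real.rpow_add (by linarith) _ _
          _ ≤ _ := by
              have i1 : ((n + N + 1 : ℕ) : ℝ) ^ (-41 / 40 : ℝ) ≤ ((n + 1 : ℕ) : ℝ) ^ (-41 / 40 : ℝ) := by
                apply Real.rpow_le_rpow_of_nonpos (by positivity) _ (by norm_num)
                push_cast
                have : (0 : ℝ) ≤ N := Nat.cast_nonneg N
                linarith
              have i2 : ((n + N + 1 : ℕ) : ℝ) ^ (-19 / 20 : ℝ) ≤ τ ^ (-19 / 20 : ℝ) :=
                Real.rpow_le_rpow_of_nonpos (by linarith) hτN (by norm_num)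
              gcongr
      have hτe : τ ^ (1 / 20 : ℝ) = τ * τ ^ (-19 / 20 : ℝ) := by
        rw [show (1 / 20 : ℝ) = 1 + -19 / 20 by norm_num, Real.rpow_add (by linarith), Real.rpow_one]
      calc ‖s - 1‖ * ‖s‖ * ((n + N + 1 : ℕ) : ℝ) ^ (-s.re - 1)
          ≤ ‖s - 1‖ * (4 * τ) * (((n + 1 : ℕ) : ℝ) ^ (-41 / 40 : ℝ) * τ ^ (-19 / 20 : ℝ)) := by
            gcongr
        _ = _ := by rw [hτe]; ring
  rw [e1, add_div]
  refine (norm_add_le _ _).trans ?_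
  have c2 : ‖((N + 1 : ℕ) : ℂ) ^ (1 - s) / (s - 1)‖ ≤ 4 * τ ^ (1 / 20 : ℝ) := by
    rw [norm_div, div_le_iff₀ (by linarith)]
    nlinarith
  have c3 : ‖(∑' n : ℕ, eT (n + N + 1) s) / (s - 1)‖ ≤ 4 * K * τ ^ (1 / 20 : ℝ) := by
    rw [norm_div, div_le_iff₀ (by linarith)]
    linarith
  have := norm_add_le (((N + 1 : ℕ) : ℂ) ^ (1 - s) / (s - 1)) ((∑' n : ℕ, eT (n + N + 1) s) / (s - 1))
  nlinarith [mul_nonneg hK0 (by linarith : (0:ℝ) ≤ τ ^ (1 / 20 : ℝ))]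

end SAux

namespace SAux
open Complex Filter Topology

lemma zeta_derivs_growth : ∃ C : ℝ, 1 ≤ C ∧ ∀ s : ℂ, 1 ≤ s.re → s.re ≤ 2 → 1 ≤ |s.im| →
    ‖riemannZeta s‖ ≤ C * (1 + |s.im|) ^ (1 / 20 : ℝ) ∧
    ‖deriv riemannZeta s‖ ≤ C * (1 + |s.im|) ^ (1 / 20 : ℝ) ∧
    ‖deriv (deriv riemannZeta) s‖ ≤ C * (1 + |s.im|) ^ (1 / 20 : ℝ) := by
  obtain ⟨C, hC, h⟩ := zeta_growth
  refine ⟨6400 * C + 1, by linarith, fun s h1 h2 ht => ?_⟩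
  set τ : ℝ := 1 + |s.im| with hτ
  have hτ1 : 1 ≤ τ := by linarith [abs_nonneg s.im]
  have hτp : τ ^ (1 / 20 : ℝ) ≥ 1 := Real.one_le_rpow hτ1 (by norm_num)
  have hball : ∀ z ∈ Metric.closedBall s (1 / 40), 39 / 40 ≤ z.re ∧ z.re ≤ 3 ∧ 1 / 2 ≤ |z.im| ∧
      |z.im| ≤ |s.im| + 1 := by
    intro z hz
    rw [Metric.mem_closedBall, dist_eq_norm] at hz
    have a1 := (Complex.abs_re_le_norm (z - s)).trans hz
    have a2 := (Complex.abs_im_le_norm (z - s)).trans hz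
    rw [sub_re, abs_le] at a1
    rw [sub_im] at a2
    have a3 := abs_sub_abs_le_abs_sub z.im s.im
    have a4 := abs_sub_abs_le_abs_sub s.im z.im
    rw [abs_sub_comm] at a4
    refine ⟨by linarith [a1.1], by linarith [a1.2], by linarith, by linarith⟩
  have hd : DifferentiableOn ℂ riemannZeta (Metric.closedBall s (1 / 40)) := by
    intro z hz
    refine (differentiableAt_riemannZeta ?_).differentiableWithinAt
    rintro rfl
    have := (hball 1 hz).2.2.1
    norm_num at this
  have hdc : DiffContOnCl ℂ riemannZeta (Metric.ball s (1 / 40)) := by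
    apply DifferentiableOn.diffContOnCl
    rwa [closure_ball _ (by norm_num)]
  have hsph : ∀ z ∈ Metric.sphere s (1 / 40), ‖riemannZeta z‖ ≤ 2 * C * τ ^ (1 / 20 : ℝ) := by
    intro z hz
    obtain ⟨b1, b2, b3, b4⟩ := hball z (Metric.sphere_subset_closedBall hz)
    refine (h z b1 b2 b3).trans ?_
    have : (1 + |z.im|) ^ (1 / 20 : ℝ) ≤ 2 * τ ^ (1 / 20 : ℝ) := by
      calc (1 + |z.im|) ^ (1 / 20 : ℝ) ≤ (2 * τ) ^ (1 / 20 : ℝ) := by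
            gcongr
            linarith [abs_nonneg s.im]
        _ = 2 ^ (1 / 20 : ℝ) * τ ^ (1 / 20 : ℝ) := Real.mul_rpow (by norm_num) (by linarith)
        _ ≤ _ := by
          gcongr
          calc (2 : ℝ) ^ (1 / 20 : ℝ) ≤ 2 ^ (1 : ℝ) :=
                Real.rpow_le_rpow_of_exponent_le (by norm_num) (by norm_num)
            _ = 2 := by norm_num
    nlinarith
  have hCt : 0 ≤ C * τ ^ (1 / 20 : ℝ) := by positivity
  have i1 := Complex.norm_iteratedDeriv_le_of_forall_mem_sphere_norm_le 1 (by norm_num) hdc hsph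
  have i2 := Complex.norm_iteratedDeriv_le_of_forall_mem_sphere_norm_le 2 (by norm_num) hdc hsph
  rw [iteratedDeriv_one] at i1
  rw [iteratedDeriv_succ, iteratedDeriv_one] at i2
  norm_num at i1 i2
  refine ⟨(h s (by linarith) (by linarith) (by linarith)).trans ?_, i1.trans ?_, i2.trans ?_⟩
  · nlinarith
  · nlinarith
  · nlinarith

lemma zeta_341 {x : ℝ} (hx : 0 < x) (y : ℝ) :
    1 ≤ ‖riemannZeta (1 + x)‖ ^ 3 * ‖riemannZeta (1 + x + I * y)‖ ^ 4 *
      ‖riemannZeta (1 + x + 2 * I * y)‖ := by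
  have := DirichletCharacter.norm_LFunction_product_ge_one (N := 1) 1 hx y
  simp only [DirichletCharacter.LFunctionTrivChar, DirichletCharacter.LFunction_modOne_eq,
    norm_mul, norm_pow] at this
  exact this

lemma zeta_real_bound : ∃ C : ℝ, 1 ≤ C ∧ ∀ x : ℝ, 0 < x → x ≤ 1 →
    ‖riemannZeta (1 + x)‖ ≤ C / x := by
  have hc : ContinuousOn (fun x : ℝ => riemannZeta₁ (1 + x)) (Set.Icc 0 1) := by
    have := differentiable_riemannZeta₁.continuous
    fun_prop
  obtain ⟨C, hC⟩ := isCompact_Icc.exists_bound_of_continuousOn hc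
  refine ⟨max C 1, le_max_right _ _, fun x hx hx1 => ?_⟩
  have hne : (1 + x : ℂ) ≠ 1 := by
    intro h
    have : (x : ℂ) = 0 := by linear_combination h
    exact hx.ne' (by exact_mod_cast this)
  have := hC x ⟨hx.le, hx1⟩
  rw [riemannZeta_eq_inv_sub_mul hne]
  rw [norm_mul, norm_inv, show (1 + x - 1 : ℂ) = ((x : ℝ) : ℂ) by ring, norm_real,
    Real.norm_eq_abs, abs_of_pos hx, div_eq_inv_mul]
  gcongr
  exact this.trans (le_max_left _ _)

lemma zeta_lower : ∃ c : ℝ, 0 < c ∧ ∀ s : ℂ, 1 < s.re → s.re ≤ 2 → 1 ≤ |s.im| →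
    c * (1 + |s.im|) ^ (-(1 / 5) : ℝ) ≤ ‖riemannZeta s‖ := by
  obtain ⟨C1, hC1, h1⟩ := zeta_derivs_growth
  obtain ⟨C2, hC2, h2⟩ := zeta_real_bound
  set C := max C1 C2 with hC
  have hCge : 1 ≤ C := hC1.trans (le_max_left _ _)
  set κ := 1 / (32 * C ^ 8) with hκ
  have hκ0 : 0 < κ := by positivity
  have hκ1 : κ ≤ 1 := by
    rw [hκ, div_le_one (by positivity)]
    nlinarith [one_le_pow₀ hCge (n := 8)]
  have hκC : κ * (32 * C ^ 8) = 1 := by rw [hκ]; field_simp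
  refine ⟨κ * C, by positivity, fun s hs1 hs2 ht => ?_⟩
  set τ : ℝ := 1 + |s.im| with hτ
  have hτ1 : 1 ≤ τ := by linarith [abs_nonneg s.im]
  have hτ0 : 0 < τ := by linarith
  set q := τ ^ (-(1 / 20) : ℝ) with hq
  have hq0 : 0 < q := by positivity
  have hq1 : q ≤ 1 := Real.rpow_le_one_of_one_le_of_nonpos hτ1 (by norm_num)
  have hqi : τ ^ (1 / 20 : ℝ) * q = 1 := by
    rw [hq, ← Real.rpow_add hτ0]; norm_num
  have hq4 : τ ^ (-(1 / 5) : ℝ) = q ^ 4 := by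
    rw [hq, ← Real.rpow_natCast, ← Real.rpow_mul hτ0.le]; norm_num
  rw [hq4]
  set η := κ * q ^ 5 with hη
  have hη0 : 0 < η := by positivity
  have hη1 : η ≤ 1 := mul_le_one₀ hκ1 (by positivity) (pow_le_one₀ hq0.le hq1)
  -- lower bound to the right of 1 + η
  have key : ∀ x : ℝ, η ≤ x → x ≤ 1 → 2 * κ * C * q ^ 4 ≤ ‖riemannZeta (1 + x + I * s.im)‖ := by
    intro x hx hx1
    have hx0 : 0 < x := hη0.trans_le hx
    have a := zeta_341 hx0 s.im
    have b := h2 x hx0 hx1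
    have c : ‖riemannZeta (1 + x + 2 * I * s.im)‖ ≤ 2 * C * τ ^ (1 / 20 : ℝ) := by
      have e : (1 + x + 2 * I * s.im : ℂ).im = 2 * s.im := by simp
      have e2 : (1 + x + 2 * I * s.im : ℂ).re = 1 + x := by simp
      have := (h1 (1 + x + 2 * I * s.im) (by rw [e2]; linarith) (by rw [e2]; linarith)
        (by rw [e, abs_mul, abs_two]; linarith)).1
      rw [e, abs_mul, abs_two] at this
      refine this.trans ?_
      have : (1 + 2 * |s.im|) ^ (1 / 20 : ℝ) ≤ 2 * τ ^ (1 / 20 : ℝ) := by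
        calc (1 + 2 * |s.im|) ^ (1 / 20 : ℝ) ≤ (2 * τ) ^ (1 / 20 : ℝ) := by
              gcongr
              linarith [abs_nonneg s.im]
          _ = 2 ^ (1 / 20 : ℝ) * τ ^ (1 / 20 : ℝ) := Real.mul_rpow (by norm_num) (by linarith)
          _ ≤ _ := by
            gcongr
            calc (2 : ℝ) ^ (1 / 20 : ℝ) ≤ 2 ^ (1 : ℝ) :=
                  Real.rpow_le_rpow_of_exponent_le (by norm_num) (by norm_num)
              _ = 2 := by norm_num
      calc _ ≤ C * (2 * τ ^ (1 / 20 : ℝ)) := by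
            gcongr
            exact le_max_left _ _
        _ = _ := by ring
    have d : ‖riemannZeta (1 + x)‖ ≤ C / η := b.trans (by
      gcongr
      exact le_max_right _ _)
    set Z := ‖riemannZeta (1 + x + I * s.im)‖ with hZ
    have hZ0 : 0 ≤ Z := norm_nonneg _
    have e : 1 ≤ (C / η) ^ 3 * Z ^ 4 * (2 * C * τ ^ (1 / 20 : ℝ)) := by
      refine a.trans ?_
      gcongr
    have f : η ^ 3 * q ≤ 2 * C ^ 4 * Z ^ 4 := by
      have := mul_le_mul_of_nonneg_right e (show 0 ≤ η ^ 3 * q by positivity)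
      rw [one_mul] at this
      refine this.trans (le_of_eq ?_)
      field_simp
      linear_combination (Z ^ 4) * hqi
    have g : (2 * κ * C * q ^ 4) ^ 4 ≤ Z ^ 4 := by
      have h3 : η ^ 3 * q = κ ^ 3 * q ^ 16 := by rw [hη]; ring
      rw [h3] at f
      have h4 : 2 * C ^ 4 * (2 * κ * C * q ^ 4) ^ 4 = κ ^ 3 * q ^ 16 * (κ * (32 * C ^ 8)) := by ring
      rw [hκC, mul_one] at h4
      have hC4 : 0 < 2 * C ^ 4 := by positivity
      nlinarith
    exact le_of_pow_le_pow_left₀ (by norm_num) hZ0 g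
  by_cases hc : η ≤ s.re - 1
  · have := key (s.re - 1) hc (by linarith)
    have e : (1 + ((s.re - 1 : ℝ) : ℂ) + I * s.im) = s := by
      conv_rhs => rw [← re_add_im s]
      push_cast; ring
    rw [e] at this
    refine le_trans ?_ this
    have : 0 ≤ κ * C * q ^ 4 := by positivity
    linarith
  · push Not at hc
    have k1 := key η le_rfl hη1
    set s' : ℂ := 1 + η + I * s.im with hs'
    have hseg : ∀ z ∈ segment ℝ s s', 1 ≤ z.re ∧ z.re ≤ 2 ∧ z.im = s.im := by
      have c1 : Convex ℝ ({z : ℂ | 1 ≤ z.re} ∩ {z : ℂ | z.re ≤ 2} ∩ {z : ℂ | s.im ≤ z.im} ∩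
          {z : ℂ | z.im ≤ s.im}) :=
        (((convex_halfSpace_re_ge 1).inter (convex_halfSpace_re_le 2)).inter
          (convex_halfSpace_im_ge _)).inter (convex_halfSpace_im_le _)
      intro z hz
      have := c1.segment_subset (x := s) (y := s') ⟨⟨⟨hs1.le, hs2⟩, le_refl s.im⟩, le_refl s.im⟩
        (by
          have r1 : s'.re = 1 + η := by simp [hs']
          have r2 : s'.im = s.im := by simp [hs']
          refine ⟨⟨⟨?_, ?_⟩, ?_⟩, ?_⟩ <;> simp only [Set.mem_ofPred_eq, r1, r2] <;> linarith) hz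
      exact ⟨this.1.1.1, this.1.1.2, le_antisymm this.2 this.1.2⟩
    have hmv := Convex.norm_image_sub_le_of_norm_hasDerivWithin_le (𝕜 := ℂ)
      (f := riemannZeta) (f' := deriv riemannZeta) (s := segment ℝ s s') (x := s) (y := s')
      (C := C * τ ^ (1 / 20 : ℝ))
      (fun z hz => by
        obtain ⟨_, _, z3⟩ := hseg z hz
        refine (differentiableAt_riemannZeta ?_).hasDerivAt.hasDerivWithinAt
        rintro rfl
        rw [← z3] at ht
        norm_num at ht)
      (fun z hz => by
        obtain ⟨z1, z2, z3⟩ := hseg z hz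
        have := (h1 z z1 z2 (by rw [z3]; exact ht)).2.1
        rw [z3] at this
        refine this.trans ?_
        gcongr
        exact le_max_left _ _)
      (convex_segment _ _) (left_mem_segment _ _ _) (right_mem_segment _ _ _)
    have hdist : ‖s' - s‖ ≤ η := by
      have : s' - s = ((1 + η - s.re : ℝ) : ℂ) := by
        conv_lhs => rw [← re_add_im s]
        rw [hs']; push_cast; ring
      rw [this, norm_real, Real.norm_eq_abs, abs_of_pos (by linarith)]
      linarith
    have hbd : C * τ ^ (1 / 20 : ℝ) * ‖s' - s‖ ≤ κ * C * q ^ 4 := by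
      calc C * τ ^ (1 / 20 : ℝ) * ‖s' - s‖ ≤ C * τ ^ (1 / 20 : ℝ) * η := by gcongr
        _ = κ * C * q ^ 4 * (τ ^ (1 / 20 : ℝ) * q) := by rw [hη]; ring
        _ = _ := by rw [hqi, mul_one]
    have := norm_sub_norm_le (riemannZeta s') (riemannZeta s)
    linarith

/-- `(ζ'/ζ)' + ζ'`. -/
noncomputable def DD (s : ℂ) : ℂ :=
  deriv (deriv riemannZeta) s / riemannZeta s - (deriv riemannZeta s / riemannZeta s) ^ 2
    + deriv riemannZeta s

lemma DD_bound_large : ∃ C : ℝ, 0 < C ∧ ∀ s : ℂ, 1 < s.re → s.re ≤ 2 → 1 ≤ |s.im| →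
    ‖DD s‖ ≤ C * (1 + |s.im|) ^ (1 / 2 : ℝ) := by
  obtain ⟨C, hC, h1⟩ := zeta_derivs_growth
  obtain ⟨c, hc, h2⟩ := zeta_lower
  refine ⟨C / c + (C / c) ^ 2 + C, by positivity, fun s hs1 hs2 ht => ?_⟩
  obtain ⟨-, g1, g2⟩ := h1 s hs1.le hs2 ht
  have l := h2 s hs1 hs2 ht
  set τ : ℝ := 1 + |s.im| with hτ
  have hτ1 : 1 ≤ τ := by linarith [abs_nonneg s.im]
  have hτ0 : 0 < τ := by linarith
  set p := τ ^ (1 / 4 : ℝ) with hp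
  have hp1 : 1 ≤ p := Real.one_le_rpow hτ1 (by norm_num)
  have hp2 : τ ^ (1 / 2 : ℝ) = p ^ 2 := by
    rw [hp, ← Real.rpow_natCast, ← Real.rpow_mul hτ0.le]; norm_num
  have hp3 : τ ^ (1 / 20 : ℝ) = p * τ ^ (-(1 / 5) : ℝ) := by
    rw [hp, ← Real.rpow_add hτ0]; norm_num
  have hp4 : τ ^ (1 / 20 : ℝ) ≤ p ^ 2 := by
    rw [← hp2]; exact Real.rpow_le_rpow_of_exponent_le hτ1 (by norm_num)
  have hl0 : 0 < c * τ ^ (-(1 / 5) : ℝ) := by positivity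
  have hdiv : ∀ w : ℂ, ‖w‖ ≤ C * τ ^ (1 / 20 : ℝ) → ‖w / riemannZeta s‖ ≤ C / c * p := by
    intro w hw
    rw [norm_div, div_le_iff₀ (hl0.trans_le l)]
    refine hw.trans ?_
    calc C * τ ^ (1 / 20 : ℝ) = C / c * p * (c * τ ^ (-(1 / 5) : ℝ)) := by
          rw [hp3]; field_simp
      _ ≤ _ := by gcongr
  have d1 := hdiv _ g1
  have d2 := hdiv _ g2
  rw [hp2]
  have hCc : 0 < C / c := by positivity
  calc ‖DD s‖ ≤ ‖deriv (deriv riemannZeta) s / riemannZeta s‖ +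
        ‖deriv riemannZeta s / riemannZeta s‖ ^ 2 + ‖deriv riemannZeta s‖ := by
        rw [← norm_pow]
        exact (norm_add_le _ _).trans (by gcongr; exact norm_sub_le _ _)
    _ ≤ C / c * p + (C / c * p) ^ 2 + C * τ ^ (1 / 20 : ℝ) := by gcongr
    _ ≤ C / c * p ^ 2 + (C / c * p) ^ 2 + C * p ^ 2 := by
        gcongr
        nlinarith
    _ = _ := by ring

lemma DD_bound_small : ∃ C : ℝ, 0 < C ∧ ∀ s : ℂ, 1 < s.re → s.re ≤ 2 → |s.im| ≤ 1 →
    ‖DD s‖ ≤ C := by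
  set z := riemannZeta₀ with hz
  have hz0 : Differentiable ℂ z := differentiable_riemannZeta₀
  have hz1 : Differentiable ℂ (deriv z) := fun x => (hz0.analyticAt x).deriv.differentiableAt
  have hz2 : Differentiable ℂ (deriv (deriv z)) :=
    fun x => (hz1.analyticAt x).deriv.differentiableAt
  let G : ℂ → ℂ := fun s => ((2 * deriv z s + (s - 1) * deriv (deriv z) s) * (1 + (s - 1) * z s)
    - (z s + (s - 1) * deriv z s) ^ 2) / (1 + (s - 1) * z s) ^ 2 + deriv z s
  have hnz : ∀ s : ℂ, 1 ≤ s.re → 1 + (s - 1) * z s ≠ 0 := by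
    intro s hs
    by_cases h : s = 1
    · simp [h]
    · have h1 := riemannZeta_ne_zero_of_one_le_re hs
      have h2 := riemannZeta_eq_inv_sub_mul h
      intro h3
      rw [h2] at h1
      apply h1
      rw [riemannZeta₁]
      simp [← hz, h3]
  have hK : IsCompact (Set.Icc (1 : ℝ) 2 ×ℂ Set.Icc (-1 : ℝ) 1) :=
    isCompact_Icc.reProdIm isCompact_Icc
  have hG : ContinuousOn G (Set.Icc (1 : ℝ) 2 ×ℂ Set.Icc (-1 : ℝ) 1) := by
    have c0 := hz0.continuous
    have c1 := hz1.continuous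
    have c2 := hz2.continuous
    refine ContinuousOn.add (ContinuousOn.div (by fun_prop) (by fun_prop) ?_) (by fun_prop)
    intro s hs
    exact pow_ne_zero 2 (hnz s hs.1.1)
  obtain ⟨C, hC⟩ := hK.exists_bound_of_continuousOn hG
  refine ⟨max C 1, by positivity, fun s h1 h2 h3 => ?_⟩
  have hs : s ∈ Set.Icc (1 : ℝ) 2 ×ℂ Set.Icc (-1 : ℝ) 1 := ⟨⟨h1.le, h2⟩, abs_le.mp h3⟩
  refine le_trans ?_ ((hC s hs).trans (le_max_left _ _))
  apply le_of_eq
  congr 1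
  have hs1 : s ≠ 1 := by rintro rfl; simp at h1
  have hw : s - 1 ≠ 0 := sub_ne_zero.mpr hs1
  have e0 : riemannZeta s = (s - 1)⁻¹ + z s := riemannZeta_eq_inv_sub_add hs1
  have hder1 : ∀ w : ℂ, w ≠ 1 → HasDerivAt riemannZeta (-1 / (w - 1) ^ 2 + deriv z w) w := by
    intro w hw1
    have hw1' : w - 1 ≠ 0 := sub_ne_zero.mpr hw1
    have : HasDerivAt (fun w => (w - 1)⁻¹ + z w) (-1 / (w - 1) ^ 2 + deriv z w) w :=
      (((hasDerivAt_id w).sub_const 1).inv hw1').add (hz0 w).hasDerivAt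
    refine this.congr_of_eventuallyEq ?_
    filter_upwards [isOpen_ne.mem_nhds hw1] with u hu using riemannZeta_eq_inv_sub_add hu
  have e1 : deriv riemannZeta s = -1 / (s - 1) ^ 2 + deriv z s := (hder1 s hs1).deriv
  have e2 : deriv (deriv riemannZeta) s = 2 / (s - 1) ^ 3 + deriv (deriv z) s := by
    have hev : deriv riemannZeta =ᶠ[𝓝 s] fun w => -1 / (w - 1) ^ 2 + deriv z w := by
      filter_upwards [isOpen_ne.mem_nhds hs1] with u hu using (hder1 u hu).deriv
    rw [hev.deriv_eq]
    have : HasDerivAt (fun w => -1 / (w - 1) ^ 2 + deriv z w)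
        ((0 * (s - 1) ^ 2 - -1 * (2 * (s - 1) ^ 1 * 1)) / ((s - 1) ^ 2) ^ 2 + deriv (deriv z) s) s := by
      refine HasDerivAt.add ?_ (hz1 s).hasDerivAt
      exact (hasDerivAt_const s (-1 : ℂ)).div (((hasDerivAt_id s).sub_const 1).pow 2)
        (pow_ne_zero 2 hw)
    rw [this.deriv]
    field_simp
    ring
  have hne := hnz s h1.le
  have e3 : riemannZeta s = (1 + (s - 1) * z s) / (s - 1) := by
    rw [e0]; field_simp
  simp only [DD, G]
  rw [e1, e2, e3]
  field_simp
  ring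

lemma DD_bound : ∃ C : ℝ, 0 < C ∧ ∀ s : ℂ, 1 < s.re → s.re ≤ 2 →
    ‖DD s‖ ≤ C * (1 + |s.im|) ^ (1 / 2 : ℝ) := by
  obtain ⟨C1, h1, H1⟩ := DD_bound_large
  obtain ⟨C2, h2, H2⟩ := DD_bound_small
  refine ⟨C1 + C2, by linarith, fun s hs1 hs2 => ?_⟩
  have hp : 1 ≤ (1 + |s.im|) ^ (1 / 2 : ℝ) :=
    Real.one_le_rpow (by linarith [abs_nonneg s.im]) (by norm_num)
  rcases le_total 1 |s.im| with h | h
  · exact (H1 s hs1 hs2 h).trans (by nlinarith)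
  · exact (H2 s hs1 hs2 h).trans (by nlinarith)

/-- coefficients `(Λ(n) - 1) log n` -/
noncomputable def aa (n : ℕ) : ℝ := (ArithmeticFunction.vonMangoldt n - 1) * Real.log n

lemma LSeries_aa {s : ℂ} (hs : 1 < s.re) :
    LSeriesSummable (fun n => (aa n : ℂ)) s ∧ LSeries (fun n => (aa n : ℂ)) s = DD s := by
  let f : ℕ → ℂ := (fun n => (ArithmeticFunction.vonMangoldt n : ℂ)) - 1
  have hfs : ∀ w : ℂ, 1 < w.re → LSeriesSummable f w := fun w hw =>
    (ArithmeticFunction.LSeriesSummable_vonMangoldt hw).sub (LSeriesSummable_one_iff.mpr hw)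
  have habs : LSeries.abscissaOfAbsConv f ≤ 1 :=
    LSeries.abscissaOfAbsConv_le_of_forall_lt_LSeriesSummable fun y hy => hfs y (by simpa using hy)
  have habs' : LSeries.abscissaOfAbsConv f < s.re := lt_of_le_of_lt habs (by exact_mod_cast hs)
  have hlog : LSeries.logMul f = fun n => (aa n : ℂ) := by
    ext n
    simp only [LSeries.logMul, aa, f, Pi.sub_apply, Pi.one_apply]
    push_cast
    rw [← Complex.natCast_log]
    ring
  have hL : ∀ w : ℂ, 1 < w.re → LSeries f w = - deriv riemannZeta w / riemannZeta w - riemannZeta w := by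
    intro w hw
    rw [LSeries_sub (ArithmeticFunction.LSeriesSummable_vonMangoldt hw) (LSeriesSummable_one_iff.mpr hw),
      ArithmeticFunction.LSeries_vonMangoldt_eq_deriv_riemannZeta_div hw, LSeries_one_eq_riemannZeta hw]
  refine ⟨?_, ?_⟩
  · rw [← hlog]
    exact LSeriesSummable_logMul_of_lt_re habs'
  · have h1 := LSeries_deriv habs'
    rw [hlog] at h1
    have hev : LSeries f =ᶠ[𝓝 s] fun w => - deriv riemannZeta w / riemannZeta w - riemannZeta w := by
      filter_upwards [(isOpen_lt continuous_const continuous_re).mem_nhds hs] with w hw using hL w hw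
    have hs1 : s ≠ 1 := by rintro rfl; simp at hs
    have hz := riemannZeta_ne_zero_of_one_lt_re hs
    have hd := (differentiableAt_riemannZeta hs1).hasDerivAt
    have ha : AnalyticAt ℂ riemannZeta s := by
      have : DifferentiableOn ℂ riemannZeta {1}ᶜ := fun w hw =>
        (differentiableAt_riemannZeta hw).differentiableWithinAt
      exact this.analyticAt (isOpen_ne.mem_nhds hs1)
    have hd2 := ha.deriv.differentiableAt.hasDerivAt
    have hD := (hd2.neg.div hd hz).sub hd
    have h2 : deriv (LSeries f) s = _ := hev.deriv_eq.trans hD.deriv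
    rw [h1] at h2
    have : LSeries (fun n => (aa n : ℂ)) s = - (-LSeries (fun n => (aa n : ℂ)) s) := by ring
    rw [this, h2]
    simp only [DD, Pi.neg_apply]
    field_simp
    ring

end SAux

namespace SAux
open Complex Filter Topology

noncomputable def kf (t : ℝ) : ℂ :=
  (Set.Ioc (0:ℝ) 1).indicator (fun _ => (1:ℂ)) t - (Set.Ioc (0:ℝ) 1).indicator (fun t : ℝ => (t:ℂ) ^ (1:ℂ)) t

lemma kf_eq {t : ℝ} (ht : 0 < t) : kf t = ((max (1 - t) 0 : ℝ) : ℂ) := by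
  unfold kf
  by_cases h : t ≤ 1
  · have hm : t ∈ Set.Ioc (0:ℝ) 1 := ⟨ht, h⟩
    rw [Set.indicator_of_mem hm, Set.indicator_of_mem hm, max_eq_left (by linarith)]
    simp
  · rw [Set.indicator_of_notMem (fun h' => h h'.2), Set.indicator_of_notMem (fun h' => h h'.2),
      max_eq_right (by linarith)]
    simp

lemma kf_mellin {s : ℂ} (hs : 1 ≤ s.re) : HasMellin kf s (1 / (s * (s + 1))) := by
  have h1 := hasMellin_one_Ioc (s := s) (by linarith)
  have h2 := hasMellin_cpow_Ioc (s := s) 1 (by simp; linarith)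
  have h := hasMellin_sub h1.1 h2.1
  rw [h1.2, h2.2] at h
  have e : 1 / s - 1 / (s + 1) = 1 / (s * (s + 1)) := by
    have : s ≠ 0 := by rintro rfl; simp at hs; linarith
    have : s + 1 ≠ 0 := by
      intro h0
      have := congrArg re h0
      simp at this; linarith
    field_simp
    ring
  rw [e] at h
  exact h

lemma kern_bound {σ : ℝ} (h1 : 1 ≤ σ) (y : ℝ) :
    ‖1 / (((σ:ℂ) + y * I) * ((σ:ℂ) + y * I + 1))‖ ≤ 2 * (1 + |y|) ^ (-2:ℝ) := by
  have hn : ∀ a : ℝ, 1 ≤ a → 1 + y ^ 2 ≤ ‖(a:ℂ) + y * I‖ ^ 2 := by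
    intro a ha
    rw [Complex.sq_norm, Complex.normSq_apply]
    simp
    nlinarith
  have e1 := hn σ h1
  have e2 := hn (σ + 1) (by linarith)
  have e3 : (1 + y ^ 2) ≤ ‖(σ:ℂ) + y * I‖ * ‖(σ:ℂ) + y * I + 1‖ := by
    have : ((σ + 1 : ℝ) : ℂ) + y * I = (σ:ℂ) + y * I + 1 := by push_cast; ring
    rw [this] at e2
    apply le_of_pow_le_pow_left₀ two_ne_zero (by positivity)
    rw [mul_pow]
    nlinarith [sq_nonneg y]
  rw [norm_div, norm_mul, norm_one, Real.rpow_neg (by positivity)]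
  have e4 : (1 + |y|) ^ (2:ℝ) ≤ 2 * (1 + y ^ 2) := by
    rw [show (2:ℝ) = ((2:ℕ):ℝ) by norm_num, Real.rpow_natCast, ← sq_abs y]
    norm_num [-sq_abs]
    nlinarith [sq_nonneg (1 - |y|)]
  rw [div_le_iff₀ (by nlinarith [sq_nonneg y])]
  have e5 : (0:ℝ) < (1 + |y|) ^ (2:ℝ) := by positivity
  rw [mul_assoc, inv_mul_eq_div, ← mul_div_assoc, le_div_iff₀ e5]
  linarith

lemma meas_line (σ : ℝ) : Continuous fun y : ℝ => (σ:ℂ) + y * I := by fun_prop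

lemma kern_integrable {σ : ℝ} (h1 : 1 ≤ σ) :
    MeasureTheory.Integrable (fun y : ℝ => 1 / (((σ:ℂ) + y * I) * ((σ:ℂ) + y * I + 1))) := by
  have h := (integrable_one_add_norm (E := ℝ) (μ := MeasureTheory.volume) (r := 2) (by simp)).const_mul 2
  refine h.mono' ?_ ?_
  · apply Measurable.aestronglyMeasurable
    fun_prop
  · exact Eventually.of_forall fun y => by simpa using kern_bound h1 y

lemma kf_inv {σ x : ℝ} (h1 : 1 ≤ σ) (hx : 0 < x) :
    ((max (1 - x) 0 : ℝ) : ℂ) = (1 / (2 * Real.pi)) • ∫ y : ℝ, (x:ℂ) ^ (-((σ:ℂ) + y * I)) *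
      (1 / (((σ:ℂ) + y * I) * ((σ:ℂ) + y * I + 1))) := by
  have hm : ∀ y : ℝ, mellin kf ((σ:ℂ) + y * I) = 1 / (((σ:ℂ) + y * I) * ((σ:ℂ) + y * I + 1)) :=
    fun y => (kf_mellin (by simpa using h1)).2
  have := mellinInv_mellin_eq σ kf hx (kf_mellin (s := σ) (by simpa using h1)).1 (by
      unfold VerticalIntegrable
      simp_rw [hm]
      exact kern_integrable h1) (by
      have : ContinuousAt (fun t : ℝ => ((max (1 - t) 0 : ℝ) : ℂ)) x := by fun_prop
      refine this.congr ?_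
      filter_upwards [lt_mem_nhds hx] with t ht using (kf_eq ht).symm)
  rw [← kf_eq hx, ← this]
  unfold mellinInv
  simp_rw [hm, smul_eq_mul]

lemma perron_c : ∃ K : ℝ, 0 < K ∧ ∀ σ : ℝ, 1 < σ → σ ≤ 2 → ∀ X : ℝ, 1 ≤ X →
    |∑ n ∈ Finset.Icc 1 ⌊X⌋₊, aa n * (1 - n / X)| ≤ K * X ^ σ := by
  obtain ⟨C, hC, hD⟩ := DD_bound
  have hint := (integrable_one_add_norm (E := ℝ) (μ := MeasureTheory.volume) (r := 3 / 2)
    (by norm_num)).const_mul (2 * C)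
  set J := ∫ y : ℝ, 2 * C * (1 + ‖y‖) ^ (-(3 / 2) : ℝ) with hJ
  have hJ0 : 0 ≤ J := MeasureTheory.integral_nonneg fun y => by positivity
  refine ⟨J + 1, by positivity, fun σ h1 h2 X hX => ?_⟩
  have hX0 : 0 < X := by linarith
  set F : ℝ → ℂ := fun y => 1 / (((σ:ℂ) + y * I) * ((σ:ℂ) + y * I + 1)) with hF
  set T : ℕ → ℝ → ℂ := fun n y => (aa n : ℂ) * ((((n:ℝ) / X : ℝ) : ℂ) ^ (-((σ:ℂ) + y * I)) * F y) with hT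
  have haa0 : aa 0 = 0 := by simp [aa]
  have hnorm : ∀ n : ℕ, 1 ≤ n → ∀ y : ℝ, ‖((((n:ℝ) / X : ℝ) : ℂ) ^ (-((σ:ℂ) + y * I)))‖ = ((n:ℝ) / X) ^ (-σ) := by
    intro n hn y
    have : (0:ℝ) < n := by exact_mod_cast hn
    rw [norm_cpow_eq_rpow_re_of_pos (by positivity)]
    simp
  have hTn : ∀ n y, ‖T n y‖ = X ^ σ * ‖LSeries.term (fun n => (aa n : ℂ)) (σ : ℂ) n‖ * ‖F y‖ := by
    intro n y
    rcases Nat.eq_zero_or_pos n with rfl | hn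
    · simp [hT, haa0]
    · have hn0 : (0:ℝ) < n := by exact_mod_cast hn
      rw [hT]
      simp only [norm_mul]
      rw [hnorm n hn, LSeries.term_of_ne_zero hn.ne', norm_div (aa n : ℂ), Complex.norm_natCast_cpow_of_pos hn,
        Real.div_rpow hn0.le hX0.le, Real.rpow_neg hn0.le, Real.rpow_neg hX0.le]
      simp only [ofReal_re]
      field_simp
  have hTi : ∀ n, MeasureTheory.Integrable (T n) := by
    intro n
    refine (((kern_integrable h1.le).norm).const_mul (X ^ σ * ‖LSeries.term (fun n => (aa n : ℂ)) (σ : ℂ) n‖)).mono' ?_ ?_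
    · rcases Nat.eq_zero_or_pos n with rfl | hn
      · simp only [hT, haa0]
        simp
        exact MeasureTheory.aestronglyMeasurable_const
      · apply Measurable.aestronglyMeasurable
        have : (0:ℝ) < n := by exact_mod_cast hn
        have hne : (((n:ℝ) / X : ℝ) : ℂ) ≠ 0 := by
          rw [Ne, ofReal_eq_zero]; positivity
        refine Measurable.mul measurable_const (Measurable.mul ?_ ?_)
        · apply Continuous.measurable
          exact Continuous.const_cpow (by fun_prop) (Or.inl hne)
        · rw [hF]; fun_prop
    · exact Eventually.of_forall fun y => (hTn n y).le
  have hls := LSeries_aa (s := σ) (by simpa using h1)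
  have hsumm : Summable fun n => ∫ y, ‖T n y‖ := by
    simp_rw [hTn, MeasureTheory.integral_const_mul]
    exact ((hls.1.norm).mul_left _).mul_right _
  have hs := MeasureTheory.hasSum_integral_of_summable_integral_norm hTi hsumm
  have hterm : ∀ y, ∑' n, T n y = (X:ℂ) ^ ((σ:ℂ) + y * I) * (DD ((σ:ℂ) + y * I) * F y) := by
    intro y
    rw [← (LSeries_aa (s := (σ:ℂ) + y * I) (by simpa using h1)).2, LSeries, ← tsum_mul_right, ← tsum_mul_left]
    congr 1
    ext n
    rcases Nat.eq_zero_or_pos n with rfl | hn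
    · simp [hT, haa0]
    · have hn0 : (0:ℝ) < n := by exact_mod_cast hn
      rw [LSeries.term_of_ne_zero hn.ne']
      simp only [hT]
      have e : (n:ℂ) ^ ((σ:ℂ) + y * I) = (((n:ℝ) / X : ℝ) : ℂ) ^ ((σ:ℂ) + y * I) * (X:ℂ) ^ ((σ:ℂ) + y * I) := by
        rw [← mul_cpow_ofReal_nonneg (by positivity) hX0.le, ← ofReal_mul, div_mul_cancel₀ _ hX0.ne']
        simp
      have n1 : (((n:ℝ) / X : ℝ) : ℂ) ^ ((σ:ℂ) + y * I) ≠ 0 := by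
        rw [Ne, cpow_eq_zero_iff]
        intro h
        have := h.1
        rw [ofReal_eq_zero] at this
        have : 0 < (n:ℝ) / X := by positivity
        linarith
      have n2 : (X : ℂ) ^ ((σ:ℂ) + y * I) ≠ 0 := by
        rw [Ne, cpow_eq_zero_iff]
        intro h
        exact hX0.ne' (ofReal_eq_zero.mp h.1)
      rw [e, cpow_neg]
      field_simp
  have hL : ∀ n : ℕ, ∫ y, T n y = (2 * Real.pi : ℝ) * ((aa n * max (1 - n / X) 0 : ℝ) : ℂ) := by
    intro n
    rcases Nat.eq_zero_or_pos n with rfl | hn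
    · simp [hT, haa0]
    · have hn0 : (0:ℝ) < n := by exact_mod_cast hn
      rw [hT]
      simp only
      have k := kf_inv h1.le (show 0 < (n:ℝ) / X by positivity)
      change _ = (1 / (2 * Real.pi)) • ∫ y : ℝ, (((n:ℝ) / X : ℝ):ℂ) ^ (-((σ:ℂ) + y * I)) * F y at k
      rw [MeasureTheory.integral_const_mul, ofReal_mul (aa n), k, Complex.real_smul]
      generalize (∫ y : ℝ, (((n:ℝ) / X : ℝ):ℂ) ^ (-((σ:ℂ) + y * I)) * F y) = Q
      have hpi : (Real.pi : ℂ) ≠ 0 := by exact_mod_cast Real.pi_ne_zero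
      push_cast
      field_simp
  have hfin : HasSum (fun n : ℕ => ∫ y, T n y) (∑ n ∈ Finset.Icc 1 ⌊X⌋₊, ∫ y, T n y) := by
    apply hasSum_sum_of_ne_finset_zero
    intro n hn
    rw [hL]
    rcases Nat.eq_zero_or_pos n with rfl | hn1
    · simp [haa0]
    · have : X < n := by
        rw [Finset.mem_Icc, not_and] at hn
        exact Nat.lt_of_floor_lt (not_le.mp (hn hn1))
      rw [max_eq_right (by rw [sub_nonpos, le_div_iff₀ hX0]; linarith)]
      simp
  have heq := hfin.unique hs
  simp_rw [hL, hterm] at heq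
  have hsum : (∑ n ∈ Finset.Icc 1 ⌊X⌋₊, ((2 * Real.pi : ℝ) : ℂ) * ((aa n * max (1 - n / X) 0 : ℝ) : ℂ)) =
      ((2 * Real.pi * ∑ n ∈ Finset.Icc 1 ⌊X⌋₊, aa n * (1 - n / X) : ℝ) : ℂ) := by
    rw [← Finset.mul_sum, ← ofReal_sum, ← ofReal_mul]
    congr 2
    refine Finset.sum_congr rfl fun n hn => ?_
    rw [max_eq_left]
    rw [sub_nonneg, div_le_one hX0]
    exact (Nat.le_floor_iff hX0.le).mp (Finset.mem_Icc.mp hn).2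
  rw [hsum] at heq
  have hb : ‖∫ y : ℝ, (X:ℂ) ^ ((σ:ℂ) + y * I) * (DD ((σ:ℂ) + y * I) * F y)‖ ≤ X ^ σ * J := by
    rw [hJ, ← MeasureTheory.integral_const_mul]
    refine MeasureTheory.norm_integral_le_of_norm_le (hint.const_mul _) (Eventually.of_forall fun y => ?_)
    rw [norm_mul, norm_mul, norm_cpow_eq_rpow_re_of_pos hX0]
    have d1 := hD ((σ:ℂ) + y * I) (by simpa using h1) (by simpa using h2)
    have d2 := kern_bound h1.le y
    have r1 : ((σ:ℂ) + y * I).re = σ := by simp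
    have r2 : ((σ:ℂ) + y * I).im = y := by simp
    rw [r1]
    rw [r2] at d1
    refine mul_le_mul_of_nonneg_left ?_ (by positivity)
    calc _ ≤ C * (1 + |y|) ^ (1 / 2 : ℝ) * (2 * (1 + |y|) ^ (-2:ℝ)) :=
          mul_le_mul d1 d2 (norm_nonneg _) (by positivity)
      _ = 2 * C * ((1 + |y|) ^ (1 / 2 : ℝ) * (1 + |y|) ^ (-2:ℝ)) := by ring
      _ = _ := by
        rw [← Real.rpow_add (by positivity)]
        norm_num
  rw [← heq, norm_real, Real.norm_eq_abs, abs_mul, abs_of_pos (by positivity)] at hb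
  have hpi := Real.pi_gt_three
  have h0 := abs_nonneg (∑ n ∈ Finset.Icc 1 ⌊X⌋₊, aa n * (1 - n / X))
  have hXp : 0 < X ^ σ := by positivity
  nlinarith

lemma perron : ∃ K : ℝ, 0 < K ∧ ∀ X : ℝ, 1 ≤ X →
    |∑ n ∈ Finset.Icc 1 ⌊X⌋₊, aa n * (X - n)| ≤ K * X ^ 2 := by
  obtain ⟨K, hK, h⟩ := perron_c
  refine ⟨K, hK, fun X hX => ?_⟩
  have hX0 : 0 < X := by linarith
  have h1 : |∑ n ∈ Finset.Icc 1 ⌊X⌋₊, aa n * (1 - n / X)| ≤ K * X := by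
    have ht : Tendsto (fun σ : ℝ => K * X ^ σ) (𝓝[>] 1) (𝓝 (K * X ^ (1:ℝ))) := by
      apply Tendsto.mono_left _ nhdsWithin_le_nhds
      have : Continuous fun σ : ℝ => K * X ^ σ :=
        continuous_const.mul (Real.continuous_const_rpow hX0.ne')
      exact this.tendsto 1
    rw [Real.rpow_one] at ht
    refine ge_of_tendsto ht ?_
    filter_upwards [Ioc_mem_nhdsGT (show (1:ℝ) < 2 by norm_num)] with σ hσ using h σ hσ.1 hσ.2 X hX
  have e : ∑ n ∈ Finset.Icc 1 ⌊X⌋₊, aa n * (X - n) = X * ∑ n ∈ Finset.Icc 1 ⌊X⌋₊, aa n * (1 - n / X) := by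
    rw [Finset.mul_sum]
    refine Finset.sum_congr rfl fun n _ => ?_
    field_simp
  rw [e, abs_mul, abs_of_pos hX0]
  nlinarith

end SAux

namespace SAux
open Filter Topology

/-- partial sums -/
noncomputable def ps (w : ℕ → ℝ) (x : ℝ) : ℝ := ∑ n ∈ Finset.Icc 1 ⌊x⌋₊, w n

lemma ps_smooth (w : ℕ → ℝ) (hw : ∀ n, 0 ≤ w n) {x y : ℝ} (hx : 0 ≤ x) (hxy : x ≤ y) :
    (y - x) * ps w x ≤ ps (fun n => w n * (y - n)) y - ps (fun n => w n * (x - n)) x ∧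
    ps (fun n => w n * (y - n)) y - ps (fun n => w n * (x - n)) x ≤ (y - x) * ps w y := by
  unfold ps
  have hsub : Finset.Icc 1 ⌊x⌋₊ ⊆ Finset.Icc 1 ⌊y⌋₊ :=
    Finset.Icc_subset_Icc_right (Nat.floor_le_floor hxy)
  have hy : 0 ≤ y := hx.trans hxy
  rw [← Finset.sum_sdiff hsub, ← Finset.sum_sdiff hsub (f := w), add_sub_assoc, ← Finset.sum_sub_distrib]
  have e : ∑ n ∈ Finset.Icc 1 ⌊x⌋₊, (w n * (y - n) - w n * (x - n)) = (y - x) * ∑ n ∈ Finset.Icc 1 ⌊x⌋₊, w n := by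
    rw [Finset.mul_sum]
    exact Finset.sum_congr rfl fun n _ => by ring
  rw [e, mul_add]
  have hd : ∀ n ∈ Finset.Icc 1 ⌊y⌋₊ \ Finset.Icc 1 ⌊x⌋₊, x ≤ n ∧ (n:ℝ) ≤ y := by
    intro n hn
    rw [Finset.mem_sdiff, Finset.mem_Icc, Finset.mem_Icc] at hn
    refine ⟨?_, (Nat.le_floor_iff hy).mp hn.1.2⟩
    have : ⌊x⌋₊ < n := by omega
    exact (Nat.lt_of_floor_lt this).le
  constructor
  · have : 0 ≤ ∑ n ∈ Finset.Icc 1 ⌊y⌋₊ \ Finset.Icc 1 ⌊x⌋₊, w n * (y - n) :=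
      Finset.sum_nonneg fun n hn => mul_nonneg (hw n) (by linarith [(hd n hn).2])
    linarith
  · gcongr
    rw [Finset.mul_sum]
    refine Finset.sum_le_sum fun n hn => ?_
    rw [mul_comm]
    exact mul_le_mul_of_nonneg_right (by linarith [(hd n hn).1]) (hw n)

lemma log_sum_upper {x : ℝ} (hx : 1 ≤ x) : ps (fun n => Real.log n) x ≤ x * Real.log x := by
  unfold ps
  have h0 : 0 ≤ x := by linarith
  have : ∑ n ∈ Finset.Icc 1 ⌊x⌋₊, Real.log n ≤ (Finset.Icc 1 ⌊x⌋₊).card • Real.log x := by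
    refine Finset.sum_le_card_nsmul _ _ _ fun n hn => ?_
    rw [Finset.mem_Icc, Nat.le_floor_iff h0] at hn
    exact Real.log_le_log (by exact_mod_cast hn.1) hn.2
  refine this.trans ?_
  simp only [Nat.card_Icc, add_tsub_cancel_right, nsmul_eq_mul]
  exact mul_le_mul_of_nonneg_right (Nat.floor_le h0) (Real.log_nonneg hx)

lemma log_sum_lower {x : ℝ} (hx : 1 ≤ x) : x * Real.log x - 3 * x ≤ ps (fun n => Real.log n) x := by
  have h0 : 0 ≤ x := by linarith
  have hfac : ∀ n : ℕ, 1 ≤ n → n * Real.log n - n ≤ ∑ k ∈ Finset.Icc 1 n, Real.log k := by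
    intro n hn
    have hn0 : (0:ℝ) < n := by exact_mod_cast hn
    have h1 := Real.pow_div_factorial_le_exp (n:ℝ) hn0.le n
    have h2 := Real.log_le_log (by positivity) h1
    rw [Real.log_exp, Real.log_div (by positivity) (by positivity), Real.log_pow] at h2
    have h3 : Real.log n.factorial = ∑ k ∈ Finset.Icc 1 n, Real.log k := by
      clear h1 h2 hn0 hn
      induction n with
      | zero => simp
      | succ k ih =>
        rw [Finset.sum_Icc_succ_top (by omega), ← ih, Nat.factorial_succ, Nat.cast_mul,
          Real.log_mul (by positivity) (by positivity)]
        ring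
    linarith
  have hn : 1 ≤ ⌊x⌋₊ := (Nat.one_le_floor_iff x).mpr hx
  have h := hfac _ hn
  have hn1 : (1:ℝ) ≤ ⌊x⌋₊ := by exact_mod_cast hn
  have l1 := Nat.lt_floor_add_one x
  have l2 := Nat.floor_le h0
  have l3 : Real.log x - 1 ≤ Real.log ⌊x⌋₊ := by
    have : Real.log x ≤ Real.log (2 * ⌊x⌋₊) := Real.log_le_log (by linarith) (by linarith)
    rw [Real.log_mul (by norm_num) (by positivity)] at this
    have := Real.log_two_lt_d9
    linarith
  have l4 : 0 ≤ Real.log (⌊x⌋₊:ℝ) := Real.log_nonneg hn1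
  have l5 := Real.log_le_sub_one_of_pos (show 0 < x by linarith)
  unfold ps
  nlinarith

noncomputable def A2 (x : ℝ) : ℝ := ps (fun n => if n.Prime then Real.log n ^ 2 else 0) x

lemma lamlog : ∃ K : ℝ, 0 < K ∧ ∀ x : ℝ, 4 ≤ Real.log x → 0 < x →
    |ps (fun n => ArithmeticFunction.vonMangoldt n * Real.log n) x - x * Real.log x| ≤ K * x * √(Real.log x) := by
  obtain ⟨K, hK, h⟩ := perron
  refine ⟨8 * K + 7, by positivity, fun x hx hx0 => ?_⟩
  set w := fun n : ℕ => ArithmeticFunction.vonMangoldt n * Real.log n with hw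
  set v := fun n : ℕ => Real.log n with hv
  have hw0 : ∀ n, 0 ≤ w n := fun n => mul_nonneg ArithmeticFunction.vonMangoldt_nonneg (Real.log_natCast_nonneg n)
  have hv0 : ∀ n, 0 ≤ v n := fun n => Real.log_natCast_nonneg n
  have hP : ∀ X : ℝ, 1 ≤ X → |ps (fun n => w n * (X - n)) X - ps (fun n => v n * (X - n)) X| ≤ K * X ^ 2 := by
    intro X hX
    have := h X hX
    unfold ps
    rw [← Finset.sum_sub_distrib]
    convert this using 3
    simp only [hw, hv, aa]
    ring
  set q := √(Real.log x) with hq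
  have hq2 : q ^ 2 = Real.log x := Real.sq_sqrt (by linarith)
  have hq1 : 2 ≤ q := by
    rw [hq]; exact Real.le_sqrt_of_sq_le (by linarith)
  have hx2 : 2 ≤ x := by
    have := Real.log_le_sub_one_of_pos hx0
    linarith
  have hh : x / q ≤ x / 2 := by gcongr
  have hhp : 0 < x / q := by positivity
  have hhq : x / q * q = x := by field_simp
  have l2 := Real.log_two_lt_d9
  have l2' := Real.log_two_gt_d9
  rw [← hq2]
  set d := x / q with hd
  rw [abs_le]
  constructor
  · have a1 := (ps_smooth w hw0 (show 0 ≤ x - d by linarith) (show x - d ≤ x by linarith)).2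
    have a2 := (ps_smooth v hv0 (show 0 ≤ x - d by linarith) (show x - d ≤ x by linarith)).1
    have a3 := abs_le.mp (hP x (by linarith))
    have a4 := abs_le.mp (hP (x - d) (by linarith))
    have a5 := log_sum_lower (show 1 ≤ x - d by linarith)
    have a6 : Real.log x - 1 ≤ Real.log (x - d) := by
      have : Real.log x ≤ Real.log (2 * (x - d)) := Real.log_le_log hx0 (by linarith)
      rw [Real.log_mul (by norm_num) (by linarith)] at this
      linarith
    rw [← hq2] at a6
    have a7 : x * q ^ 2 - x * q - 4 * x ≤ ps v (x - d) := by
      have : (x - d) * (q ^ 2 - 1) ≤ (x - d) * Real.log (x - d) :=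
        mul_le_mul_of_nonneg_left a6 (by linarith)
      have e : d * q ^ 2 = x * q := by rw [pow_two, ← mul_assoc, hhq]
      nlinarith
    have a8 : K * (x - d) ^ 2 ≤ K * x ^ 2 := by
      have : (x - d) ^ 2 ≤ x ^ 2 := by nlinarith
      nlinarith
    have a9 : d * ps w x ≥ d * ps v (x - d) - 2 * K * x ^ 2 := by
      have e : x - (x - d) = d := by ring
      rw [e] at a1 a2
      linarith [a3.1, a4.2]
    have e2 : d * (2 * K * x * q) = 2 * K * x ^ 2 := by
      calc d * (2 * K * x * q) = 2 * K * x * (d * q) := by ring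
        _ = _ := by rw [hhq]; ring
    have a10 : ps v (x - d) - 2 * K * x * q ≤ ps w x := by
      apply le_of_mul_le_mul_left _ hhp
      rw [mul_sub, e2]; linarith
    have : 4 * x ≤ 2 * (x * q) := by nlinarith
    have : 0 ≤ K * x * q := by positivity
    nlinarith
  · have a1 := (ps_smooth w hw0 hx0.le (show x ≤ x + d by linarith)).1
    have a2 := (ps_smooth v hv0 hx0.le (show x ≤ x + d by linarith)).2
    have a3 := abs_le.mp (hP x (by linarith))
    have a4 := abs_le.mp (hP (x + d) (by linarith))
    have a5 := log_sum_upper (show 1 ≤ x + d by linarith)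
    have a6 : Real.log (x + d) ≤ Real.log x + 1 := by
      have : Real.log (x + d) ≤ Real.log (2 * x) := Real.log_le_log (by linarith) (by linarith)
      rw [Real.log_mul (by norm_num) (by linarith)] at this
      linarith
    rw [← hq2] at a6
    have a7 : ps v (x + d) ≤ x * q ^ 2 + x * q + 2 * x := by
      have : (x + d) * Real.log (x + d) ≤ (x + d) * (q ^ 2 + 1) :=
        mul_le_mul_of_nonneg_left a6 (by linarith)
      have e : d * q ^ 2 = x * q := by rw [pow_two, ← mul_assoc, hhq]
      nlinarith
    have a8 : K * (x + d) ^ 2 ≤ K * (4 * x ^ 2) := by gcongr; nlinarith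
    have a9 : d * ps w x ≤ d * ps v (x + d) + 5 * K * x ^ 2 := by
      have e : x + d - x = d := by ring
      rw [e] at a1 a2
      linarith [a3.1, a4.2]
    have e2 : d * (5 * K * x * q) = 5 * K * x ^ 2 := by
      calc d * (5 * K * x * q) = 5 * K * x * (d * q) := by ring
        _ = _ := by rw [hhq]; ring
    have a10 : ps w x ≤ ps v (x + d) + 5 * K * x * q := by
      apply le_of_mul_le_mul_left _ hhp
      rw [mul_add, e2]; linarith
    have : 2 * x ≤ (x * q) := by nlinarith
    have : 0 ≤ K * x * q := by positivity
    nlinarith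

lemma A2_pnt : ∃ K : ℝ, 0 < K ∧ ∀ x : ℝ, 4 ≤ Real.log x → 0 < x →
    |A2 x - x * Real.log x| ≤ K * x * √(Real.log x) := by
  obtain ⟨K, hK, h⟩ := lamlog
  obtain ⟨C, hC⟩ := Chebyshev.psi_sub_theta_le_mul_sqrt
  refine ⟨K + max C 0, by positivity, fun x hx hx0 => ?_⟩
  have h1 := h x hx hx0
  have hps : ps (fun n => ArithmeticFunction.vonMangoldt n * Real.log n) x - A2 x =
      ∑ n ∈ Finset.Icc 1 ⌊x⌋₊, (if n.Prime then 0 else ArithmeticFunction.vonMangoldt n * Real.log n) := by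
    unfold A2 ps
    rw [← Finset.sum_sub_distrib]
    refine Finset.sum_congr rfl fun n _ => ?_
    split_ifs with hp
    · rw [ArithmeticFunction.vonMangoldt_apply_prime hp]; ring
    · ring
  have hlow : 0 ≤ ps (fun n => ArithmeticFunction.vonMangoldt n * Real.log n) x - A2 x := by
    rw [hps]
    refine Finset.sum_nonneg fun n _ => ?_
    split_ifs
    · exact le_rfl
    · exact mul_nonneg ArithmeticFunction.vonMangoldt_nonneg (Real.log_natCast_nonneg n)
  have hup : ps (fun n => ArithmeticFunction.vonMangoldt n * Real.log n) x - A2 x ≤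
      (Chebyshev.psi x - Chebyshev.theta x) * Real.log x := by
    rw [hps]
    have e : Chebyshev.psi x - Chebyshev.theta x =
        ∑ n ∈ Finset.Icc 1 ⌊x⌋₊, (if n.Prime then 0 else ArithmeticFunction.vonMangoldt n) := by
      rw [Chebyshev.psi_sub_theta_eq_sum_not_prime, Finset.sum_filter]
      refine Finset.sum_congr (by ext; simp [Finset.mem_Ioc, Finset.mem_Icc]; omega) fun n _ => ?_
      by_cases hp : n.Prime <;> simp [hp]
    rw [e, Finset.sum_mul]
    refine Finset.sum_le_sum fun n hn => ?_
    rw [Finset.mem_Icc, Nat.le_floor_iff hx0.le] at hn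
    split_ifs
    · simp
    · exact mul_le_mul_of_nonneg_left (Real.log_le_log (by exact_mod_cast hn.1) hn.2)
        ArithmeticFunction.vonMangoldt_nonneg
  have hb : (Chebyshev.psi x - Chebyshev.theta x) * Real.log x ≤ max C 0 * x * √(Real.log x) := by
    have c1 : Chebyshev.psi x - Chebyshev.theta x ≤ max C 0 * √x :=
      (hC x).trans (mul_le_mul_of_nonneg_right (le_max_left _ _) (Real.sqrt_nonneg _))
    have l : Real.log x ≤ x := (Real.log_le_sub_one_of_pos hx0).trans (by linarith)
    have l2 : √(Real.log x) ≤ √x := Real.sqrt_le_sqrt l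
    have e1 : √(Real.log x) * √(Real.log x) = Real.log x := Real.mul_self_sqrt (by linarith)
    have e2 : √x * √x = x := Real.mul_self_sqrt hx0.le
    calc _ ≤ max C 0 * √x * Real.log x := mul_le_mul_of_nonneg_right c1 (by linarith)
      _ = max C 0 * √x * √(Real.log x) * √(Real.log x) := by rw [mul_assoc _ √(Real.log x), e1]
      _ ≤ max C 0 * √x * √x * √(Real.log x) := by gcongr
      _ = _ := by rw [mul_assoc (max C 0), e2]
  rw [abs_le] at h1 ⊢
  constructor <;> nlinarith [h1.1, h1.2]

end SAux

namespace SAux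
open Filter Topology

lemma loc_alg {r N X a y K' : ℝ} (hr8 : 8 ≤ r) (hN0 : 0 ≤ N) (ha : 0 ≤ a) (hy0 : 0 < y) (hK : 0 < K')
    (hy : X = y * r) (u1 : (r - 1) ^ 2 * N ≤ (X - a) + K' * y) (u2 : (X - a) - K' * y ≤ (r + 1) ^ 2 * N) :
    |r ^ 2 * N - (X - a)| ≤ (K' + 12 * (1 + K')) * y := by
  have hrp : 0 < r := by linarith
  have u3 : r * N ≤ 4 * (1 + K') * y := by
    have q1 : r ^ 2 / 4 * N ≤ (r - 1) ^ 2 * N := by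
      apply mul_le_mul_of_nonneg_right _ hN0
      nlinarith
    have q2 : K' * y ≤ K' * (y * r) := by
      apply mul_le_mul_of_nonneg_left _ hK.le
      nlinarith
    have : r * (r * N) ≤ r * (4 * (1 + K') * y) := by linarith
    exact le_of_mul_le_mul_left this hrp
  have n1 : N ≤ r * N := by nlinarith
  have n2 : 0 < K' * y := by positivity
  rw [abs_le]
  constructor <;> linarith

lemma prime_local : ∃ C ℓ0 : ℝ, 0 < C ∧ 64 ≤ ℓ0 ∧ ∀ ℓ ≥ ℓ0, ∀ a x : ℕ, Real.exp (ℓ - √ℓ) ≤ a → a ≤ x →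
    (x:ℝ) ≤ Real.exp (ℓ + √ℓ) →
    |∑ n ∈ Finset.Ioc a x, ((if n.Prime then 1 else 0 : ℝ) - 1 / ℓ)| ≤ C / (ℓ * √ℓ) * x := by
  obtain ⟨K, hK, h⟩ := A2_pnt
  refine ⟨(4 * K + 2) + 12 * (1 + (4 * K + 2)), 64, by positivity, le_rfl, fun ℓ hℓ a x ha hax hx => ?_⟩
  set r := √ℓ with hr
  have hr2 : r ^ 2 = ℓ := Real.sq_sqrt (by linarith)
  have hr8 : 8 ≤ r := Real.le_sqrt_of_sq_le (by linarith)
  set K' := 4 * K + 2 with hK'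
  set N : ℝ := ∑ n ∈ Finset.Ioc a x, (if n.Prime then 1 else 0 : ℝ) with hN
  have hN0 : 0 ≤ N := Finset.sum_nonneg fun n _ => by split_ifs <;> norm_num
  have hsum : ∑ n ∈ Finset.Ioc a x, ((if n.Prime then 1 else 0 : ℝ) - 1 / ℓ) = N - (x - a) / ℓ := by
    rw [Finset.sum_sub_distrib, Finset.sum_const, Nat.card_Ioc, nsmul_eq_mul, Nat.cast_sub hax]
    ring
  have ha0 : (0:ℝ) < a := (Real.exp_pos _).trans_le ha
  have haxr : (a:ℝ) ≤ x := by exact_mod_cast hax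
  have hx0 : (0:ℝ) < x := ha0.trans_le haxr
  have hlog : ∀ y : ℝ, (a:ℝ) ≤ y → y ≤ x → r ^ 2 - r ≤ Real.log y ∧ Real.log y ≤ r ^ 2 + r := by
    intro y h1 h2
    rw [hr2]
    exact ⟨(Real.le_log_iff_exp_le (ha0.trans_le h1)).mpr (ha.trans h1),
      (Real.log_le_iff_le_exp (ha0.trans_le h1)).mpr (h2.trans hx)⟩
  have hsq : ∀ y : ℝ, (a:ℝ) ≤ y → y ≤ x → |A2 y - y * Real.log y| ≤ K * y * (2 * r) := by
    intro y h1 h2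
    obtain ⟨l1, l2⟩ := hlog y h1 h2
    refine (h y (by nlinarith) (ha0.trans_le h1)).trans ?_
    have : √(Real.log y) ≤ 2 * r := by
      rw [Real.sqrt_le_left (by linarith)]
      nlinarith
    have : 0 < y := ha0.trans_le h1
    gcongr
  set D := A2 x - A2 a with hD
  have hDsum : D = ∑ n ∈ Finset.Ioc a x, (if n.Prime then Real.log n ^ 2 else 0 : ℝ) := by
    rw [hD]
    unfold A2 ps
    rw [Nat.floor_natCast, Nat.floor_natCast]
    have hsub : Finset.Icc 1 a ⊆ Finset.Icc 1 x := Finset.Icc_subset_Icc_right hax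
    rw [← Finset.sum_sdiff hsub, add_sub_cancel_right]
    refine Finset.sum_congr ?_ fun _ _ => rfl
    ext n; simp only [Finset.mem_sdiff, Finset.mem_Icc, Finset.mem_Ioc]
    have : 0 < a := by exact_mod_cast ha0
    omega
  have hD1 : (r ^ 2 - r) ^ 2 * N ≤ D := by
    rw [hDsum, hN, Finset.mul_sum]
    refine Finset.sum_le_sum fun n hn => ?_
    rw [Finset.mem_Ioc] at hn
    split_ifs
    · rw [mul_one]
      have := (hlog n (by exact_mod_cast hn.1.le) (by exact_mod_cast hn.2)).1
      exact pow_le_pow_left₀ (by nlinarith) this 2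
    · simp
  have hD2 : D ≤ (r ^ 2 + r) ^ 2 * N := by
    rw [hDsum, hN, Finset.mul_sum]
    refine Finset.sum_le_sum fun n hn => ?_
    rw [Finset.mem_Ioc] at hn
    split_ifs
    · rw [mul_one]
      have := (hlog n (by exact_mod_cast hn.1.le) (by exact_mod_cast hn.2))
      exact pow_le_pow_left₀ (by nlinarith) this.2 2
    · simp
  have hD3 : |D - (x - a) * r ^ 2| ≤ K' * x * r := by
    have h1 := abs_le.mp (hsq x haxr le_rfl)
    have h2 := abs_le.mp (hsq a le_rfl haxr)
    obtain ⟨l1, l2⟩ := hlog x haxr le_rfl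
    obtain ⟨l3, l4⟩ := hlog a le_rfl haxr
    have k1 : K * a * (2 * r) ≤ K * x * (2 * r) := by gcongr
    have x1 : x * (r ^ 2 - r) ≤ x * Real.log x := by gcongr
    have x2 : x * Real.log x ≤ x * (r ^ 2 + r) := by gcongr
    have x3 : a * (r ^ 2 - r) ≤ a * Real.log a := by gcongr
    have x4 : a * Real.log a ≤ a * (r ^ 2 + r) := by gcongr
    have x5 : a * r ≤ x * r := by gcongr
    rw [abs_le, hD, hK']
    constructor <;> nlinarith [h1.1, h1.2, h2.1, h2.2]
  obtain ⟨d1, d2⟩ := abs_le.mp hD3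
  have hrp : 0 < r := by linarith
  -- work with y = x / r
  obtain ⟨y, hy⟩ : ∃ y : ℝ, (x:ℝ) = y * r := ⟨x / r, by field_simp⟩
  have hy0 : 0 < y := by
    by_contra hc
    push Not at hc
    nlinarith
  have u1 : (r - 1) ^ 2 * N ≤ (x - a) + K' * y := by
    have : r ^ 2 * ((r - 1) ^ 2 * N) ≤ r ^ 2 * ((x - a) + K' * y) := by
      have e1 : r ^ 2 * ((r - 1) ^ 2 * N) = (r ^ 2 - r) ^ 2 * N := by ring
      have e2 : r ^ 2 * ((x - a) + K' * y) = (x - a) * r ^ 2 + K' * x * r := by rw [hy]; ring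
      rw [e1, e2]; linarith
    exact le_of_mul_le_mul_left this (by positivity)
  have u2 : (x - a) - K' * y ≤ (r + 1) ^ 2 * N := by
    have : r ^ 2 * ((x - a) - K' * y) ≤ r ^ 2 * ((r + 1) ^ 2 * N) := by
      have e1 : r ^ 2 * ((r + 1) ^ 2 * N) = (r ^ 2 + r) ^ 2 * N := by ring
      have e2 : r ^ 2 * ((x - a) - K' * y) = (x - a) * r ^ 2 - K' * x * r := by rw [hy]; ring
      rw [e1, e2]; linarith
    exact le_of_mul_le_mul_left this (by positivity)
  have hK'0 : 0 < K' := by positivity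
  have u4 := loc_alg hr8 hN0 ha0.le hy0 hK'0 hy u1 u2
  rw [hsum]
  have e1 : N - (x - a) / ℓ = (r ^ 2 * N - (x - a)) / r ^ 2 := by rw [← hr2]; field_simp
  have e2 : (K' + 12 * (1 + K')) / (ℓ * r) * x = (K' + 12 * (1 + K')) * y / r ^ 2 := by
    rw [← hr2, hy]; field_simp
  rw [e1, e2, abs_div, abs_of_pos (show 0 < r ^ 2 by positivity)]
  gcongr

lemma abel_disc (c g : ℕ → ℝ) (A : ℕ) (hg : ∀ n ≥ A, g (n + 1) ≤ g n) (hg0 : ∀ n ≥ A, 0 ≤ g n)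
    (κ : ℝ) (B : ℕ) (hAB : A ≤ B)
    (hE : ∀ n, A ≤ n → n ≤ B → |∑ k ∈ Finset.Ioc A n, c k| ≤ κ * n) :
    |∑ n ∈ Finset.Ioc A B, c n * g n| ≤ κ * (∑ n ∈ Finset.Ioc A B, g n + A * g A) := by
  have key : ∀ n, A ≤ n → n ≤ B →
      |∑ k ∈ Finset.Ioc A n, c k * g k - (∑ k ∈ Finset.Ioc A n, c k) * g n| ≤
        κ * (∑ k ∈ Finset.Ioc A n, g k - n * g n + A * g A) := by
    intro n hn
    induction n, hn using Nat.le_induction with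
    | base => intro _; simp
    | succ n hn ih =>
      intro hB
      have ih := ih (by omega)
      have hEn := hE n hn (by omega)
      rw [Finset.sum_Ioc_succ_top (by omega), Finset.sum_Ioc_succ_top (by omega),
        Finset.sum_Ioc_succ_top (by omega)]
      have e : ∑ k ∈ Finset.Ioc A n, c k * g k + c (n + 1) * g (n + 1) -
          (∑ k ∈ Finset.Ioc A n, c k + c (n + 1)) * g (n + 1) =
          (∑ k ∈ Finset.Ioc A n, c k * g k - (∑ k ∈ Finset.Ioc A n, c k) * g n) +
          (∑ k ∈ Finset.Ioc A n, c k) * (g n - g (n + 1)) := by ring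
      rw [e]
      refine (abs_add_le _ _).trans ?_
      rw [abs_mul, abs_of_nonneg (show 0 ≤ g n - g (n + 1) by linarith [hg n hn])]
      have := mul_le_mul_of_nonneg_right hEn (show 0 ≤ g n - g (n + 1) by linarith [hg n hn])
      push_cast
      linarith
  have h1 := key B hAB le_rfl
  have h2 := mul_le_mul_of_nonneg_right (hE B hAB le_rfl) (hg0 B hAB)
  rw [← abs_of_nonneg (hg0 B hAB), ← abs_mul, abs_of_nonneg (hg0 B hAB)] at h2
  have h3 := abs_sub_abs_le_abs_sub (∑ k ∈ Finset.Ioc A B, c k * g k) ((∑ k ∈ Finset.Ioc A B, c k) * g B)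
  nlinarith

noncomputable def ff (t : ℝ) : ℝ := Real.log (1 - Real.log (1 - Real.exp (-t)))

noncomputable def II : ℝ := ∫ t in Set.Ioi (0:ℝ), ff t

lemma ff_aux {t : ℝ} (ht : 0 < t) : 0 < 1 - Real.exp (-t) ∧ 1 - Real.exp (-t) < 1 := by
  have : Real.exp (-t) < 1 := Real.exp_lt_one_iff.mpr (by linarith)
  exact ⟨by linarith, by linarith [Real.exp_pos (-t)]⟩

lemma ff_log_neg {t : ℝ} (ht : 0 < t) : 0 < - Real.log (1 - Real.exp (-t)) := by
  have := Real.log_neg (ff_aux ht).1 (ff_aux ht).2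
  linarith

lemma ff_pos {t : ℝ} (ht : 0 < t) : 0 < ff t := Real.log_pos (by linarith [ff_log_neg ht])

lemma ff_anti {s t : ℝ} (hs : 0 < s) (hst : s ≤ t) : ff t ≤ ff s := by
  unfold ff
  apply Real.log_le_log (by linarith [ff_log_neg (hs.trans_le hst)])
  have : Real.log (1 - Real.exp (-s)) ≤ Real.log (1 - Real.exp (-t)) := by
    apply Real.log_le_log (ff_aux hs).1
    have := Real.exp_le_exp.mpr (show -t ≤ -s by linarith)
    linarith
  linarith

lemma ff_le_log {t : ℝ} (ht : 0 < t) : ff t ≤ Real.log (1 + 1 / (Real.exp t - 1)) := by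
  unfold ff
  have h1 := Real.log_le_sub_one_of_pos (show 0 < 1 - Real.log (1 - Real.exp (-t)) by linarith [ff_log_neg ht])
  have h2 : 0 < Real.exp t - 1 := by linarith [Real.add_one_lt_exp ht.ne']
  have h3 : 1 + 1 / (Real.exp t - 1) = (1 - Real.exp (-t))⁻¹ := by
    have := (ff_aux ht).1
    rw [Real.exp_neg] at this ⊢
    have h4 : 0 < Real.exp t := Real.exp_pos t
    field_simp
    ring_nf
  rw [h3, Real.log_inv]
  linarith

lemma ff_le1 {t : ℝ} (ht : 0 < t) : ff t ≤ 2 * t ^ (-(1 / 2) : ℝ) := by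
  refine (ff_le_log ht).trans ?_
  have h2 : t ≤ Real.exp t - 1 := by linarith [Real.add_one_le_exp t]
  have h3 : 1 + 1 / (Real.exp t - 1) ≤ (1 + 1 / √t) ^ 2 := by
    have : 1 / (Real.exp t - 1) ≤ 1 / t := one_div_le_one_div_of_le ht h2
    have e : (1 / √t) ^ 2 = 1 / t := by rw [div_pow, Real.sq_sqrt ht.le, one_pow]
    have : 0 ≤ 1 / √t := by positivity
    nlinarith
  have h6 : 0 < Real.exp t - 1 := ht.trans_le h2
  have h4 := Real.log_le_log (by positivity) h3
  rw [Real.log_pow] at h4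
  have h5 := Real.log_le_sub_one_of_pos (show 0 < 1 + 1 / √t by positivity)
  rw [Real.rpow_neg ht.le, ← Real.sqrt_eq_rpow, ← one_div]
  push_cast at h4
  linarith

lemma ff_le2 {t : ℝ} (ht : 0 < t) : ff t ≤ 6 * t ^ (-3 : ℝ) := by
  refine (ff_le_log ht).trans ?_
  have h1 : t ^ 3 / 6 ≤ Real.exp t - 1 := by
    have := Real.sum_le_exp_of_nonneg ht.le 4
    simp [Finset.sum_range_succ, Nat.factorial] at this
    have : 0 < t ^ 2 / 2 := by positivity
    linarith
  have h0 : 0 < t ^ 3 / 6 := by positivity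
  have h2 : 0 < Real.exp t - 1 := h0.trans_le h1
  have h3 := Real.log_le_sub_one_of_pos (show 0 < 1 + 1 / (Real.exp t - 1) by positivity)
  have h4 : 1 / (Real.exp t - 1) ≤ 1 / (t ^ 3 / 6) := one_div_le_one_div_of_le h0 h1
  rw [Real.rpow_neg ht.le, show (3:ℝ) = ((3:ℕ):ℝ) by norm_num, Real.rpow_natCast]
  have : 1 / (t ^ 3 / 6) = 6 * (t ^ 3)⁻¹ := by field_simp
  linarith

lemma ff_meas : Measurable ff := by unfold ff; fun_prop

lemma ff_int_small {y : ℝ} (hy : 0 ≤ y) : MeasureTheory.IntegrableOn ff (Set.Ioc 0 y) ∧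
    ∫ t in (0:ℝ)..y, ff t ≤ 4 * √y := by
  have h1 : IntervalIntegrable (fun t : ℝ => 2 * t ^ (-(1 / 2) : ℝ)) MeasureTheory.volume 0 y :=
    (intervalIntegral.intervalIntegrable_rpow' (by norm_num)).const_mul 2
  have h1' := h1
  rw [intervalIntegrable_iff_integrableOn_Ioc_of_le hy] at h1
  have h2 : MeasureTheory.IntegrableOn ff (Set.Ioc 0 y) := by
    refine MeasureTheory.Integrable.mono' h1 ff_meas.aestronglyMeasurable ?_
    rw [MeasureTheory.ae_restrict_iff' measurableSet_Ioc]
    refine Eventually.of_forall fun t ht => ?_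
    rw [Real.norm_of_nonneg (ff_pos ht.1).le]
    exact ff_le1 ht.1
  refine ⟨h2, ?_⟩
  have h3 := intervalIntegral.integral_mono_on_of_le_Ioo hy
    ((intervalIntegrable_iff_integrableOn_Ioc_of_le hy).mpr h2) h1' (fun t ht => ff_le1 ht.1)
  refine h3.trans (le_of_eq ?_)
  rw [intervalIntegral.integral_const_mul, integral_rpow (Or.inl (by norm_num)),
    Real.sqrt_eq_rpow]
  norm_num
  ring

lemma ff_int_tail {y : ℝ} (hy : 0 < y) : MeasureTheory.IntegrableOn ff (Set.Ioi y) ∧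
    ∫ t in Set.Ioi y, ff t ≤ 3 / y ^ 2 := by
  have h1 : MeasureTheory.IntegrableOn (fun t : ℝ => 6 * t ^ (-3 : ℝ)) (Set.Ioi y) :=
    (integrableOn_Ioi_rpow_of_lt (by norm_num) hy).const_mul 6
  have h2 : MeasureTheory.IntegrableOn ff (Set.Ioi y) := by
    refine MeasureTheory.Integrable.mono' h1 ff_meas.aestronglyMeasurable ?_
    rw [MeasureTheory.ae_restrict_iff' measurableSet_Ioi]
    refine Eventually.of_forall fun t ht => ?_
    have ht' : 0 < t := hy.trans ht
    rw [Real.norm_of_nonneg (ff_pos ht').le]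
    exact ff_le2 ht'
  refine ⟨h2, ?_⟩
  have h3 := MeasureTheory.setIntegral_mono_on h2 h1 measurableSet_Ioi
    (fun t ht => ff_le2 (hy.trans ht))
  refine h3.trans (le_of_eq ?_)
  rw [MeasureTheory.integral_const_mul, integral_Ioi_rpow_of_lt (by norm_num) hy]
  norm_num
  field_simp
  norm_num

lemma ff_integrable : MeasureTheory.IntegrableOn ff (Set.Ioi 0) := by
  rw [← Set.Ioc_union_Ioi_eq_Ioi (show (0:ℝ) ≤ 1 by norm_num)]
  exact (ff_int_small zero_le_one).1.union (ff_int_tail one_pos).1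

lemma II_split {y : ℝ} (hy : 0 < y) : II = (∫ t in (0:ℝ)..y, ff t) + ∫ t in Set.Ioi y, ff t := by
  unfold II
  rw [intervalIntegral.integral_of_le hy.le, ← MeasureTheory.setIntegral_union
    (by rw [Set.disjoint_left]; intro _ h1 h2; exact absurd h1.2 (not_le.mpr h2)) measurableSet_Ioi
    (ff_int_small hy.le).1 (ff_int_tail hy).1, Set.Ioc_union_Ioi_eq_Ioi hy.le]

lemma ff_tail_nonneg {y : ℝ} (hy : 0 < y) : 0 ≤ ∫ t in Set.Ioi y, ff t :=
  MeasureTheory.setIntegral_nonneg measurableSet_Ioi fun t ht => (ff_pos (hy.trans ht)).le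

lemma ff_ii {x y : ℝ} (hx : 0 ≤ x) (hy : 0 ≤ y) : IntervalIntegrable ff MeasureTheory.volume x y := by
  have : ∀ z : ℝ, 0 ≤ z → IntervalIntegrable ff MeasureTheory.volume 0 z := fun z hz =>
    (intervalIntegrable_iff_integrableOn_Ioc_of_le hz).mpr (ff_int_small hz).1
  exact (this x hx).symm.trans (this y hy)

lemma ff_mul_le {y : ℝ} (hy : 0 < y) : y * ff y ≤ ∫ t in (0:ℝ)..y, ff t := by
  have := intervalIntegral.integral_mono_on_of_le_Ioo hy.le (f := fun _ => ff y) (g := ff) (μ := MeasureTheory.volume)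
    (by simp) (ff_ii le_rfl hy.le) (fun t ht => ff_anti ht.1 ht.2.le)
  simpa using this

lemma II_pos : 0 < II := by
  have h1 := ff_mul_le one_pos
  have h2 := ff_tail_nonneg one_pos
  have h3 := ff_pos one_pos
  rw [II_split one_pos]
  linarith

end SAux

namespace SAux
open Filter Topology

lemma ff_step {s x y : ℝ} (hs : 0 < s) (hx : 0 < x) (hy : y = x + s) :
    s * ff y ≤ ∫ t in x..y, ff t ∧ ∫ t in x..y, ff t ≤ s * ff x := by
  have hxy : x ≤ y := by linarith
  have h1 := intervalIntegral.integral_mono_on_of_le_Ioo hxy (f := fun _ => ff y) (g := ff)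
    (μ := MeasureTheory.volume) (by simp) (ff_ii hx.le (hx.le.trans hxy))
    (fun t ht => ff_anti (hx.trans ht.1) ht.2.le)
  have h2 := intervalIntegral.integral_mono_on_of_le_Ioo hxy (f := ff) (g := fun _ => ff x)
    (μ := MeasureTheory.volume) (ff_ii hx.le (hx.le.trans hxy)) (by simp)
    (fun t ht => ff_anti hx ht.1.le)
  simp only [intervalIntegral.integral_const, smul_eq_mul] at h1 h2
  have e : y - x = s := by linarith
  rw [e] at h1 h2
  exact ⟨h1, h2⟩

lemma ff_sum {s : ℝ} (hs : 0 < s) {A B : ℕ} (hA : 1 ≤ A) (hAB : A ≤ B) :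
    s * ∑ n ∈ Finset.Ioc A B, ff (s * n) ≤ ∫ t in (s * A)..(s * B), ff t ∧
    ∫ t in (s * (A + 1))..(s * (B + 1)), ff t ≤ s * ∑ n ∈ Finset.Ioc A B, ff (s * n) := by
  induction B, hAB using Nat.le_induction with
  | base => simp
  | succ n hn ih =>
    have hn0 : (0:ℝ) < n := by exact_mod_cast (by omega : 0 < n)
    have hA0 : (0:ℝ) < A := by exact_mod_cast hA
    rw [Finset.sum_Ioc_succ_top (by omega), mul_add]
    have i : ∀ x y : ℝ, 0 ≤ x → 0 ≤ y → IntervalIntegrable ff MeasureTheory.volume x y := fun x y => ff_ii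
    push_cast
    rw [← intervalIntegral.integral_add_adjacent_intervals (i (s * A) (s * n) (by positivity) (by positivity))
      (i _ (s * (n + 1)) (by positivity) (by positivity)),
      ← intervalIntegral.integral_add_adjacent_intervals
      (i (s * (A + 1)) (s * (n + 1)) (by positivity) (by positivity))
      (i _ (s * (n + 1 + 1)) (by positivity) (by positivity))]
    have a1 := (ff_step hs (show 0 < s * n by positivity) (show s * (n + 1) = s * n + s by ring)).1
    have a2 := (ff_step hs (show 0 < s * (n + 1 : ℝ) by positivity)
      (show s * (n + 1 + 1) = s * (n + 1 : ℝ) + s by ring)).2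
    constructor <;> linarith [ih.1, ih.2]

lemma ff_int_le {x y : ℝ} (hx : 0 < x) (hy : 0 < y) :
    ∫ t in x..y, ff t = II - (∫ t in (0:ℝ)..x, ff t) - ∫ t in Set.Ioi y, ff t := by
  have h1 := intervalIntegral.integral_add_adjacent_intervals (ff_ii le_rfl hx.le) (ff_ii hx.le hy.le)
  have h2 := II_split hy
  linarith

lemma ff_int0 {x : ℝ} (hx : 0 < x) : 0 ≤ ∫ t in (0:ℝ)..x, ff t :=
  le_trans (mul_nonneg hx.le (ff_pos hx).le) (ff_mul_le hx)

lemma ff_sum_up {s : ℝ} (hs : 0 < s) {A B : ℕ} (hA : 1 ≤ A) (hAB : A ≤ B) :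
    s * ∑ n ∈ Finset.Ioc A B, ff (s * n) ≤ II := by
  have hA0 : (0:ℝ) < A := by exact_mod_cast hA
  have hB0 : (0:ℝ) < B := by exact_mod_cast (by omega : 0 < B)
  have h := (ff_sum hs hA hAB).1
  rw [ff_int_le (by positivity) (by positivity)] at h
  have h1 := ff_int0 (show 0 < s * A by positivity)
  have h2 := ff_tail_nonneg (show 0 < s * B by positivity)
  linarith

lemma ff_sum_low {s : ℝ} (hs : 0 < s) {A B : ℕ} (hA : 1 ≤ A) (hAB : A ≤ B) :
    II - 4 * √(s * (A + 1)) - 3 / (s * (B + 1)) ^ 2 ≤ s * ∑ n ∈ Finset.Ioc A B, ff (s * n) := by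
  have h := (ff_sum hs hA hAB).2
  rw [ff_int_le (by positivity) (by positivity)] at h
  have h1 := (ff_int_small (show 0 ≤ s * (A + 1) by positivity)).2
  have h2 := (ff_int_tail (show 0 < s * (B + 1) by positivity)).2
  linarith

lemma ff_sum_tail {s : ℝ} (hs : 0 < s) {A B : ℕ} (hA : 1 ≤ A) (hAB : A ≤ B) :
    s * ∑ n ∈ Finset.Ioc A B, ff (s * n) ≤ 3 / (s * A) ^ 2 := by
  have hA0 : (0:ℝ) < A := by exact_mod_cast hA
  have hB0 : (0:ℝ) < B := by exact_mod_cast (by omega : 0 < B)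
  have h := (ff_sum hs hA hAB).1
  rw [ff_int_le (by positivity) (by positivity)] at h
  have h1 := II_split (show 0 < s * A by positivity)
  have h2 := ff_tail_nonneg (show 0 < s * B by positivity)
  have h3 := (ff_int_tail (show 0 < s * A by positivity)).2
  linarith

/-- sum of `ff (s p)` over primes in `(A, B]` -/
noncomputable def pS (A B : ℕ) (s : ℝ) : ℝ := ∑ n ∈ Finset.Ioc A B, if n.Prime then ff (s * n) else 0

lemma prime_sum_gen : ∃ C ℓ0 : ℝ, 0 < C ∧ 64 ≤ ℓ0 ∧ ∀ ℓ ≥ ℓ0, ∀ A B : ℕ, Real.exp (ℓ - √ℓ) ≤ A → A ≤ B →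
    (B:ℝ) ≤ Real.exp (ℓ + √ℓ) → ∀ s : ℝ, 0 < s →
    |s * pS A B s - II / ℓ| ≤ C / (ℓ * √ℓ) + (4 * √(s * (A + 1)) + 3 / (s * (B + 1)) ^ 2) / ℓ := by
  obtain ⟨C, ℓ0, hC, hℓ0, h⟩ := prime_local
  refine ⟨C * (2 * II), ℓ0, mul_pos hC (by linarith [II_pos]), hℓ0, fun ℓ hℓ A B hA hAB hB s hs => ?_⟩
  have hA0 : (0:ℝ) < A := (Real.exp_pos _).trans_le hA
  have hA1 : 1 ≤ A := by exact_mod_cast hA0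
  have hℓp : 0 < ℓ := by linarith
  have hab := abel_disc (fun n => (if n.Prime then 1 else 0 : ℝ) - 1 / ℓ) (fun n => ff (s * n)) A
    (fun n hn => ff_anti (mul_pos hs (by exact_mod_cast (by omega : 0 < n))) (by push_cast; nlinarith))
    (fun n hn => (ff_pos (mul_pos hs (by exact_mod_cast (by omega : 0 < n)))).le)
    (C / (ℓ * √ℓ)) B hAB (fun n h1 h2 => h ℓ hℓ A n hA h1 (le_trans (by exact_mod_cast h2) hB))
  have e : ∑ n ∈ Finset.Ioc A B, ((if n.Prime then 1 else 0 : ℝ) - 1 / ℓ) * ff (s * n) =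
      pS A B s - (1 / ℓ) * ∑ n ∈ Finset.Ioc A B, ff (s * n) := by
    unfold pS
    rw [Finset.mul_sum, ← Finset.sum_sub_distrib]
    refine Finset.sum_congr rfl fun n _ => ?_
    split_ifs <;> ring
  simp only [e] at hab
  have u1 := ff_sum_up hs hA1 hAB
  have u2 := ff_sum_low hs hA1 hAB
  have u3 : s * (A * ff (s * A)) ≤ II := by
    have h1 := ff_mul_le (show 0 < s * A by positivity)
    have h2 := II_split (show 0 < s * A by positivity)
    have h3 := ff_tail_nonneg (show 0 < s * A by positivity)
    linarith
  set S := ∑ n ∈ Finset.Ioc A B, ff (s * n) with hS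
  have u4 : |s * pS A B s - s * S / ℓ| ≤ C / (ℓ * √ℓ) * (2 * II) := by
    have e2 : s * pS A B s - s * S / ℓ = s * (pS A B s - 1 / ℓ * S) := by ring
    rw [e2, abs_mul, abs_of_pos hs]
    calc _ ≤ s * (C / (ℓ * √ℓ) * (S + A * ff (s * A))) := by gcongr
      _ = C / (ℓ * √ℓ) * (s * S + s * (A * ff (s * A))) := by ring
      _ ≤ _ := by gcongr; linarith
  have u5 : |s * S / ℓ - II / ℓ| ≤ (4 * √(s * (A + 1)) + 3 / (s * (B + 1)) ^ 2) / ℓ := by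
    rw [← sub_div, abs_div, abs_of_pos hℓp]
    gcongr
    have : 0 ≤ √(s * (A + 1)) := Real.sqrt_nonneg _
    have : 0 ≤ 3 / (s * (B + 1)) ^ 2 := by positivity
    rw [abs_le]
    constructor <;> linarith
  have u6 := abs_sub_le (s * pS A B s) (s * S / ℓ) (II / ℓ)
  have e3 : C * (2 * II) / (ℓ * √ℓ) = C / (ℓ * √ℓ) * (2 * II) := by ring
  rw [e3]
  linarith

noncomputable def Am (m : ℕ) : ℕ := ⌊√m / Real.log m ^ 2⌋₊
noncomputable def Bm (m : ℕ) : ℕ := ⌊√m * Real.log m ^ 2⌋₊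

lemma tlog : Tendsto (fun m : ℕ => Real.log m) atTop atTop :=
  Real.tendsto_log_atTop.comp tendsto_natCast_atTop_atTop

lemma exp_pow5 {r : ℝ} (hr : 4000 ≤ r) : 32 * r ^ 4 ≤ Real.exp r := by
  have h := Real.pow_div_factorial_le_exp r (by linarith) 5
  have e : ((5:ℕ).factorial : ℝ) = 120 := by norm_num [Nat.factorial]
  rw [e] at h
  have : 0 < r ^ 4 := by positivity
  have e2 : r ^ 5 = r ^ 4 * r := by ring
  nlinarith

lemma AB_facts : ∀ᶠ m : ℕ in atTop,
    Real.exp (Real.log m / 2 - √(Real.log m / 2)) ≤ Am m ∧ Am m ≤ Bm m ∧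
    (Bm m : ℝ) ≤ Real.exp (Real.log m / 2 + √(Real.log m / 2)) ∧
    (Am m : ℝ) ≤ √m / Real.log m ^ 2 ∧ (Am m : ℝ) + 1 ≤ 2 * (√m / Real.log m ^ 2) ∧
    √m / Real.log m ^ 2 ≤ Am m + 1 ∧
    (Bm m : ℝ) ≤ √m * Real.log m ^ 2 ∧ √m * Real.log m ^ 2 ≤ 2 * Bm m ∧
    √m * Real.log m ^ 2 ≤ Bm m + 1 := by
  filter_upwards [tlog.eventually_ge_atTop (2 * 4000 ^ 2), eventually_ge_atTop 1] with m hL hm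
  set L := Real.log m with hLdef
  have hm0 : (0:ℝ) < m := by exact_mod_cast hm
  have hsm : √(m:ℝ) = Real.exp (L / 2) := by
    rw [hLdef, Real.exp_half, Real.exp_log hm0]
  set r := √(L / 2) with hr
  have hr2 : r ^ 2 = L / 2 := Real.sq_sqrt (by linarith)
  have hr4 : 4000 ≤ r := Real.le_sqrt_of_sq_le (by linarith)
  have hx := exp_pow5 hr4
  have hLr : 32 * r ^ 4 = 8 * L ^ 2 := by
    have : r ^ 4 = (L / 2) ^ 2 := by rw [← hr2]; ring
    rw [this]; ring
  rw [hLr] at hx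
  have hL0 : 0 < L := by linarith
  have hLsq : 0 < L ^ 2 := by positivity
  have k1 : Real.exp (L / 2 - r) * 8 ≤ √m / L ^ 2 := by
    rw [le_div_iff₀ hLsq, hsm, Real.exp_sub, div_mul_eq_mul_div, div_mul_eq_mul_div,
      div_le_iff₀ (Real.exp_pos r), mul_assoc]
    gcongr
  have k0 : 1 ≤ Real.exp (L / 2 - r) := by
    apply Real.one_le_exp
    nlinarith
  have k2 : √m * L ^ 2 ≤ Real.exp (L / 2 + r) := by
    rw [Real.exp_add, hsm]
    gcongr
    linarith
  have f1 := Nat.floor_le (show 0 ≤ √(m:ℝ) / L ^ 2 by positivity)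
  have f2 := Nat.lt_floor_add_one (√(m:ℝ) / L ^ 2)
  have f3 := Nat.floor_le (show 0 ≤ √(m:ℝ) * L ^ 2 by positivity)
  have f4 := Nat.lt_floor_add_one (√(m:ℝ) * L ^ 2)
  have hAd : Am m = ⌊√(m:ℝ) / L ^ 2⌋₊ := rfl
  have hBd : Bm m = ⌊√(m:ℝ) * L ^ 2⌋₊ := rfl
  rw [← hAd] at f1 f2
  rw [← hBd] at f3 f4
  have k3 : √m / L ^ 2 ≤ √m * L ^ 2 := by
    rw [div_le_iff₀ hLsq, mul_assoc]
    have : (1:ℝ) ≤ L ^ 2 * L ^ 2 := by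
      rw [← pow_add]; exact one_le_pow₀ (by linarith)
    exact le_mul_of_one_le_right (Real.sqrt_nonneg _) this
  refine ⟨by linarith, Nat.floor_le_floor k3, by linarith, f1, by linarith, f2.le, f3, by linarith, f4.le⟩

lemma prime_sum (c1 c2 : ℝ) (hc1 : 0 < c1) :
    ∃ C : ℝ, 0 < C ∧ ∀ᶠ m : ℕ in atTop, ∀ κ : ℝ, c1 ≤ κ → κ ≤ c2 → ∀ s : ℝ, s = κ / √(m * Real.log m) →
      |pS (Am m) (Bm m) s - 2 * II / (s * Real.log m)| ≤ C * √m / Real.log m ∧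
      ∑ n ∈ Finset.Ioc (Bm m) m, ff (s * n) ≤ C * √m / Real.log m := by
  obtain ⟨C, ℓ0, hC, hℓ0, h⟩ := prime_sum_gen
  set D := (4 * C + 8 * √(2 * |c2|) + 12 / c1 ^ 2) / c1 + 12 / c1 ^ 3 with hD
  refine ⟨D, by positivity, ?_⟩
  filter_upwards [AB_facts, tlog.eventually_ge_atTop (2 * ℓ0), eventually_ge_atTop 1] with m hAB hL hm κ hκ1 hκ2 s hs
  set L := Real.log m with hLdef
  have hm0 : (0:ℝ) < m := by exact_mod_cast hm
  have hκ0 : 0 < κ := hc1.trans_le hκ1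
  have hL1 : 1 ≤ L := by linarith
  have hL0 : 0 < L := by linarith
  set q := √L with hq
  have hq2 : q ^ 2 = L := Real.sq_sqrt hL0.le
  have hq1 : 1 ≤ q := by rw [hq]; exact Real.le_sqrt_of_sq_le (by linarith)
  set X := √(m:ℝ) with hX
  have hX0 : 0 < X := Real.sqrt_pos.mpr hm0
  have hsX : s = κ / (X * q) := by rw [hs, Real.sqrt_mul hm0.le]
  have hs0 : 0 < s := by rw [hsX]; positivity
  obtain ⟨a1, a2, a3, a4, a5, a6, a7, a8, a9⟩ := hAB
  have g := h (L / 2) (by linarith) (Am m) (Bm m) a1 a2 a3 s hs0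
  have b1 : √(s * ((Am m : ℝ) + 1)) ≤ √(2 * |c2|) / q := by
    have : s * ((Am m : ℝ) + 1) ≤ 2 * |c2| / q ^ 2 := by
      calc s * ((Am m : ℝ) + 1) ≤ s * (2 * (X / L ^ 2)) := by gcongr
        _ = 2 * κ / (q * (q ^ 2) ^ 2) := by rw [hsX, ← hq2]; field_simp
        _ ≤ 2 * |c2| / q ^ 2 := by
          have : κ ≤ |c2| := hκ2.trans (le_abs_self _)
          gcongr
          have : (1:ℝ) ≤ q ^ 3 := one_le_pow₀ hq1
          nlinarith [show 0 < q ^ 2 by positivity]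
    refine (Real.sqrt_le_sqrt this).trans (le_of_eq ?_)
    rw [Real.sqrt_div (by positivity), Real.sqrt_sq (by linarith)]
  have b0 : c1 * q ^ 3 ≤ s * (X * L ^ 2) := by
    calc c1 * q ^ 3 ≤ κ * q ^ 3 := by gcongr
      _ = s * (X * L ^ 2) := by rw [hsX, ← hq2]; field_simp
  have b2 : 3 / (s * ((Bm m : ℝ) + 1)) ^ 2 ≤ 3 / c1 ^ 2 / q := by
    have : c1 * q ^ 3 ≤ s * ((Bm m : ℝ) + 1) := b0.trans (by gcongr)
    calc 3 / (s * ((Bm m : ℝ) + 1)) ^ 2 ≤ 3 / (c1 * q ^ 3) ^ 2 := by gcongr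
      _ = 3 / c1 ^ 2 / q ^ 6 := by field_simp
      _ ≤ 3 / c1 ^ 2 / q := by
        gcongr
        exact le_self_pow₀ hq1 (by norm_num)
  have b3 : C / (L / 2 * √(L / 2)) ≤ 4 * C / q ^ 3 := by
    have : q / 2 ≤ √(L / 2) := by
      apply Real.le_sqrt_of_sq_le
      rw [div_pow, hq2]; linarith
    calc C / (L / 2 * √(L / 2)) ≤ C / (L / 2 * (q / 2)) := by gcongr
      _ = _ := by rw [← hq2]; field_simp; norm_num
  have b4 : |s * pS (Am m) (Bm m) s - II / (L / 2)| ≤ (4 * C + 8 * √(2 * |c2|) + 12 / c1 ^ 2) / q ^ 3 := by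
    refine g.trans ?_
    calc _ ≤ 4 * C / q ^ 3 + (4 * (√(2 * |c2|) / q) + 3 / c1 ^ 2 / q) / (L / 2) := by gcongr
      _ = (4 * C + 8 * √(2 * |c2|) + 6 / c1 ^ 2) / q ^ 3 := by rw [← hq2]; field_simp; ring
      _ ≤ _ := by gcongr; norm_num
  have hsinv : 1 / s ≤ X * q / c1 := by
    rw [hsX, one_div_div]
    gcongr
  have hD2 : (4 * C + 8 * √(2 * |c2|) + 12 / c1 ^ 2) / c1 ≤ D := by
    rw [hD]; have : 0 < 12 / c1 ^ 3 := by positivity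
    linarith
  have hD3 : 12 / c1 ^ 3 ≤ D := by
    rw [hD]
    have : 0 < (4 * C + 8 * √(2 * |c2|) + 12 / c1 ^ 2) / c1 := by positivity
    linarith
  constructor
  · have e : pS (Am m) (Bm m) s - 2 * II / (s * L) = 1 / s * (s * pS (Am m) (Bm m) s - II / (L / 2)) := by
      field_simp
    rw [e, abs_mul, abs_of_pos (show 0 < 1 / s by positivity)]
    calc _ ≤ X * q / c1 * ((4 * C + 8 * √(2 * |c2|) + 12 / c1 ^ 2) / q ^ 3) := by gcongr
      _ = (4 * C + 8 * √(2 * |c2|) + 12 / c1 ^ 2) / c1 * X / L := by rw [← hq2]; field_simp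
      _ ≤ D * X / L := by gcongr
  · by_cases hBm : Bm m ≤ m
    · have hB1 : 1 ≤ Bm m := by
        have : (0:ℝ) < Bm m := by
          have : 0 < X * L ^ 2 := by positivity
          linarith
        exact_mod_cast this
      have t := ff_sum_tail hs0 hB1 hBm
      have t2 : c1 * q ^ 3 / 2 ≤ s * Bm m := by
        have : s * (X * L ^ 2) ≤ s * (2 * Bm m) := by gcongr
        linarith
      have e : ∑ n ∈ Finset.Ioc (Bm m) m, ff (s * n) = 1 / s * (s * ∑ n ∈ Finset.Ioc (Bm m) m, ff (s * n)) := by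
        field_simp
      rw [e]
      calc _ ≤ 1 / s * (3 / (s * Bm m) ^ 2) := by gcongr
        _ ≤ X * q / c1 * (3 / (c1 * q ^ 3 / 2) ^ 2) := by gcongr
        _ = 12 / c1 ^ 3 * X / q ^ 5 := by field_simp; norm_num
        _ ≤ D * X / L := by
          rw [← hq2]
          gcongr
          norm_num
    · rw [Finset.Ioc_eq_empty (by omega), Finset.sum_empty]
      positivity

end SAux

namespace SAux
open Filter Topology

lemma card_ct (m : ℕ) (c : Multiset ℕ) (h1 : c.sum ≤ m) (h2 : ∀ a ∈ c, 2 ≤ a) :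
    ((Finset.univ.filter (fun σ : Equiv.Perm (Fin m) => σ.cycleType = c)).card : ℝ) *
      (((m - c.sum).factorial : ℝ) * (c.prod : ℝ) * ∏ n ∈ c.toFinset, ((c.count n).factorial : ℝ)) = (m.factorial : ℝ) := by
  have := Equiv.Perm.card_of_cycleType_mul_eq (Fin m) c
  rw [if_pos ⟨by simpa using h1, h2⟩, Fintype.card_fin] at this
  rw [← this]
  push_cast
  congr!

lemma count_fact_mono (c d : Multiset ℕ) (h : d ≤ c) :
    ∏ n ∈ d.toFinset, ((d.count n).factorial : ℝ) ≤ ∏ n ∈ c.toFinset, ((c.count n).factorial : ℝ) := by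
  have hs : d.toFinset ⊆ c.toFinset := Multiset.toFinset_subset.2 (Multiset.subset_of_le h)
  calc ∏ n ∈ d.toFinset, ((d.count n).factorial : ℝ)
      ≤ ∏ n ∈ d.toFinset, ((c.count n).factorial : ℝ) := by
        apply Finset.prod_le_prod
        · intros; positivity
        · intro i _
          exact_mod_cast Nat.factorial_le (Multiset.le_iff_count.1 h i)
    _ ≤ _ := by
        apply Finset.prod_le_prod_of_subset_of_one_le hs
        · intros; positivity
        · intro i _ _
          exact_mod_cast Nat.succ_le_of_lt (Nat.factorial_pos _)

lemma card_contains (m : ℕ) (D : Finset ℕ) :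
    ((Finset.univ.filter (fun σ : Equiv.Perm (Fin m) => D.val ≤ σ.cycleType)).card : ℝ) * (∏ d ∈ D, (d:ℝ))
      ≤ (m.factorial : ℝ) := by
  set F := Finset.univ.filter (fun σ : Equiv.Perm (Fin m) => D.val ≤ σ.cycleType) with hF
  set CC := F.image Equiv.Perm.cycleType with hCC
  set N := D.val.sum with hN
  have hcard : (F.card : ℝ) = ∑ c ∈ CC, ((Finset.univ.filter (fun σ : Equiv.Perm (Fin m) => σ.cycleType = c)).card : ℝ) := by
    rw [Finset.card_eq_sum_card_image Equiv.Perm.cycleType F]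
    push_cast
    apply Finset.sum_congr rfl
    intro c hc
    congr 2
    ext σ
    simp only [hF, Finset.mem_filter, Finset.mem_univ, true_and, and_iff_right_iff_imp]
    rintro rfl
    obtain ⟨τ, hτ, hτ2⟩ := Finset.mem_image.1 hc
    rw [← hτ2]
    exact (Finset.mem_filter.1 hτ).2
  have key : ∀ c ∈ CC, ((Finset.univ.filter (fun σ : Equiv.Perm (Fin m) => σ.cycleType = c)).card : ℝ) * (∏ d ∈ D, (d:ℝ)) * ((m - N).factorial : ℝ)
      ≤ (m.factorial : ℝ) * ((Finset.univ.filter (fun σ : Equiv.Perm (Fin (m-N)) => σ.cycleType = c - D.val)).card : ℝ) := by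
    intro c hc
    obtain ⟨τ, hτ, hτ2⟩ := Finset.mem_image.1 hc
    have hDc : D.val ≤ c := by rw [← hτ2]; exact (Finset.mem_filter.1 hτ).2
    have h1 : c.sum ≤ m := by rw [← hτ2]; simpa using Equiv.Perm.sum_cycleType_le τ
    have h2 : ∀ a ∈ c, 2 ≤ a := by
      intro a ha; rw [← hτ2] at ha; exact Equiv.Perm.two_le_of_mem_cycleType ha
    have hsplit : c = (c - D.val) + D.val := (tsub_add_cancel_of_le hDc).symm
    have hsum : c.sum = (c - D.val).sum + N := by
      conv_lhs => rw [hsplit]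
      rw [Multiset.sum_add]
    have hprod : c.prod = (c - D.val).prod * ∏ d ∈ D, d := by
      conv_lhs => rw [hsplit]
      rw [Multiset.prod_add, Finset.prod_val]; rfl
    have e1 := card_ct m c h1 h2
    have e2 := card_ct (m-N) (c - D.val) (by omega) (fun a ha => h2 a (Multiset.mem_of_le (tsub_le_self) ha))
    have e3 : m - N - (c - D.val).sum = m - c.sum := by omega
    rw [e3] at e2
    have e4 := count_fact_mono c (c - D.val) tsub_le_self
    set X := ((Finset.univ.filter (fun σ : Equiv.Perm (Fin m) => σ.cycleType = c)).card : ℝ)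
    set Y := ((Finset.univ.filter (fun σ : Equiv.Perm (Fin (m-N)) => σ.cycleType = c - D.val)).card : ℝ)
    have hX : 0 ≤ X := Nat.cast_nonneg _
    have hY : 0 ≤ Y := Nat.cast_nonneg _
    have hprodR : (c.prod : ℝ) = ((c - D.val).prod : ℝ) * ∏ d ∈ D, (d:ℝ) := by
      rw [hprod, Nat.cast_mul, Nat.cast_prod]
    rw [← e1, ← e2, hprodR]
    have h0 : 0 ≤ (((c - D.val).prod : ℕ) : ℝ) := Nat.cast_nonneg _
    have h0' : 0 ≤ ((m - c.sum).factorial : ℝ) := Nat.cast_nonneg _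
    have h0'' : 0 ≤ ∏ d ∈ D, (d:ℝ) := Finset.prod_nonneg (fun i _ => Nat.cast_nonneg i)
    generalize (((c - D.val).prod : ℕ) : ℝ) = Z at *
    generalize ((m - c.sum).factorial : ℝ) = W at *
    generalize ∏ d ∈ D, (d:ℝ) = V at *
    clear_value X Y
    have : 0 ≤ X * V * Y * W * Z := by positivity
    have := mul_le_mul_of_nonneg_left e4 this
    linarith
  have hle : ∑ c ∈ CC, ((Finset.univ.filter (fun σ : Equiv.Perm (Fin (m-N)) => σ.cycleType = c - D.val)).card : ℝ) ≤ ((m-N).factorial : ℝ) := by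
    have hinj : Set.InjOn (fun c : Multiset ℕ => c - D.val) CC := by
      intro c hc c' hc' h
      obtain ⟨τ, hτ, hτ2⟩ := Finset.mem_image.1 hc
      obtain ⟨τ', hτ', hτ2'⟩ := Finset.mem_image.1 hc'
      have hDc : D.val ≤ c := by rw [← hτ2]; exact (Finset.mem_filter.1 hτ).2
      have hDc' : D.val ≤ c' := by rw [← hτ2']; exact (Finset.mem_filter.1 hτ').2
      rw [← tsub_add_cancel_of_le hDc, ← tsub_add_cancel_of_le hDc']
      simp only at h
      rw [h]
    have := Finset.sum_image (f := fun c => ((Finset.univ.filter (fun σ : Equiv.Perm (Fin (m-N)) => σ.cycleType = c)).card : ℝ)) hinj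
    rw [← this]
    have h2 := Finset.sum_card_fiberwise_eq_card_filter (Finset.univ : Finset (Equiv.Perm (Fin (m-N)))) (CC.image (fun c : Multiset ℕ => c - D.val)) Equiv.Perm.cycleType
    have h3 : (Finset.univ.filter (fun σ : Equiv.Perm (Fin (m-N)) => σ.cycleType ∈ (CC.image (fun c : Multiset ℕ => c - D.val)))).card ≤ (m-N).factorial := by
      refine (Finset.card_le_univ _).trans ?_
      rw [Fintype.card_perm, Fintype.card_fin]
    rw [← h2] at h3
    exact_mod_cast h3
  have hpos : (0:ℝ) < ((m-N).factorial : ℝ) := by positivity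
  have : (F.card : ℝ) * (∏ d ∈ D, (d:ℝ)) * ((m-N).factorial : ℝ) ≤ (m.factorial : ℝ) * ((m-N).factorial : ℝ) := by
    calc _ = ∑ c ∈ CC, ((Finset.univ.filter (fun σ : Equiv.Perm (Fin m) => σ.cycleType = c)).card : ℝ) * (∏ d ∈ D, (d:ℝ)) * ((m - N).factorial : ℝ) := by
          rw [hcard, Finset.sum_mul, Finset.sum_mul]
      _ ≤ _ := Finset.sum_le_sum key
      _ ≤ _ := by rw [← Finset.mul_sum]; gcongr
  exact le_of_mul_le_mul_right this hpos

end SAux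

namespace SAux
open Filter Topology

lemma msum_mono {d c : Multiset ℕ} (h : d ≤ c) : d.sum ≤ c.sum := by
  obtain ⟨e, rfl⟩ := Multiset.le_iff_exists_add.1 h
  simp

lemma order_bound (m y : ℕ) (hm : 1 ≤ m) (σ : Equiv.Perm (Fin m)) :
    orderOf σ ≤ m ^ (m / (y^2+1) + y) * ∏ p ∈ ((Finset.Ioc y m).filter Nat.Prime).filter
      (fun p => ∃ a ∈ σ.cycleType, a ≤ y^2 ∧ p ∣ a), p := by
  set c := σ.cycleType with hc
  have hsum : c.sum ≤ m := by simpa using Equiv.Perm.sum_cycleType_le σ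
  have h2 : ∀ a ∈ c, 2 ≤ a := fun a ha => Equiv.Perm.two_le_of_mem_cycleType ha
  have hle : ∀ a ∈ c, a ≤ m := fun a ha => (Multiset.le_sum_of_mem ha).trans hsum
  set T := ((Finset.Ioc y m).filter Nat.Prime).filter (fun p => ∃ a ∈ c, a ≤ y^2 ∧ p ∣ a) with hT
  set big := c.filter (fun a => y^2 < a) with hbig
  set Q := ∏ p ∈ (Finset.Ioc 0 y).filter Nat.Prime, p ^ (Nat.log p m) with hQ
  have hTpos : 0 < ∏ p ∈ T, p := by
    apply Finset.prod_pos
    intro p hp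
    exact (Finset.mem_filter.1 (Finset.mem_filter.1 hp).1).2.pos
  have hQpos : 0 < Q := by
    apply Finset.prod_pos
    intro p hp
    exact pow_pos (Finset.mem_filter.1 hp).2.pos _
  have hbpos : 0 < big.prod := by
    apply Nat.pos_of_ne_zero
    apply Multiset.prod_ne_zero
    intro h0
    have := h2 0 (Multiset.mem_of_mem_filter h0)
    omega
  have hdvd : orderOf σ ∣ big.prod * Q * ∏ p ∈ T, p := by
    rw [← Equiv.Perm.lcm_cycleType, Multiset.lcm_dvd]
    intro a ha
    by_cases hay : y^2 < a
    · rw [mul_assoc]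
      exact Dvd.dvd.mul_right (Multiset.dvd_prod (Multiset.mem_filter.2 ⟨ha, hay⟩)) _
    push Not at hay
    have ham := hle a ha
    have ha2 := h2 a ha
    rw [mul_assoc]
    apply Dvd.dvd.mul_left
    rw [Nat.dvd_iff_prime_pow_dvd_dvd]
    intro p k hp hk
    rcases Nat.eq_zero_or_pos k with rfl | hk0
    · simp
    have hka : p^k ≤ a := Nat.le_of_dvd (by omega) hk
    have hpa : p ∣ a := (dvd_pow_self p (by omega)).trans hk
    have hpa' : p ≤ a := Nat.le_of_dvd (by omega) hpa
    by_cases hpy : p ≤ y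
    · apply Dvd.dvd.mul_right
      have : p ^ (Nat.log p m) ∣ Q := Finset.dvd_prod_of_mem (fun p => p ^ (Nat.log p m))
        (Finset.mem_filter.2 ⟨Finset.mem_Ioc.2 ⟨hp.pos, hpy⟩, hp⟩)
      refine (pow_dvd_pow p ?_).trans this
      exact Nat.le_log_of_pow_le hp.one_lt (hka.trans ham)
    · push Not at hpy
      apply Dvd.dvd.mul_left
      have hk1 : k = 1 := by
        by_contra hne
        have : p^2 ≤ p^k := Nat.pow_le_pow_right hp.pos (by omega)
        have : y^2 < p^2 := Nat.pow_lt_pow_left hpy (by norm_num)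
        omega
      subst hk1
      rw [pow_one]
      exact Finset.dvd_prod_of_mem (fun p => p) (Finset.mem_filter.2 ⟨Finset.mem_filter.2 ⟨Finset.mem_Ioc.2 ⟨hpy, hpa'.trans ham⟩, hp⟩, a, ha, hay, hpa⟩)
  refine (Nat.le_of_dvd (by positivity) hdvd).trans ?_
  apply Nat.mul_le_mul_right
  rw [pow_add]
  apply Nat.mul_le_mul
  · have hcard : big.card ≤ m / (y^2+1) := by
      rw [Nat.le_div_iff_mul_le (by positivity)]
      have h1 : big.card • (y^2+1) ≤ big.sum := Multiset.card_nsmul_le_sum (fun a ha => (Multiset.mem_filter.1 ha).2)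
      have h3 : big.sum ≤ c.sum := msum_mono (Multiset.filter_le _ _)
      rw [smul_eq_mul] at h1
      omega
    exact (Multiset.prod_le_pow_card big m (fun a ha => hle a (Multiset.mem_of_mem_filter ha))).trans (Nat.pow_le_pow_right hm hcard)
  · have : Q ≤ m ^ ((Finset.Ioc 0 y).filter Nat.Prime).card := by
      apply Finset.prod_le_pow_card
      intro p _
      exact Nat.pow_log_le_self p (by omega)
    refine this.trans (Nat.pow_le_pow_right hm ?_)
    exact (Finset.card_filter_le _ _).trans (by simp)

lemma exists_x (m y : ℕ) (σ : Equiv.Perm (Fin m)) :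
    ∃ x : ↥((Finset.Ioc y m).filter Nat.Prime) → ℕ, (∀ p, x p ≤ m) ∧
      (∀ p, x p ≠ 0 ↔ ∃ a ∈ σ.cycleType, a ≤ y^2 ∧ (p:ℕ) ∣ a) ∧
      (∀ p, x p ≠ 0 → (p:ℕ) * x p ∈ σ.cycleType ∧ p * x p ≤ y^2) := by
  have : ∀ p : ↥((Finset.Ioc y m).filter Nat.Prime), ∃ j : ℕ, j ≤ m ∧ (j ≠ 0 ↔ ∃ a ∈ σ.cycleType, a ≤ y^2 ∧ (p:ℕ) ∣ a) ∧
      (j ≠ 0 → (p:ℕ) * j ∈ σ.cycleType ∧ p * j ≤ y^2) := by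
    intro p
    have hp := (Finset.mem_filter.1 p.2).2
    by_cases h : ∃ a ∈ σ.cycleType, a ≤ y^2 ∧ (p:ℕ) ∣ a
    · obtain ⟨a, ha, hay, j, rfl⟩ := h
      have h2 := Equiv.Perm.two_le_of_mem_cycleType ha
      have hle : (p:ℕ) * j ≤ m := (Multiset.le_sum_of_mem ha).trans (by simpa using Equiv.Perm.sum_cycleType_le σ)
      have hj : j ≠ 0 := by rintro rfl; simp at h2
      refine ⟨j, (Nat.le_mul_of_pos_left j hp.pos).trans hle, ?_, fun _ => ⟨ha, hay⟩⟩
      exact ⟨fun _ => ⟨_, ha, hay, dvd_mul_right _ _⟩, fun _ => hj⟩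
    · exact ⟨0, Nat.zero_le _, by simpa using h, by simp⟩
  choose x h1 h2 h3 using this
  exact ⟨x, h1, h2, h3⟩

lemma partial_log (t : ℝ) (ht : 0 < t) (n : ℕ) :
    ∑ j ∈ Finset.range (n+1), (if j = 0 then (1:ℝ) else Real.exp (-(t*j))/j) ≤ Real.exp (ff t) := by
  have h := ff_aux ht
  have h' := ff_log_neg ht
  have hs := Real.hasSum_pow_div_log_of_abs_lt_one (x := Real.exp (-t)) (by
    rw [abs_of_pos (Real.exp_pos _)]; linarith [h.1])
  have h1 := sum_le_hasSum (Finset.range n) (fun i _ => by positivity) hs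
  rw [ff, Real.exp_log (by linarith), Finset.sum_range_succ']
  simp only [if_true, Nat.succ_ne_zero, if_false]
  have : ∑ i ∈ Finset.range n, Real.exp (-(t * ((i+1:ℕ):ℝ))) / ((i+1:ℕ):ℝ) = ∑ i ∈ Finset.range n, Real.exp (-t) ^ (i+1) / ((i:ℝ)+1) := by
    apply Finset.sum_congr rfl
    intro i _
    rw [← Real.exp_nat_mul]
    push_cast
    congr 2
    ring
  rw [this]
  linarith

lemma upper1 (m y : ℕ) (hm : 1 ≤ m) (s : ℝ) (hs : 0 < s) :
    (∑ σ : Equiv.Perm (Fin m), (orderOf σ : ℝ)) / (m.factorial : ℝ) ≤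
      (m:ℝ) ^ (m / (y^2+1) + y) * Real.exp (s * m + ∑ p ∈ (Finset.Ioc y m).filter Nat.Prime, ff (s*p)) := by
  set P := (Finset.Ioc y m).filter Nat.Prime with hP
  choose x hx1 hx2 hx3 using exists_x m y
  set f : ↥P → ℕ → ℝ := fun p j => if j = 0 then (1:ℝ) else Real.exp (-(s*(p:ℕ)*j))/j with hf
  set q : ↥P → ℕ → ℝ := fun p j => if j = 0 then (1:ℝ) else ((p:ℕ):ℝ) with hq
  set X := Fintype.piFinset (fun _ : ↥P => Finset.range (m+1)) with hX
  have hT : ∀ σ, ((∏ p ∈ P.filter (fun p => ∃ a ∈ σ.cycleType, a ≤ y^2 ∧ p ∣ a), p : ℕ) : ℝ) = ∏ p : ↥P, q p (x σ p) := by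
    intro σ
    rw [Finset.prod_filter, ← Finset.prod_coe_sort, Nat.cast_prod]
    apply Finset.prod_congr rfl
    intro p _
    simp only [hq]
    by_cases h : x σ p = 0
    · have := (not_congr (hx2 σ p)).1 (by simpa using h)
      rw [if_neg this, if_pos h, Nat.cast_one]
    · rw [if_pos ((hx2 σ p).1 h), if_neg h]
  have hxX : ∀ σ, x σ ∈ X := by
    intro σ
    rw [hX, Fintype.mem_piFinset]
    intro p
    exact Finset.mem_range.2 (Nat.lt_succ_of_le (hx1 σ p))
  have key : ∀ v ∈ X, ∑ σ ∈ Finset.univ.filter (fun σ : Equiv.Perm (Fin m) => x σ = v), ∏ p : ↥P, q p (x σ p)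
      ≤ (m.factorial : ℝ) * Real.exp (s*m) * ∏ p : ↥P, f p (v p) := by
    intro v _
    have hf0 : 0 ≤ ∏ p : ↥P, f p (v p) := by
      apply Finset.prod_nonneg
      intro p _
      simp only [hf]
      split_ifs <;> positivity
    by_cases hne : ∃ σ, x σ = v
    swap
    · push Not at hne
      rw [Finset.filter_false_of_mem (fun σ _ => hne σ), Finset.sum_empty]
      positivity
    obtain ⟨τ, rfl⟩ := hne
    set v := x τ with hv
    set R : Finset ↥P := Finset.univ.filter (fun p => v p ≠ 0) with hR
    have hRm : ∀ p ∈ R, v p ≠ 0 := fun p hp => (Finset.mem_filter.1 hp).2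
    have hinj : Set.InjOn (fun p : ↥P => (p:ℕ) * v p) R := by
      intro p hp p' hp' he
      simp only at he
      by_contra hne
      have hpr := (Finset.mem_filter.1 p.2)
      have hpr' := (Finset.mem_filter.1 p'.2)
      have hne' : (p:ℕ) ≠ p' := fun h => hne (Subtype.ext h)
      have hco : Nat.Coprime (p:ℕ) p' := (Nat.coprime_primes hpr.2 hpr'.2).2 hne'
      have hd : (p:ℕ) * p' ∣ p * v p := hco.mul_dvd_of_dvd_of_dvd (dvd_mul_right _ _) (he ▸ dvd_mul_right _ _)
      have h3 := hx3 τ p (hRm p hp)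
      have hpos : 0 < (p:ℕ) * v p := Nat.mul_pos hpr.2.pos (Nat.pos_of_ne_zero (hRm p hp))
      have h4 := Nat.le_of_dvd hpos hd
      have h5 := (Finset.mem_Ioc.1 hpr.1).1
      have h6 := (Finset.mem_Ioc.1 hpr'.1).1
      have h7 : (p:ℕ) * v p ≤ y^2 := h3.2
      nlinarith
    set D := R.image (fun p : ↥P => (p:ℕ) * v p) with hD
    have hDle : ∀ σ, x σ = v → D.val ≤ σ.cycleType := by
      intro σ hσ
      rw [Multiset.le_iff_subset D.nodup]
      intro a ha
      obtain ⟨p, hp, rfl⟩ := Finset.mem_image.1 (show a ∈ D from ha)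
      have := hx3 σ p (by rw [hσ]; exact hRm p hp)
      rw [hσ] at this
      exact this.1
    have hcc := card_contains m D
    have hDprod : ∏ d ∈ D, (d:ℝ) = ∏ p ∈ R, ((p:ℕ):ℝ) * (v p : ℝ) := by
      rw [hD, Finset.prod_image hinj]
      push_cast; rfl
    have hDsum : ∑ p ∈ R, (p:ℕ) * v p ≤ m := by
      have h1 : D.val.sum ≤ τ.cycleType.sum := msum_mono (hDle τ rfl)
      have h2 : τ.cycleType.sum ≤ m := by simpa using Equiv.Perm.sum_cycleType_le τ
      have h3 : D.val.sum = ∑ p ∈ R, (p:ℕ) * v p := by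
        rw [Finset.sum_val, hD]
        exact Finset.sum_image hinj
      omega
    have hqe : ∏ p : ↥P, q p (v p) = ∏ p ∈ R, ((p:ℕ):ℝ) := by
      rw [hR, Finset.prod_filter]
      apply Finset.prod_congr rfl
      intro p _
      simp only [hq]
      by_cases h : v p = 0 <;> simp [h]
    have hfe : ∏ p : ↥P, f p (v p) = Real.exp (-(s * ((∑ p ∈ R, (p:ℕ) * v p : ℕ):ℝ))) * (∏ p ∈ R, (v p : ℝ))⁻¹ := by
      rw [Nat.cast_sum, Finset.mul_sum, ← Finset.sum_neg_distrib, Real.exp_sum, ← Finset.prod_inv_distrib, ← Finset.prod_mul_distrib, hR, Finset.prod_filter]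
      apply Finset.prod_congr rfl
      intro p _
      simp only [hf]
      by_cases h : v p = 0
      · simp [h]
      · simp only [h, if_false, ne_eq, not_false_eq_true, if_true]
        rw [div_eq_mul_inv]
        push_cast
        ring_nf
    have hsum1 : ∑ σ ∈ Finset.univ.filter (fun σ : Equiv.Perm (Fin m) => x σ = v), ∏ p : ↥P, q p (x σ p)
        = ((Finset.univ.filter (fun σ : Equiv.Perm (Fin m) => x σ = v)).card : ℝ) * ∏ p ∈ R, ((p:ℕ):ℝ) := by
      rw [← hqe, ← nsmul_eq_mul, ← Finset.sum_const]
      apply Finset.sum_congr rfl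
      intro σ hσ
      rw [(Finset.mem_filter.1 hσ).2]
    rw [hsum1, hfe]
    have hVpos : 0 < ∏ p ∈ R, (v p : ℝ) := by
      apply Finset.prod_pos
      intro p hp
      exact_mod_cast Nat.pos_of_ne_zero (hRm p hp)
    have hE : 1 ≤ Real.exp (s*m) * Real.exp (-(s * ((∑ p ∈ R, (p:ℕ) * v p : ℕ):ℝ))) := by
      rw [← Real.exp_add]
      apply Real.one_le_exp
      have : ((∑ p ∈ R, (p:ℕ) * v p : ℕ):ℝ) ≤ m := by exact_mod_cast hDsum
      nlinarith
    have hcl : ((Finset.univ.filter (fun σ : Equiv.Perm (Fin m) => x σ = v)).card : ℝ) ≤ ((Finset.univ.filter (fun σ : Equiv.Perm (Fin m) => D.val ≤ σ.cycleType)).card : ℝ) := by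
      have : (Finset.univ.filter (fun σ : Equiv.Perm (Fin m) => x σ = v)).card ≤ (Finset.univ.filter (fun σ : Equiv.Perm (Fin m) => D.val ≤ σ.cycleType)).card := by
        apply Finset.card_le_card
        intro σ hσ
        exact Finset.mem_filter.2 ⟨Finset.mem_univ _, hDle σ (Finset.mem_filter.1 hσ).2⟩
      exact_mod_cast this
    have hPpos : 0 ≤ ∏ p ∈ R, ((p:ℕ):ℝ) := Finset.prod_nonneg (fun i _ => Nat.cast_nonneg _)
    rw [hDprod, Finset.prod_mul_distrib] at hcc
    have h9 : ((Finset.univ.filter (fun σ : Equiv.Perm (Fin m) => x σ = v)).card : ℝ) * ∏ p ∈ R, ((p:ℕ):ℝ) ≤ (m.factorial : ℝ) * (∏ p ∈ R, (v p : ℝ))⁻¹ := by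
      rw [← div_eq_mul_inv, le_div_iff₀ hVpos, mul_assoc]
      refine le_trans ?_ hcc
      gcongr
    refine h9.trans ?_
    have h10 : 0 ≤ (m.factorial : ℝ) * (∏ p ∈ R, (v p : ℝ))⁻¹ := by positivity
    have := mul_le_mul_of_nonneg_left hE h10
    linarith
  have hfac : (0:ℝ) < m.factorial := by positivity
  rw [div_le_iff₀ hfac]
  have step1 : ∑ σ : Equiv.Perm (Fin m), (orderOf σ : ℝ) ≤ (m:ℝ) ^ (m / (y^2+1) + y) * ∑ σ : Equiv.Perm (Fin m), ∏ p : ↥P, q p (x σ p) := by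
    rw [Finset.mul_sum]
    apply Finset.sum_le_sum
    intro σ _
    rw [← hT σ]
    exact_mod_cast order_bound m y hm σ
  have step2 : ∑ σ : Equiv.Perm (Fin m), ∏ p : ↥P, q p (x σ p) ≤ (m.factorial : ℝ) * Real.exp (s*m) * ∏ p : ↥P, ∑ j ∈ Finset.range (m+1), f p j := by
    rw [Finset.prod_univ_sum, Finset.mul_sum, ← Finset.sum_fiberwise_of_maps_to (fun σ _ => hxX σ)]
    exact Finset.sum_le_sum key
  have step3 : ∏ p : ↥P, ∑ j ∈ Finset.range (m+1), f p j ≤ Real.exp (∑ p ∈ P, ff (s*p)) := by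
    rw [Real.exp_sum, ← Finset.prod_coe_sort P]
    apply Finset.prod_le_prod
    · intro p _
      apply Finset.sum_nonneg
      intro j _
      simp only [hf]
      split_ifs <;> positivity
    · intro p _
      have hp := (Finset.mem_filter.1 p.2).2.pos
      have : (0:ℝ) < s * (p:ℕ) := by positivity
      exact partial_log _ this m
  calc _ ≤ _ := step1
    _ ≤ (m:ℝ) ^ (m / (y^2+1) + y) * ((m.factorial : ℝ) * Real.exp (s*m) * Real.exp (∑ p ∈ P, ff (s*p))) := by
        gcongr
        exact step2.trans (by gcongr)
    _ = _ := by rw [Real.exp_add]; ring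

end SAux

namespace SAux
open Filter Topology

noncomputable def MM (m : ℕ) : ℝ := (∑ σ : Equiv.Perm (Fin m), (orderOf σ : ℝ)) / (m.factorial : ℝ)

lemma MM_pos (m : ℕ) : 0 < MM m := by
  unfold MM
  apply div_pos _ (by positivity)
  apply Finset.sum_pos
  · intro σ _
    exact_mod_cast orderOf_pos σ
  · exact Finset.univ_nonempty

lemma log_pow_small (k : ℕ) (c : ℝ) : ∀ᶠ m : ℕ in atTop, c * Real.log m ^ k ≤ √(m:ℝ) := by
  have h := (Real.isLittleO_pow_log_id_atTop (n := 2*k)).comp_tendsto (tendsto_natCast_atTop_atTop (R := ℝ))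
  have hb := h.bound (c := 1/(c^2+1)) (by positivity)
  filter_upwards [hb, tlog.eventually_ge_atTop 1] with m hm hL
  simp only [comp_apply, id, Real.norm_eq_abs] at hm
  rw [abs_of_nonneg (by positivity), abs_of_nonneg (by positivity), one_div_mul_eq_div, le_div_iff₀ (by positivity)] at hm
  apply Real.le_sqrt_of_sq_le
  rw [mul_pow, ← pow_mul, mul_comm k 2]
  have : 0 ≤ Real.log m ^ (2*k) := by positivity
  nlinarith

lemma rfacts (m : ℕ) (hm : 1 ≤ m) (hL : 1 ≤ Real.log m) :
    0 < √((m:ℝ)/Real.log m) ∧ √((m:ℝ)*Real.log m) = Real.log m * √((m:ℝ)/Real.log m) ∧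
    (m:ℝ) = Real.log m * √((m:ℝ)/Real.log m)^2 := by
  have hm0 : (0:ℝ) < m := by exact_mod_cast hm
  have hL0 : 0 < Real.log m := by linarith
  have h3 : (m:ℝ) = Real.log m * √((m:ℝ)/Real.log m)^2 := by
    rw [Real.sq_sqrt (by positivity)]; field_simp
  refine ⟨by positivity, ?_, h3⟩
  rw [show (m:ℝ) * Real.log m = (Real.log m)^2 * (m/Real.log m) by field_simp,
    Real.sqrt_mul (by positivity), Real.sqrt_sq hL0.le]

lemma upper_final : ∃ C > 0, ∀ᶠ m : ℕ in atTop,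
    Real.log (MM m) ≤ √(8*II) * √((m:ℝ)/Real.log m) + C * √m / Real.log m := by
  set κ := √(2*II) with hκ
  have hII := II_pos
  have hκ0 : 0 < κ := by positivity
  have hκ2 : κ^2 = 2*II := Real.sq_sqrt (by positivity)
  have h8 : √(8*II) = 2*κ := by
    rw [hκ, show 8*II = 2^2*(2*II) by ring, Real.sqrt_mul (by positivity), Real.sqrt_sq (by norm_num)]
  obtain ⟨C, hC, hps⟩ := prime_sum κ κ hκ0
  refine ⟨2*C+2, by positivity, ?_⟩
  filter_upwards [hps, AB_facts, tlog.eventually_ge_atTop 1, eventually_ge_atTop 1, log_pow_small 6 2] with m hps hAB hL hm h6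
  obtain ⟨hr, hr1, hr2⟩ := rfacts m hm hL
  obtain ⟨-, hABle, -, hA1, -, hA3, -⟩ := hAB
  set r := √((m:ℝ)/Real.log m)
  set L := Real.log m with hLdef
  have hL0 : 0 < L := by linarith
  have hm0 : (0:ℝ) < m := by exact_mod_cast hm
  obtain ⟨hp1, hp2⟩ := hps κ le_rfl le_rfl _ rfl
  set s := κ/√((m:ℝ)*L) with hs
  have hs0 : 0 < s := by rw [hs, hr1]; positivity
  have hsm : s*m = κ*r := by
    rw [hs, hr1]
    conv_lhs => rw [hr2]
    field_simp
  have hsL : 2*II/(s*L) = κ*r := by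
    rw [← hκ2, hs, hr1]; field_simp
  rw [hsL] at hp1
  have hu := upper1 m (Am m) hm s hs0
  have hsumle : ∑ p ∈ (Finset.Ioc (Am m) m).filter Nat.Prime, ff (s*p) ≤ pS (Am m) (Bm m) s + ∑ n ∈ Finset.Ioc (Bm m) m, ff (s*n) := by
    have hpos : ∀ n : ℕ, 0 < n → 0 ≤ ff (s*n) := fun n hn => (ff_pos (by have : (0:ℝ) < n := by exact_mod_cast hn
                                                                         positivity)).le
    have h1 : pS (Am m) (Bm m) s = ∑ p ∈ (Finset.Ioc (Am m) (Bm m)).filter Nat.Prime, ff (s*p) := by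
      rw [pS, Finset.sum_filter]
    have hdisj : Disjoint ((Finset.Ioc (Am m) (Bm m)).filter Nat.Prime) (Finset.Ioc (Bm m) m) := by
      rw [Finset.disjoint_left]
      intro a ha hb
      have := (Finset.mem_Ioc.1 (Finset.mem_filter.1 ha).1).2
      have := (Finset.mem_Ioc.1 hb).1
      omega
    rw [h1, ← Finset.sum_union hdisj]
    apply Finset.sum_le_sum_of_subset_of_nonneg
    · intro p hp
      obtain ⟨h3, h4⟩ := Finset.mem_filter.1 hp
      have h5 := Finset.mem_Ioc.1 h3
      rw [Finset.mem_union]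
      by_cases h : p ≤ Bm m
      · left; exact Finset.mem_filter.2 ⟨Finset.mem_Ioc.2 ⟨h5.1, h⟩, h4⟩
      · right; exact Finset.mem_Ioc.2 ⟨by omega, h5.2⟩
    · intro i hi _
      apply hpos
      rcases Finset.mem_union.1 hi with h | h
      · exact (Finset.mem_filter.1 h).2.pos
      · exact Nat.pos_of_ne_zero (by have := (Finset.mem_Ioc.1 h).1; omega)
  have hlog := Real.log_le_log (MM_pos m) hu
  rw [Real.log_mul (by positivity) (Real.exp_pos _).ne', Real.log_pow, Real.log_exp, ← hLdef] at hlog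
  have hE : ((m / (Am m ^2+1) + Am m : ℕ) : ℝ) * L ≤ 2 * √m / L := by
    have h1 : ((m / (Am m ^2+1) + Am m : ℕ) : ℝ) ≤ (m:ℝ) / ((Am m:ℝ)^2+1) + Am m := by
      push_cast
      gcongr
      have := @Nat.cast_div_le ℝ _ _ _ m (Am m ^2+1)
      push_cast at this
      exact this
    have h2 : (m:ℝ) / ((Am m:ℝ)^2+1) ≤ 2*L^4 := by
      rw [div_le_iff₀ (by positivity)]
      have h4 : (√m/L^2)^2 ≤ ((Am m:ℝ)+1)^2 := by gcongr
      have h5 : ((Am m:ℝ)+1)^2 ≤ 2*((Am m:ℝ)^2+1) := by nlinarith [sq_nonneg ((Am m:ℝ)-1)]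
      have h7 : (√m/L^2)^2 * L^4 = m := by
        rw [div_pow, Real.sq_sqrt hm0.le]; field_simp
      have : 0 < L^4 := by positivity
      nlinarith
    have h3 : 2*L^4 ≤ √m/L^2 := by
      rw [le_div_iff₀ (by positivity)]; linarith
    calc _ ≤ (√m/L^2 + √m/L^2) * L := by gcongr; linarith
      _ = _ := by field_simp; ring
  have := (abs_le.1 hp1).2
  rw [h8]
  have e : (2*C+2) * √m/L = C*√m/L + C*√m/L + 2*√m/L := by ring
  unfold MM at *
  linarith

end SAux

namespace SAux
open Filter Topology

noncomputable def Dx (S : Finset ℕ) (x : ↥S → ℕ) : Finset ℕ :=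
  (Finset.univ.filter (fun p : ↥S => x p ≠ 0)).image (fun p : ↥S => (p:ℕ) * x p)

def Nx (S : Finset ℕ) (x : ↥S → ℕ) : ℕ := ∑ p : ↥S, (p:ℕ) * x p

lemma xprime (S : Finset ℕ) (A : ℕ) (hS : ∀ p ∈ S, p.Prime ∧ A < p) (x : ↥S → ℕ) (hx : ∀ p, x p ≤ A)
    (p q : ↥S) (hq : x q ≠ 0) (h : (p:ℕ) ∣ (q:ℕ) * x q) : p = q := by
  obtain ⟨hp1, hp2⟩ := hS p p.2
  obtain ⟨hq1, hq2⟩ := hS q q.2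
  rcases (Nat.Prime.dvd_mul hp1).1 h with h | h
  · exact Subtype.ext ((Nat.prime_dvd_prime_iff_eq hp1 hq1).1 h)
  · have := Nat.le_of_dvd (Nat.pos_of_ne_zero hq) h
    have := hx q
    omega

lemma Dx_injOn (S : Finset ℕ) (A : ℕ) (hS : ∀ p ∈ S, p.Prime ∧ A < p) (x : ↥S → ℕ) (hx : ∀ p, x p ≤ A) :
    Set.InjOn (fun p : ↥S => (p:ℕ) * x p) (Finset.univ.filter (fun p : ↥S => x p ≠ 0)) := by
  intro p hp q hq h
  simp only at h
  exact xprime S A hS x hx p q (Finset.mem_filter.1 hq).2 (h ▸ dvd_mul_right _ _)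

lemma Dx_inj (S : Finset ℕ) (A : ℕ) (hS : ∀ p ∈ S, p.Prime ∧ A < p) (x y : ↥S → ℕ) (hx : ∀ p, x p ≤ A)
    (hy : ∀ p, y p ≤ A) (h : Dx S x = Dx S y) : x = y := by
  have key : ∀ (x y : ↥S → ℕ), (∀ p, y p ≤ A) → Dx S x = Dx S y → ∀ p, x p ≠ 0 → x p = y p := by
    intro x y hy h p hp
    have h1 : (p:ℕ) * x p ∈ Dx S x := Finset.mem_image.2 ⟨p, Finset.mem_filter.2 ⟨Finset.mem_univ _, hp⟩, rfl⟩
    rw [h] at h1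
    obtain ⟨q, hq, he⟩ := Finset.mem_image.1 h1
    have hpq := xprime S A hS y hy p q (Finset.mem_filter.1 hq).2 (he ▸ dvd_mul_right _ _)
    subst hpq
    exact (Nat.eq_of_mul_eq_mul_left (hS p p.2).1.pos he).symm
  funext p
  by_cases h1 : x p = 0
  · by_cases h2 : y p = 0
    · rw [h1, h2]
    · exact (key y x hx h.symm p h2).symm
  · exact key x y hy h p h1

lemma count_fact_le (D : Finset ℕ) (r : ℕ) :
    ∏ n ∈ (D.val + {r}).toFinset, (((D.val + {r}).count n).factorial : ℝ) ≤ 2 := by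
  calc _ ≤ ∏ n ∈ (D.val + {r}).toFinset, (if n = r then (2:ℝ) else 1) := by
        apply Finset.prod_le_prod
        · intros; positivity
        · intro n _
          have h1 : Multiset.count n D.val ≤ 1 := Multiset.nodup_iff_count_le_one.1 D.nodup n
          rw [Multiset.count_add, Multiset.count_singleton]
          split_ifs with h
          · have : (Multiset.count n D.val + 1).factorial ≤ (2).factorial := Nat.factorial_le (by omega)
            exact_mod_cast this
          · have : (Multiset.count n D.val + 0).factorial ≤ (1).factorial := Nat.factorial_le (by omega)
            exact_mod_cast this
    _ ≤ 2 := by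
        rw [Finset.prod_ite_eq']
        split_ifs <;> norm_num

lemma lower_one (m A : ℕ) (S : Finset ℕ) (hS : ∀ p ∈ S, p.Prime ∧ A < p) (x : ↥S → ℕ) (hx : ∀ p, x p ≤ A)
    (hN : Nx S x + 2 ≤ m) :
    (m.factorial : ℝ) * ∏ p : ↥S, (if x p = 0 then (1:ℝ) else 1/(x p)) ≤
      2*m*∑ σ ∈ Finset.univ.filter (fun σ : Equiv.Perm (Fin m) => σ.cycleType = (Dx S x).val + {m - Nx S x}), (orderOf σ : ℝ) := by
  set R := Finset.univ.filter (fun p : ↥S => x p ≠ 0) with hR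
  have hinj := Dx_injOn S A hS x hx
  rw [← hR] at hinj
  set r := m - Nx S x with hr
  set c := (Dx S x).val + {r} with hc
  have hRm : ∀ p ∈ R, x p ≠ 0 := fun p hp => (Finset.mem_filter.1 hp).2
  have hsumD : (Dx S x).val.sum = Nx S x := by
    rw [Finset.sum_val, Dx, ← hR, Nx]
    rw [Finset.sum_image hinj, hR, Finset.sum_filter]
    apply Finset.sum_congr rfl
    intro p _
    by_cases h : x p = 0 <;> simp [h]
  have hsum : c.sum = m := by
    rw [hc, Multiset.sum_add, hsumD, Multiset.sum_singleton]; omega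
  have h2 : ∀ a ∈ c, 2 ≤ a := by
    intro a ha
    rcases Multiset.mem_add.1 ha with h | h
    · obtain ⟨p, hp, rfl⟩ := Finset.mem_image.1 (show a ∈ Dx S x from h)
      exact (hS p p.2).1.two_le.trans (Nat.le_mul_of_pos_right _ (Nat.pos_of_ne_zero (hRm p hp)))
    · rw [Multiset.mem_singleton] at h; omega
  have hprod : (c.prod : ℝ) = (∏ p ∈ R, ((p:ℕ):ℝ)) * (∏ p ∈ R, (x p:ℝ)) * r := by
    rw [hc, Multiset.prod_add, Multiset.prod_singleton, Finset.prod_val, Dx, ← hR,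
      Finset.prod_image hinj, Nat.cast_mul, Nat.cast_prod, ← Finset.prod_mul_distrib]
    congr 1
    apply Finset.prod_congr rfl
    intro p _
    simp
  have hct := card_ct m c hsum.le h2
  rw [hsum, Nat.sub_self, Nat.factorial_zero, Nat.cast_one, one_mul, hprod] at hct
  have hcf := count_fact_le (Dx S x) r
  rw [← hc] at hcf
  have hord : ∀ σ ∈ Finset.univ.filter (fun σ : Equiv.Perm (Fin m) => σ.cycleType = c), (∏ p ∈ R, ((p:ℕ):ℝ)) ≤ (orderOf σ : ℝ) := by
    intro σ hσ
    have hσ' := (Finset.mem_filter.1 hσ).2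
    have : ∏ p ∈ R, (p:ℕ) ∣ orderOf σ := by
      apply Finset.prod_dvd_of_isRelPrime
      · intro p hp q hq hne
        exact Nat.coprime_iff_isRelPrime.1 ((Nat.coprime_primes (hS p p.2).1 (hS q q.2).1).2 (fun h => hne (Subtype.ext h)))
      · intro p hp
        rw [← Equiv.Perm.lcm_cycleType, hσ']
        refine (dvd_mul_right (p:ℕ) (x p)).trans (Multiset.dvd_lcm ?_)
        exact Multiset.mem_add.2 (Or.inl (Finset.mem_image.2 ⟨p, hp, rfl⟩))
    have := Nat.le_of_dvd (orderOf_pos σ) this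
    exact_mod_cast this
  have hw : ∏ p : ↥S, (if x p = 0 then (1:ℝ) else 1/(x p)) = (∏ p ∈ R, (x p:ℝ))⁻¹ := by
    rw [hR, Finset.prod_filter, ← Finset.prod_inv_distrib]
    apply Finset.prod_congr rfl
    intro p _
    by_cases h : x p = 0 <;> simp [h]
  have hVpos : 0 < ∏ p ∈ R, (x p : ℝ) := by
    apply Finset.prod_pos
    intro p hp
    exact_mod_cast Nat.pos_of_ne_zero (hRm p hp)
  have hPpos : 0 ≤ ∏ p ∈ R, ((p:ℕ):ℝ) := Finset.prod_nonneg (fun i _ => Nat.cast_nonneg _)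
  have hs := Finset.card_nsmul_le_sum _ _ _ hord
  rw [nsmul_eq_mul] at hs
  rw [hw, ← div_eq_mul_inv, div_le_iff₀ hVpos, ← hct]
  have hrm : (r:ℝ) ≤ m := by exact_mod_cast Nat.sub_le _ _
  have hcf0 : 0 ≤ ∏ n ∈ c.toFinset, ((c.count n).factorial : ℝ) := Finset.prod_nonneg (fun _ _ => Nat.cast_nonneg _)
  have hK : (0:ℝ) ≤ ((Finset.univ.filter (fun σ : Equiv.Perm (Fin m) => σ.cycleType = c)).card : ℝ) := Nat.cast_nonneg _
  generalize ((Finset.univ.filter (fun σ : Equiv.Perm (Fin m) => σ.cycleType = c)).card : ℝ) = K at *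
  generalize ∏ n ∈ c.toFinset, ((c.count n).factorial : ℝ) = W at *
  generalize ∏ p ∈ R, ((p:ℕ):ℝ) = U at *
  generalize ∏ p ∈ R, (x p:ℝ) = V at *
  calc K * (U * V * r * W) = (K * U) * (V * (r * W)) := by ring
    _ ≤ (∑ σ ∈ Finset.univ.filter (fun σ : Equiv.Perm (Fin m) => σ.cycleType = c), (orderOf σ : ℝ)) * (V * (m * 2)) := by gcongr
    _ = _ := by ring

lemma lower1 (m A : ℕ) (S : Finset ℕ) (hS : ∀ p ∈ S, p.Prime ∧ A < p) :
    ∑ x ∈ (Fintype.piFinset (fun _ : ↥S => Finset.range (A+1))).filter (fun x => Nx S x + 2 ≤ m),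
      ∏ p : ↥S, (if x p = 0 then (1:ℝ) else 1/(x p)) ≤ 2*m*(m+1)*MM m := by
  set X := (Fintype.piFinset (fun _ : ↥S => Finset.range (A+1))).filter (fun x => Nx S x + 2 ≤ m) with hX
  have hXA : ∀ x ∈ X, (∀ p, x p ≤ A) ∧ Nx S x + 2 ≤ m := by
    intro x hx
    obtain ⟨h1, h2⟩ := Finset.mem_filter.1 hx
    refine ⟨fun p => ?_, h2⟩
    have := Fintype.mem_piFinset.1 h1 p
    exact Nat.lt_succ_iff.1 (Finset.mem_range.1 this)
  have hfac : (0:ℝ) < m.factorial := by positivity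
  have hMM : (m.factorial:ℝ) * MM m = ∑ σ : Equiv.Perm (Fin m), (orderOf σ : ℝ) := by
    unfold MM; field_simp
  rw [← Finset.sum_fiberwise_of_maps_to (t := Finset.range (m+1)) (g := fun x => m - Nx S x) (by
    intro x _
    exact Finset.mem_range.2 (by omega))]
  have key : ∀ r ∈ Finset.range (m+1), ∑ x ∈ X.filter (fun x => m - Nx S x = r), ∏ p : ↥S, (if x p = 0 then (1:ℝ) else 1/(x p)) ≤ 2*m*MM m := by
    intro r _
    set Y := X.filter (fun x => m - Nx S x = r) with hY
    have hYm : ∀ x ∈ Y, x ∈ X ∧ m - Nx S x = r := fun x hx => Finset.mem_filter.1 hx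
    set g : Multiset ℕ → ℝ := fun c => ∑ σ ∈ Finset.univ.filter (fun σ : Equiv.Perm (Fin m) => σ.cycleType = c), (orderOf σ : ℝ) with hg
    have h1 : (m.factorial : ℝ) * ∑ x ∈ Y, ∏ p : ↥S, (if x p = 0 then (1:ℝ) else 1/(x p)) ≤ 2*m*∑ x ∈ Y, g ((Dx S x).val + {r}) := by
      rw [Finset.mul_sum, Finset.mul_sum]
      apply Finset.sum_le_sum
      intro x hx
      obtain ⟨hx1, hx2⟩ := hYm x hx
      have := lower_one m A S hS x (hXA x hx1).1 (hXA x hx1).2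
      rw [hx2] at this
      exact this
    have hinj : Set.InjOn (fun x : ↥S → ℕ => (Dx S x).val + {r}) Y := by
      intro x hx y hy h
      have h := add_right_cancel h
      exact Dx_inj S A hS x y (hXA x (hYm x hx).1).1 (hXA y (hYm y hy).1).1 (Finset.val_injective h)
    have h2 : ∑ x ∈ Y, g ((Dx S x).val + {r}) ≤ ∑ σ : Equiv.Perm (Fin m), (orderOf σ : ℝ) := by
      rw [← Finset.sum_image (f := g) hinj, hg]
      simp only [Finset.sum_filter]
      rw [Finset.sum_comm]
      apply Finset.sum_le_sum
      intro σ _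
      rw [Finset.sum_ite_eq]
      split_ifs
      · exact le_rfl
      · positivity
    rw [← hMM] at h2
    have : (m.factorial : ℝ) * ∑ x ∈ Y, ∏ p : ↥S, (if x p = 0 then (1:ℝ) else 1/(x p)) ≤ m.factorial * (2*m*MM m) := by
      refine h1.trans ?_
      have := mul_le_mul_of_nonneg_left h2 (show (0:ℝ) ≤ 2*m by positivity)
      linarith
    exact le_of_mul_le_mul_left this hfac
  refine (Finset.sum_le_sum key).trans ?_
  rw [Finset.sum_const, Finset.card_range, nsmul_eq_mul]
  push_cast
  linarith

end SAux

namespace SAux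
open Filter Topology

noncomputable def wt (j : ℕ) : ℝ := if j = 0 then (1:ℝ) else 1/(j:ℝ)

lemma wt_nonneg (j : ℕ) : 0 ≤ wt j := by
  unfold wt; split_ifs <;> positivity

noncomputable def EE (A k : ℕ) (p t : ℝ) : ℝ :=
  ∑ j ∈ Finset.range (A+1), wt j * (p*j)^k * Real.exp (-(p*j*t))

noncomputable def Lam (A : ℕ) (S : Finset ℕ) (t : ℝ) : ℝ := ∑ p ∈ S, Real.log (EE A 0 p t)

lemma expsum_deriv {α : Type*} (F : Finset α) (a b : α → ℝ) (t : ℝ) :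
    HasDerivAt (fun t => ∑ i ∈ F, a i * Real.exp (-(b i * t))) (-∑ i ∈ F, a i * b i * Real.exp (-(b i * t))) t := by
  rw [← Finset.sum_neg_distrib]
  apply HasDerivAt.fun_sum
  intro i _
  have h : HasDerivAt (fun t : ℝ => -(b i * t)) (-(b i)) t := by
    simpa using ((hasDerivAt_id t).const_mul (b i)).fun_neg
  exact (h.exp.const_mul (a i)).congr_deriv (by ring)

lemma EE_deriv (A k : ℕ) (p t : ℝ) : HasDerivAt (EE A k p) (-EE A (k+1) p t) t := by
  have := expsum_deriv (Finset.range (A+1)) (fun j => wt j * (p*j)^k) (fun j => p*j) t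
  unfold EE
  convert this using 3
  ring

lemma EE_one_le (A : ℕ) (p t : ℝ) : 1 ≤ EE A 0 p t := by
  unfold EE
  have := Finset.single_le_sum (f := fun j : ℕ => wt j * (p*j)^0 * Real.exp (-(p*j*t))) (s := Finset.range (A+1))
    (fun j _ => by have := wt_nonneg j; positivity) (Finset.mem_range.2 (Nat.succ_pos A))
  simpa [wt] using this

lemma EE2_le (A : ℕ) (p s : ℝ) (hp : 0 < p) (hs : 0 < s) : EE A 2 p s ≤ 1/s^2 := by
  set u := Real.exp (-(p*s)) with hu
  have hps : 0 < p*s := by positivity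
  have hu0 : 0 < u := Real.exp_pos _
  have hu1 : u < 1 := by rw [hu, Real.exp_lt_one_iff]; linarith
  have hsum := hasSum_coe_mul_geometric_of_norm_lt_one (r := u) (by rw [Real.norm_eq_abs, abs_of_pos hu0]; exact hu1)
  have h1 := sum_le_hasSum (Finset.range (A+1)) (fun i _ => by positivity) hsum
  have h2 : EE A 2 p s = p^2 * ∑ j ∈ Finset.range (A+1), (j:ℝ) * u^j := by
    unfold EE
    rw [Finset.mul_sum]
    apply Finset.sum_congr rfl
    intro j _
    rw [hu, ← Real.exp_nat_mul]
    unfold wt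
    by_cases h : j = 0
    · simp [h]
    · have : (j:ℝ) ≠ 0 := by exact_mod_cast h
      rw [if_neg h]
      rw [show (j:ℝ) * -(p*s) = -(p*j*s) by ring]
      field_simp
  have h3 : u/(1-u)^2 ≤ 1/(p*s)^2 := by
    rw [div_le_div_iff₀ (by have : 0 < 1-u := by linarith
                            positivity) (by positivity)]
    have hsinh := Real.self_le_sinh_iff.2 (show 0 ≤ p*s/2 by positivity)
    rw [Real.sinh_eq] at hsinh
    set v := Real.exp (-(p*s/2)) with hv
    have hv0 : 0 < v := Real.exp_pos _
    have huv : u = v^2 := by rw [hu, hv, ← Real.exp_nat_mul]; congr 1; push_cast; ring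
    have hvi : Real.exp (p*s/2) = 1/v := by rw [hv, Real.exp_neg]; simp
    rw [hvi] at hsinh
    have h4 : p*s*v ≤ 1 - v^2 := by
      have : p*s ≤ 1/v - v := by linarith
      calc p*s*v ≤ (1/v - v)*v := by gcongr
        _ = _ := by field_simp
    have h5 : (p*s*v)^2 ≤ (1-v^2)^2 := by
      apply pow_le_pow_left₀ (by positivity) h4
    rw [huv]; nlinarith
  rw [h2]
  calc _ ≤ p^2 * (1/(p*s)^2) := by gcongr; exact h1.trans h3
    _ = _ := by field_simp

lemma Lam_deriv (A : ℕ) (S : Finset ℕ) (t : ℝ) :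
    HasDerivAt (Lam A S) (∑ p ∈ S, (-EE A 1 p t) / EE A 0 p t) t := by
  unfold Lam
  apply HasDerivAt.fun_sum
  intro p _
  exact (EE_deriv A 0 p t).log (by linarith [EE_one_le A p t])

noncomputable def ZZ (A k : ℕ) (S : Finset ℕ) (t : ℝ) : ℝ :=
  ∑ x ∈ Fintype.piFinset (fun _ : ↥S => Finset.range (A+1)), (∏ p : ↥S, wt (x p)) * (Nx S x : ℝ)^k * Real.exp (-((Nx S x : ℝ)*t))

lemma ZZ_deriv (A k : ℕ) (S : Finset ℕ) (t : ℝ) : HasDerivAt (ZZ A k S) (-ZZ A (k+1) S t) t := by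
  have := expsum_deriv (Fintype.piFinset (fun _ : ↥S => Finset.range (A+1))) (fun x => (∏ p : ↥S, wt (x p)) * (Nx S x : ℝ)^k) (fun x => (Nx S x : ℝ)) t
  unfold ZZ
  convert this using 3
  ring

lemma ZZ_eq (A : ℕ) (S : Finset ℕ) (t : ℝ) : ZZ A 0 S t = Real.exp (Lam A S t) := by
  unfold Lam ZZ
  rw [Real.exp_sum, ← Finset.prod_coe_sort S]
  have : ∀ p : ↥S, Real.exp (Real.log (EE A 0 (p:ℕ) t)) = ∑ j ∈ Finset.range (A+1), wt j * Real.exp (-((p:ℕ)*j*t)) := by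
    intro p
    rw [Real.exp_log (by linarith [EE_one_le A (p:ℕ) t])]
    simp [EE]
  rw [Finset.prod_congr rfl (fun p _ => this p), Finset.prod_univ_sum]
  apply Finset.sum_congr rfl
  intro x _
  rw [Finset.prod_mul_distrib, ← Real.exp_sum, pow_zero, mul_one, Finset.sum_neg_distrib, ← Finset.sum_mul]
  unfold Nx
  push_cast
  rfl

lemma cheb (A : ℕ) (S : Finset ℕ) (hS : ∀ p ∈ S, 0 < p) (s μ : ℝ) (hs : 0 < s)
    (hd : HasDerivAt (Lam A S) (-μ) s) :
    ZZ A 2 S s - 2*μ*ZZ A 1 S s + μ^2*ZZ A 0 S s ≤ ZZ A 0 S s * (S.card/s^2) := by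
  set L1 : ℝ → ℝ := fun t => ∑ p ∈ S, (-EE A 1 p t) / EE A 0 p t with hL1
  have h0 : L1 s = -μ := (Lam_deriv A S s).unique hd
  have h1 : ∀ t, ZZ A 1 S t = -(ZZ A 0 S t * L1 t) := by
    intro t
    have e1 := ZZ_deriv A 0 S t
    have e2 := (Lam_deriv A S t).exp
    have e3 : ZZ A 0 S = fun t => Real.exp (Lam A S t) := funext (ZZ_eq A S)
    rw [e3] at e1
    have := e1.unique e2
    rw [ZZ_eq]
    linarith
  set L2 : ℝ := ∑ p ∈ S, (EE A 2 p s * EE A 0 p s - (EE A 1 p s)^2) / (EE A 0 p s)^2 with hL2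
  have hL1d : HasDerivAt L1 L2 s := by
    apply HasDerivAt.fun_sum
    intro p _
    exact ((EE_deriv A 1 p s).fun_neg.fun_div (EE_deriv A 0 p s) (by linarith [EE_one_le A p s])).congr_deriv (by ring)
  have h2 : ZZ A 2 S s = ZZ A 1 S s * (-L1 s) + ZZ A 0 S s * L2 := by
    have e1 := ZZ_deriv A 1 S s
    have e2 := ((ZZ_deriv A 0 S s).mul hL1d).neg
    have e3 : ZZ A 1 S = -(ZZ A 0 S * L1) := funext h1
    have e4 : HasDerivAt (ZZ A 1 S) (-(-ZZ A (0+1) S s * L1 s + ZZ A 0 S s * L2)) s := by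
      rw [← e3] at e2; exact e2
    have := e1.unique e4
    simp only [zero_add] at this
    linarith
  have hL2le : L2 ≤ S.card/s^2 := by
    have : ∀ p ∈ S, (EE A 2 p s * EE A 0 p s - (EE A 1 p s)^2) / (EE A 0 p s)^2 ≤ 1/s^2 := by
      intro p hp
      have hp0 : (0:ℝ) < p := by exact_mod_cast hS p hp
      have a1 := EE_one_le A p s
      have a2 := EE2_le A p s hp0 hs
      have a3 : 0 < 1/s^2 := by positivity
      rw [div_le_iff₀ (by positivity)]
      have : EE A 2 p s * EE A 0 p s ≤ 1/s^2 * (EE A 0 p s)^2 := by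
        have b1 := mul_le_mul_of_nonneg_right a2 (show 0 ≤ EE A 0 p s by linarith)
        have b2 : EE A 0 p s ≤ (EE A 0 p s)^2 := by nlinarith
        have b3 := mul_le_mul_of_nonneg_left b2 a3.le
        linarith
      nlinarith [sq_nonneg (EE A 1 p s)]
    have := Finset.sum_le_card_nsmul S _ _ this
    rw [nsmul_eq_mul] at this
    rw [hL2]
    refine this.trans (le_of_eq (by ring))
  have hZ : 0 < ZZ A 0 S s := by rw [ZZ_eq]; exact Real.exp_pos _
  rw [h2, h1 s, h0]
  nlinarith [mul_le_mul_of_nonneg_left hL2le hZ.le]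

lemma lower2 (m A : ℕ) (S : Finset ℕ) (hS : ∀ p ∈ S, p.Prime ∧ A < p) (s μ d : ℝ) (hs : 0 < s) (hd0 : 0 < d)
    (hd : HasDerivAt (Lam A S) (-μ) s) (hvar : (S.card:ℝ)/s^2 ≤ d^2/2) (hm : μ + d + 2 ≤ m) :
    Real.exp (Lam A S s + s*(μ-d)) ≤ 4*m*(m+1)*MM m := by
  have hc := cheb A S (fun p hp => (hS p hp).1.pos) s μ hs hd
  have hl := lower1 m A S hS
  have hZ : ZZ A 0 S s = Real.exp (Lam A S s) := ZZ_eq A S s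
  set X := Fintype.piFinset (fun _ : ↥S => Finset.range (A+1)) with hX
  set W : (↥S → ℕ) → ℝ := fun x => ∏ p : ↥S, wt (x p) with hW
  have hW0 : ∀ x, 0 ≤ W x := fun x => Finset.prod_nonneg (fun p _ => wt_nonneg _)
  have hexp : ZZ A 2 S s - 2*μ*ZZ A 1 S s + μ^2*ZZ A 0 S s = ∑ x ∈ X, W x * Real.exp (-((Nx S x:ℝ)*s)) * ((Nx S x:ℝ) - μ)^2 := by
    unfold ZZ
    rw [Finset.mul_sum, Finset.mul_sum, ← Finset.sum_sub_distrib, ← Finset.sum_add_distrib]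
    apply Finset.sum_congr rfl
    intro x _
    simp only [hW]
    ring
  have hpt : ∀ x ∈ X, W x * Real.exp (-((Nx S x:ℝ)*s)) ≤
      (if Nx S x + 2 ≤ m then W x * Real.exp (-(s*(μ-d))) else 0) + W x * Real.exp (-((Nx S x:ℝ)*s)) * ((Nx S x:ℝ) - μ)^2 * (1/d^2) := by
    intro x _
    have h1 : 0 ≤ W x * Real.exp (-((Nx S x:ℝ)*s)) := mul_nonneg (hW0 x) (Real.exp_pos _).le
    have h2 : 0 ≤ (if Nx S x + 2 ≤ m then W x * Real.exp (-(s*(μ-d))) else 0) := by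
      split_ifs
      · exact mul_nonneg (hW0 x) (Real.exp_pos _).le
      · exact le_rfl
    by_cases h : |(Nx S x:ℝ) - μ| ≤ d
    · have h' := abs_le.1 h
      have hle : Nx S x + 2 ≤ m := by
        have : (Nx S x:ℝ) + 2 ≤ m := by linarith
        exact_mod_cast this
      rw [if_pos hle]
      have h3 : Real.exp (-((Nx S x:ℝ)*s)) ≤ Real.exp (-(s*(μ-d))) := by
        apply Real.exp_le_exp.2
        nlinarith
      have h4 := mul_le_mul_of_nonneg_left h3 (hW0 x)
      have : 0 ≤ W x * Real.exp (-((Nx S x:ℝ)*s)) * ((Nx S x:ℝ) - μ)^2 * (1/d^2) := by positivity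
      linarith
    · push Not at h
      have h5 : d^2 ≤ ((Nx S x:ℝ) - μ)^2 := by
        rw [← sq_abs ((Nx S x:ℝ) - μ)]
        gcongr
      have h6 : 1 ≤ ((Nx S x:ℝ) - μ)^2 * (1/d^2) := by
        rw [mul_one_div, le_div_iff₀ (by positivity)]; linarith
      have := mul_le_mul_of_nonneg_left h6 h1
      linarith
  have hsum := Finset.sum_le_sum hpt
  rw [Finset.sum_add_distrib, ← Finset.sum_mul, ← hexp, ← Finset.sum_filter, ← Finset.sum_mul] at hsum
  have hZ0 : ∑ x ∈ X, W x * Real.exp (-((Nx S x:ℝ)*s)) = ZZ A 0 S s := by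
    unfold ZZ
    simp [hW, hX]
  rw [hZ0] at hsum
  have hWl : ∑ x ∈ X.filter (fun x => Nx S x + 2 ≤ m), W x ≤ 2*m*(m+1)*MM m := hl
  have hZpos : 0 < ZZ A 0 S s := by rw [hZ]; exact Real.exp_pos _
  have h7 : (ZZ A 2 S s - 2*μ*ZZ A 1 S s + μ^2*ZZ A 0 S s) * (1/d^2) ≤ ZZ A 0 S s / 2 := by
    rw [mul_one_div, div_le_iff₀ (by positivity)]
    have := mul_le_mul_of_nonneg_left hvar hZpos.le
    linarith
  have h8 : ZZ A 0 S s / 2 ≤ 2*m*(m+1)*MM m * Real.exp (-(s*(μ-d))) := by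
    have := mul_le_mul_of_nonneg_right hWl (Real.exp_pos (-(s*(μ-d)))).le
    linarith
  rw [Real.exp_add, ← hZ]
  have h9 := mul_le_mul_of_nonneg_right h8 (Real.exp_pos (s*(μ-d))).le
  have h10 : Real.exp (-(s*(μ-d))) * Real.exp (s*(μ-d)) = 1 := by rw [← Real.exp_add]; simp
  rw [mul_assoc (2*(m:ℝ)*(m+1)*MM m), h10] at h9
  linarith

lemma legendre (A : ℕ) (S : Finset ℕ) (a b c μ : ℝ) (hac : a < c) (hcb : c < b)
    (h1 : Lam A S c + c*μ < Lam A S a + a*μ) (h2 : Lam A S c + c*μ < Lam A S b + b*μ) :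
    ∃ s, a < s ∧ s < b ∧ HasDerivAt (Lam A S) (-μ) s := by
  set g : ℝ → ℝ := fun t => Lam A S t + t*μ with hg
  have hgd : ∀ t, HasDerivAt g ((∑ p ∈ S, (-EE A 1 p t) / EE A 0 p t) + μ) t := by
    intro t
    simpa using (Lam_deriv A S t).fun_add ((hasDerivAt_id t).mul_const μ)
  have hcont : Continuous g := continuous_iff_continuousAt.2 (fun t => (hgd t).continuousAt)
  obtain ⟨s, hs, hmin⟩ := isCompact_Icc.exists_isMinOn (Set.nonempty_Icc.2 (hac.le.trans hcb.le)) hcont.continuousOn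
  have hsc : g s ≤ g c := hmin ⟨hac.le, hcb.le⟩
  have hsa : s ≠ a := by rintro rfl; exact absurd hsc (not_le.2 h1)
  have hsb : s ≠ b := by rintro rfl; exact absurd hsc (not_le.2 h2)
  have has : a < s := lt_of_le_of_ne hs.1 hsa.symm
  have hsb' : s < b := lt_of_le_of_ne hs.2 hsb
  refine ⟨s, has, hsb', ?_⟩
  have hloc : IsLocalMin g s := hmin.isLocalMin (Icc_mem_nhds has hsb')
  have := hloc.hasDerivAt_eq_zero (hgd s)
  have h3 : -μ = ∑ p ∈ S, (-EE A 1 p s) / EE A 0 p s := by linarith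
  rw [h3]
  exact Lam_deriv A S s

end SAux

namespace SAux
open Filter Topology

lemma EE_up (A : ℕ) (p s : ℝ) (hp : 0 < p) (hs : 0 < s) : EE A 0 p s ≤ Real.exp (ff (s*p)) := by
  refine le_trans (le_of_eq ?_) (partial_log (s*p) (by positivity) A)
  unfold EE
  apply Finset.sum_congr rfl
  intro j _
  unfold wt
  by_cases h : j = 0
  · simp [h]
  · rw [if_neg h, if_neg h, pow_zero, show p*j*s = s*p*j by ring]
    ring

lemma EE_low (A : ℕ) (p s : ℝ) (hp : 0 < p) (hs : 0 < s) : Real.exp (ff (s*p)) ≤ EE A 0 p s + 1/((A+1)*(s*p)) := by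
  have ht : 0 < s*p := by positivity
  have h := ff_aux ht
  have h' := ff_log_neg ht
  set x := Real.exp (-(s*p)) with hx
  have hx0 : 0 < x := Real.exp_pos _
  have hx1 : x < 1 := by linarith [h.1]
  have hs1 := Real.hasSum_pow_div_log_of_abs_lt_one (x := x) (by rw [abs_of_pos hx0]; exact hx1)
  have hs2 : HasSum (fun n : ℕ => if n ∈ Finset.range A then x^(n+1)/((n:ℝ)+1) else 0) (∑ n ∈ Finset.range A, if n ∈ Finset.range A then x^(n+1)/((n:ℝ)+1) else 0) :=
    hasSum_sum_of_ne_finset_zero (fun n hn => if_neg hn)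
  have hs3 := (hasSum_geometric_of_lt_one hx0.le hx1).mul_left (x/((A:ℝ)+1))
  have hle := hasSum_le (fun n => ?_) hs1 (hs2.add hs3)
  · rw [ff, ← hx, Real.exp_log (by linarith)]
    have e1 : EE A 0 p s = 1 + ∑ n ∈ Finset.range A, if n ∈ Finset.range A then x^(n+1)/((n:ℝ)+1) else 0 := by
      unfold EE
      rw [Finset.sum_range_succ', add_comm]
      congr 1
      · simp [wt]
      · apply Finset.sum_congr rfl
        intro n hn
        rw [if_pos hn, hx, ← Real.exp_nat_mul, wt, if_neg (Nat.succ_ne_zero n), pow_zero]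
        push_cast
        rw [show ((n:ℝ)+1) * -(s*p) = -(p*(n+1)*s) by ring]
        ring
    have e2 : x/((A:ℝ)+1) * (1-x)⁻¹ ≤ 1/((A+1)*(s*p)) := by
      have h1x : 0 < 1 - x := by linarith
      have h3 : s*p*x ≤ 1 - x := by
        have := Real.add_one_le_exp (s*p)
        have h4 : x * Real.exp (s*p) = 1 := by rw [hx, ← Real.exp_add]; simp
        nlinarith
      rw [← div_eq_mul_inv, div_div, div_le_div_iff₀ (by positivity) (by positivity)]
      have : (0:ℝ) < A+1 := by positivity
      nlinarith
    linarith
  · have hA : 0 ≤ x/((A:ℝ)+1) * x^n := by positivity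
    split_ifs with hn
    · linarith
    · rw [zero_add, div_mul_eq_mul_div, pow_succ, mul_comm x]
      have : (A:ℝ) ≤ n := by
        have := Finset.mem_range.not.1 hn
        exact_mod_cast not_lt.1 this
      gcongr

lemma logEE_low (A : ℕ) (p s τ : ℝ) (hp : 0 < p) (hs : 0 < s) (hτ : 1/((A+1)*(s*p)) ≤ τ) (hτ2 : τ ≤ 1/2) :
    ff (s*p) - 2*τ ≤ Real.log (EE A 0 p s) := by
  have h0 := ff_pos (show 0 < s*p by positivity)
  have h1 := EE_low A p s hp hs
  have h2 : 1 ≤ Real.exp (ff (s*p)) := Real.one_le_exp h0.le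
  have hτ0 : 0 < τ := lt_of_lt_of_le (by positivity) hτ
  have h3 : Real.exp (ff (s*p)) * (1-τ) ≤ EE A 0 p s := by nlinarith
  have h4 : 0 < Real.exp (ff (s*p)) * (1-τ) := mul_pos (Real.exp_pos _) (by linarith)
  have h5 := Real.log_le_log h4 h3
  rw [Real.log_mul (Real.exp_pos _).ne' (by linarith), Real.log_exp] at h5
  have h6 := Real.one_sub_inv_le_log_of_pos (show 0 < 1 - τ by linarith)
  have h7 : (1-τ)⁻¹ ≤ 1 + 2*τ := by
    rw [inv_le_iff_one_le_mul₀ (by linarith)]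
    nlinarith
  linarith

noncomputable def Sm (m : ℕ) : Finset ℕ := (Finset.Ioc (Am m) (Bm m)).filter Nat.Prime

lemma Lam_near (c1 c2 : ℝ) (hc1 : 0 < c1) : ∃ C > 0, ∀ᶠ m : ℕ in atTop, ∀ κ, c1 ≤ κ → κ ≤ c2 →
    |Lam (Am m) (Sm m) (κ/√((m:ℝ)*Real.log m)) - 2*II*√((m:ℝ)/Real.log m)/κ| ≤ C*√m/Real.log m := by
  obtain ⟨C, hC, hps⟩ := prime_sum c1 c2 hc1
  refine ⟨C+1, by positivity, ?_⟩
  filter_upwards [hps, AB_facts, tlog.eventually_ge_atTop 1, eventually_ge_atTop 1, log_pow_small 8 (2/c1), log_pow_small 5 (2/c1)] with m hps hAB hL hm h8 h5 κ hκ1 hκ2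
  obtain ⟨hr, hr1, hr2⟩ := rfacts m hm hL
  obtain ⟨-, hABle, -, hA1, -, hA3, hB, -⟩ := hAB
  set r := √((m:ℝ)/Real.log m)
  set L := Real.log m with hLdef
  have hL0 : 0 < L := by linarith
  have hm0 : (0:ℝ) < m := by exact_mod_cast hm
  have hκ0 : 0 < κ := lt_of_lt_of_le hc1 hκ1
  obtain ⟨hp1, -⟩ := hps κ hκ1 hκ2 _ rfl
  set s := κ/√((m:ℝ)*L) with hs
  have hs0 : 0 < s := by rw [hs, hr1]; positivity
  have hsL : 2*II/(s*L) = 2*II*r/κ := by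
    rw [hs, hr1]; field_simp
  rw [hsL] at hp1
  have hpSe : pS (Am m) (Bm m) s = ∑ p ∈ Sm m, ff (s*p) := by
    rw [pS, Sm, Finset.sum_filter]
  have hSm : ∀ p ∈ Sm m, 0 < p ∧ Am m + 1 ≤ p := by
    intro p hp
    have := Finset.mem_filter.1 hp
    exact ⟨this.2.pos, (Finset.mem_Ioc.1 this.1).1⟩
  have hup : Lam (Am m) (Sm m) s ≤ pS (Am m) (Bm m) s := by
    rw [hpSe, Lam]
    apply Finset.sum_le_sum
    intro p hp
    have hp0 : (0:ℝ) < p := by exact_mod_cast (hSm p hp).1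
    rw [Real.log_le_iff_le_exp (by linarith [EE_one_le (Am m) p s])]
    exact EE_up _ _ _ hp0 hs0
  set τ := L^5/(c1*√m) with hτ
  have hsq : 0 < √(m:ℝ) := Real.sqrt_pos.2 hm0
  have hsqm : √(m:ℝ)^2 = m := Real.sq_sqrt hm0.le
  have hτ2 : τ ≤ 1/2 := by
    rw [hτ, div_le_div_iff₀ (by positivity) (by norm_num)]
    have : 2/c1*L^5*c1 ≤ √m*c1 := by gcongr
    have e : 2/c1*L^5*c1 = 2*L^5 := by field_simp
    linarith
  have hsge : c1/(√m*L) ≤ s := by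
    rw [hs, Real.sqrt_mul hm0.le]
    have : √L ≤ L := by
      rw [Real.sqrt_le_left hL0.le]; nlinarith
    have : 0 < √L := Real.sqrt_pos.2 hL0
    gcongr
  have hlow : pS (Am m) (Bm m) s - (Sm m).card * (2*τ) ≤ Lam (Am m) (Sm m) s := by
    rw [hpSe, Lam, ← nsmul_eq_mul, ← Finset.sum_const, ← Finset.sum_sub_distrib]
    apply Finset.sum_le_sum
    intro p hp
    have hp0 : (0:ℝ) < p := by exact_mod_cast (hSm p hp).1
    apply logEE_low _ _ _ _ hp0 hs0 _ hτ2
    have hpA : (Am m:ℝ)+1 ≤ p := by exact_mod_cast (hSm p hp).2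
    have h1 : (√m/L^2) * (c1/(√m*L) * (√m/L^2)) ≤ ((Am m:ℝ)+1)*(s*p) := by
      have : √m/L^2 ≤ p := by linarith
      gcongr
    have h2 : 1/τ ≤ (√m/L^2) * (c1/(√m*L) * (√m/L^2)) := by
      rw [hτ]
      apply le_of_eq
      field_simp
    have hτ0 : 0 < τ := by positivity
    rw [div_le_iff₀ (by positivity)]
    have := h2.trans h1
    rw [div_le_iff₀ hτ0] at this
    linarith
  have hcard : ((Sm m).card:ℝ) ≤ √m*L^2 := by
    refine le_trans ?_ hB
    have : (Sm m).card ≤ Bm m := by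
      refine (Finset.card_filter_le _ _).trans ?_
      rw [Nat.card_Ioc]; omega
    exact_mod_cast this
  have hτs : (Sm m).card * (2*τ) ≤ √m/L := by
    calc (Sm m).card * (2*τ) ≤ √m*L^2*(2*τ) := by gcongr
      _ = (2/c1*L^8)/L := by rw [hτ]; field_simp
      _ ≤ _ := by gcongr
  obtain ⟨q1, q2⟩ := abs_le.1 hp1
  have e : (C+1)*√m/L = C*√m/L + √m/L := by ring
  have : 0 < √m/L := by positivity
  rw [abs_le]
  constructor <;> linarith

lemma pow4_aux {x : ℝ} (hx : 4 ≤ x) : 4*x*(x+1) ≤ x^4 := by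
  have h3 : 16 * x^2 ≤ x^2 * x^2 := by gcongr; nlinarith
  nlinarith

set_option maxHeartbeats 1000000 in
lemma lower_final : ∃ C > 0, ∀ᶠ m : ℕ in atTop,
    √(8*II) * √((m:ℝ)/Real.log m) - C * √m / Real.log m ≤ Real.log (MM m) := by
  set κ := √(2*II) with hκ
  have hII := II_pos
  have hκ0 : 0 < κ := by positivity
  have hκ2 : κ^2 = 2*II := Real.sq_sqrt (by positivity)
  have h8 : √(8*II) = 2*κ := by
    rw [hκ, show 8*II = 2^2*(2*II) by ring, Real.sqrt_mul (by positivity), Real.sqrt_sq (by norm_num)]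
  obtain ⟨C, hC, hnear⟩ := Lam_near (κ/4) (4*κ) (by positivity)
  refine ⟨C+16*κ+1, by positivity, ?_⟩
  filter_upwards [hnear, AB_facts, tlog.eventually_ge_atTop 16, eventually_ge_atTop 4, log_pow_small 5 (32/κ^2), log_pow_small 2 4, tlog.eventually_ge_atTop ((2*C/κ)^2), log_pow_small 1 1]
    with m hnear hAB hL hm h5 h2 hLC hLm
  obtain ⟨hr, hr1, hr2⟩ := rfacts m (by omega) (by linarith)
  obtain ⟨-, hABle, -, hA1, -, hA3, hB, -⟩ := hAB
  set r := √((m:ℝ)/Real.log m) with hrdef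
  set L := Real.log m with hLdef
  have hL0 : 0 < L := by linarith
  have hm4 : (4:ℝ) ≤ m := by exact_mod_cast hm
  have hm0 : (0:ℝ) < m := by linarith
  have hsq : 0 < √(m:ℝ) := Real.sqrt_pos.2 hm0
  have hsqm : √(m:ℝ)^2 = m := Real.sq_sqrt hm0.le
  have hrle : r ≤ √m := by
    apply Real.sqrt_le_sqrt
    rw [div_le_iff₀ hL0]; nlinarith
  set e := C*√m/L with he
  have he0 : 0 < e := by positivity
  have hre : e ≤ κ*r/2 := by
    have hsL : 2*C/κ ≤ √L := Real.le_sqrt_of_sq_le hLC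
    have hsL0 : 0 < √L := Real.sqrt_pos.2 hL0
    have e1 : √(m:ℝ) = √L * r := by
      rw [hrdef, ← Real.sqrt_mul hL0.le]; congr 1; field_simp
    have e2 : √L*√L = L := Real.mul_self_sqrt hL0.le
    rw [he, div_le_iff₀ hL0, e1]
    rw [div_le_iff₀ hκ0] at hsL
    have : √L * r * (2*C) ≤ √L*r*(√L*κ) := by gcongr
    have e3 : √L*r*(√L*κ) = L*r*κ := by linear_combination r*κ*e2
    linarith
  set d := (m:ℝ)/L with hd
  have hd2 : 2 ≤ d := by
    rw [hd, le_div_iff₀ hL0]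
    have : L ≤ √m := by linarith
    nlinarith
  have hdr : d = r^2 := by
    rw [hd]; conv_lhs => rw [hr2]
    field_simp
  set μ := (m:ℝ) - d - 2 with hμ
  have hdm : d ≤ m/16 := by
    rw [hd]; gcongr
  have hμ0 : 0 ≤ μ := by
    rw [hμ]; linarith
  set S := Sm m with hSd
  set A := Am m with hAd
  set a := κ/4/√((m:ℝ)*L) with ha
  set b := 4*κ/√((m:ℝ)*L) with hb
  set c := κ/√((m:ℝ)*L) with hc
  have hq0 : 0 < √((m:ℝ)*L) := by rw [hr1]; positivity
  have hac : a < c := by rw [ha, hc]; gcongr; linarith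
  have hcb : c < b := by rw [hb, hc]; gcongr; linarith
  have hcm : c*m = κ*r := by
    rw [hc, hr1]
    conv_lhs => rw [hr2]
    field_simp
  have hbc : b = 4*c := by rw [hb, hc]; ring
  have hcd : c*d = κ*r/L := by
    rw [hc, hr1, hdr]; field_simp
  have hc0 : 0 < c := by positivity
  have ha0 : 0 < a := by positivity
  have nc := hnear κ (by linarith) (by linarith)
  have na := hnear (κ/4) (by linarith) (by linarith)
  rw [← hκ2, show κ^2*r/κ = κ*r by field_simp] at nc
  rw [← hκ2, show κ^2*r/(κ/4) = 4*(κ*r) by field_simp] at na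
  have nc2 := (abs_le.1 nc).2
  have na1 := (abs_le.1 na).1
  have hkr : 0 < κ*r := by positivity
  have hkrL : κ*r/L ≤ κ*r/16 := by gcongr
  have hLb : 0 ≤ Lam A S b := Finset.sum_nonneg (fun p _ => Real.log_nonneg (EE_one_le _ _ _))
  have hcμ : c*μ ≤ κ*r := by rw [← hcm]; gcongr; rw [hμ]; linarith
  have haμ : 0 ≤ a*μ := by positivity
  have hcdd : c*(d+2) ≤ κ*r/8 := by
    have : c*(d+2) ≤ c*(d+d) := by gcongr
    linarith
  have hbμ : 4*(κ*r) - κ*r/2 ≤ b*μ := by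
    rw [hbc, ← hcm]
    have : 4*c*μ = 4*(c*m) - 4*(c*(d+2)) := by rw [hμ]; ring
    rw [this, hcm]; linarith
  obtain ⟨s, has, hsb, hder⟩ := legendre A S a b c μ hac hcb (by linarith) (by linarith)
  have hs0 : 0 < s := ha0.trans has
  set k := s*√((m:ℝ)*L) with hk
  have hsk : s = k/√((m:ℝ)*L) := by rw [hk]; field_simp
  have hk1 : κ/4 ≤ k := by rw [ha, div_lt_iff₀ hq0] at has; exact has.le
  have hk2 : k ≤ 4*κ := by rw [hb, lt_div_iff₀ hq0] at hsb; exact hsb.le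
  have hk0 : 0 < k := by linarith
  have ns := hnear k hk1 hk2
  rw [← hsk, ← hκ2] at ns
  have ns1 := (abs_le.1 ns).1
  have hS : ∀ p ∈ S, p.Prime ∧ A < p := by
    intro p hp
    have := Finset.mem_filter.1 hp
    exact ⟨this.2, (Finset.mem_Ioc.1 this.1).1⟩
  have hcard : (S.card:ℝ) ≤ √m*L^2 := by
    refine le_trans ?_ hB
    have : S.card ≤ Bm m := by
      refine (Finset.card_filter_le _ _).trans ?_
      rw [Nat.card_Ioc]; omega
    exact_mod_cast this
  have hvar : (S.card:ℝ)/s^2 ≤ d^2/2 := by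
    have e1 : a^2 = κ^2/16/(m*L) := by
      rw [ha, div_pow, Real.sq_sqrt (by positivity)]; ring
    calc (S.card:ℝ)/s^2 ≤ √m*L^2/a^2 := by gcongr
      _ = (32/κ^2*L^5) * (√m*m/(2*L^2)) := by rw [e1]; field_simp; ring
      _ ≤ √m * (√m*m/(2*L^2)) := by gcongr
      _ = √m^2*m/(2*L^2) := by ring
      _ = d^2/2 := by rw [hsqm, hd]; field_simp
  have hfin := lower2 m A S hS s μ d hs0 (by linarith) hder hvar (by rw [hμ]; linarith)
  have hMM := MM_pos m
  have hlog := (Real.le_log_iff_exp_le (by positivity)).2 hfin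
  rw [Real.log_mul (by positivity) hMM.ne'] at hlog
  have h4L : Real.log (4*m*(m+1)) ≤ √m/L := by
    have h1 : Real.log (4*m*(m+1)) ≤ 4*L := by
      have : 4*L = Real.log ((m:ℝ)^4) := by rw [Real.log_pow]; norm_num [hLdef]
      rw [this]
      apply Real.log_le_log (by positivity)
      exact pow4_aux hm4
    refine h1.trans ?_
    rw [le_div_iff₀ hL0]; linarith
  have hsm : s*m = k*r := by
    rw [hsk, hr1]
    conv_lhs => rw [hr2]
    field_simp
  have hamgm : 2*κ*r ≤ κ^2*r/k + k*r := by
    have : κ^2*r/k + k*r - 2*κ*r = (κ-k)^2*r/k := by field_simp; ring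
    have : 0 ≤ (κ-k)^2*r/k := by positivity
    linarith
  have hsd : s*(2*d+2) ≤ 16*κ*√m/L := by
    calc s*(2*d+2) ≤ (4*c)*(2*d+2*d) := by
          rw [← hbc]; gcongr; linarith
      _ = 16*(c*d) := by ring
      _ = 16*κ*r/L := by rw [hcd]; ring
      _ ≤ _ := by gcongr
  have hexp : s*(μ-d) = s*m - s*(2*d+2) := by rw [hμ]; ring
  rw [hexp, hsm] at hlog
  have e9 : (C+16*κ+1)*√m/L = e + 16*κ*√m/L + √m/L := by rw [he]; ring
  rw [h8, e9]
  linarith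

end SAux

namespace IterMap

theorem I_eq : I = SAux.II := by
  unfold I SAux.II
  apply MeasureTheory.setIntegral_congr_fun measurableSet_Ioi
  intro t ht
  have h := SAux.ff_aux (show 0 < t from ht)
  simp only [SAux.ff]
  rw [Real.log_div (Real.exp_pos 1).ne' h.1.ne', Real.log_exp]

/-- Stong: the average order of a random permutation. -/
theorem stong :
    ∃ C : ℝ, ∃ N : ℕ, ∀ m : ℕ, N ≤ m →
      |Real.log (M m) - beta0 * Real.sqrt ((m : ℝ) / Real.log m)| ≤
        C * Real.sqrt m * Real.log (Real.log m) / Real.log m := by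
  obtain ⟨C1, h1, hu⟩ := SAux.upper_final
  obtain ⟨C2, h2, hl⟩ := SAux.lower_final
  have hM : ∀ m, M m = SAux.MM m := fun m => rfl
  have hb : beta0 = Real.sqrt (8 * SAux.II) := by unfold beta0; rw [I_eq]
  have hev := (hu.and hl).and ((SAux.tlog.eventually_ge_atTop (Real.exp 1)))
  obtain ⟨N, hN⟩ := Filter.eventually_atTop.1 hev
  refine ⟨C1 + C2, N, fun m hm => ?_⟩
  obtain ⟨⟨hu, hl⟩, hL⟩ := hN m hm
  have hL0 : 0 < Real.log m := lt_of_lt_of_le (Real.exp_pos 1) hL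
  have hLL : 1 ≤ Real.log (Real.log m) := (Real.le_log_iff_exp_le hL0).2 hL
  have hx : 0 ≤ Real.sqrt m / Real.log m := by positivity
  have hx2 : Real.sqrt m / Real.log m ≤ Real.sqrt m / Real.log m * Real.log (Real.log m) :=
    le_mul_of_one_le_right hx hLL
  have e : (C1 + C2) * Real.sqrt m * Real.log (Real.log m) / Real.log m =
      C1 * (Real.sqrt m / Real.log m * Real.log (Real.log m)) +
      C2 * (Real.sqrt m / Real.log m * Real.log (Real.log m)) := by ring
  have a1 := mul_le_mul_of_nonneg_left hx2 h1.le
  have a2 := mul_le_mul_of_nonneg_left hx2 h2.le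
  have b1 := mul_nonneg h1.le hx
  have b2 := mul_nonneg h2.le hx
  rw [mul_div_assoc] at hu hl
  rw [e, hM, hb, abs_le]
  constructor <;> linarith

end IterMap
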